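/- arXiv:1002.3448 — 3 statements merged into one kernel-verified Lean document; each statement's English description precedes it below -/
import Mathlib

section
/- Let (Q_n)_n be a sequence of probability distributions on ℝ^d, each with convex support having nonempty interior, such that Q_n converges weakly to a distribution Q whose convex support has nonempty interior, L(Q_n) → λ ∈ [−∞, ∞], and ∫ ‖x‖ Q_n(dx) → γ ∈ [0, ∞]. Then γ ≥ ∫ ‖x‖ Q(dx), and λ > −∞ if and only if γ < ∞. Moreover, λ < L(Q) if γ > ∫ ‖x‖ Q(dx), and λ = L(Q) ∈ ℝ if γ = ∫ ‖x‖ Q(dx) < ∞. In the latter case the densities f := exp∘ψ(·|Q) and f_n := exp∘ψ(·|Q_n) are well defined for sufficiently large n and satisfy: lim_{n→∞, x→y} f_n(x) = f(y) for all y ∈ ℝ^d \ ∂{f > 0}; limsup_{n→∞, x→y} f_n(x) ≤ f(y) for y ∈ ∂{f > 0}; and ∫ |f_n(x) − f(x)| dx → 0. -/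
open MeasureTheory Filter Topology Set
open scoped ENNReal RealInnerProductSpace BoundedContinuousFunction

noncomputable section

/-- Truncation of an extended real number to `ℝ≥0∞`. -/
def EReal.toENN (x : EReal) : ℝ≥0∞ := if x = ⊤ then ⊤ else ENNReal.ofReal x.toReal

/-- The real-valued exponential of an extended real number (`⊤` is sent to `0`,
but this value is never used for functions in the class `Φ`). -/
def EReal.expR (x : EReal) : ℝ := (EReal.exp x).toReal

/-- The class `Φ(d)`: upper semicontinuous, concave functions `φ : E → [-∞, ∞)`
which are coercive in the sense that `φ x → -∞` as `‖x‖ → ∞`. -/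
def IsPhi {E : Type*} [NormedAddCommGroup E] [NormedSpace ℝ E] (φ : E → EReal) : Prop :=
  UpperSemicontinuous φ ∧ (∀ x, φ x ≠ ⊤) ∧
  (∀ x y : E, ∀ a b : ℝ, 0 < a → 0 < b → a + b = 1 →
    (a : EReal) * φ x + (b : EReal) * φ y ≤ φ (a • x + b • y)) ∧
  Tendsto φ (Filter.comap (fun x : E => ‖x‖) atTop) (𝓝 ⊥)

/-- The integral of an `EReal`-valued function with respect to a measure,
defined as the difference of the integrals of the positive and negative parts. -/
def eint {E : Type*} [MeasurableSpace E] (Q : Measure E) (φ : E → EReal) : EReal :=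
  ((∫⁻ x, (φ x).toENN ∂Q : ℝ≥0∞) : EReal) - ((∫⁻ x, (-(φ x)).toENN ∂Q : ℝ≥0∞) : EReal)

/-- The log-likelihood-type functional `L(φ, Q) = ∫ φ dQ - ∫ e^{φ(x)} dx + 1`. -/
def Lfun {E : Type*} [NormedAddCommGroup E] [NormedSpace ℝ E] [MeasureSpace E]
    (φ : E → EReal) (Q : Measure E) : EReal :=
  eint Q φ - ((∫⁻ x, EReal.exp (φ x) : ℝ≥0∞) : EReal) + 1

/-- The profile log-likelihood `L(Q) = sup_{φ ∈ Φ} L(φ, Q)`. -/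
def Lprof {E : Type*} [NormedAddCommGroup E] [NormedSpace ℝ E] [MeasureSpace E]
    (Q : Measure E) : EReal :=
  ⨆ φ ∈ {φ : E → EReal | IsPhi φ}, Lfun φ Q

/-- The convex support of a measure: the intersection of all closed convex sets of full
measure. -/
def csupp {E : Type*} [NormedAddCommGroup E] [NormedSpace ℝ E] [MeasurableSpace E]
    (Q : Measure E) : Set E :=
  ⋂₀ {C : Set E | IsClosed C ∧ Convex ℝ C ∧ Q C = 1}

/-- `ψ` is the (a) maximizer of `L(·, Q)` over `Φ`, i.e. `ψ = ψ(·|Q)`. -/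
def IsMLE {E : Type*} [NormedAddCommGroup E] [NormedSpace ℝ E] [MeasureSpace E]
    (Q : Measure E) (ψ : E → EReal) : Prop :=
  IsPhi ψ ∧ ∀ φ : E → EReal, IsPhi φ → Lfun φ Q ≤ Lfun ψ Q

/-- Weak convergence of a sequence of measures. -/
def WConv {E : Type*} [NormedAddCommGroup E] [MeasurableSpace E]
    (Qn : ℕ → Measure E) (Q : Measure E) : Prop :=
  ∀ g : E →ᵇ ℝ, Tendsto (fun n => ∫ x, g x ∂(Qn n)) atTop (𝓝 (∫ x, g x ∂Q))

/-- The Mallows (Wasserstein-1, Kantorovich–Rubinstein) distance. -/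
def D1 {E : Type*} [NormedAddCommGroup E] [MeasurableSpace E] (Q Q' : Measure E) : ℝ :=
  sSup {r : ℝ | ∃ h : E → ℝ, LipschitzWith 1 h ∧ r = |(∫ x, h x ∂Q) - ∫ x, h x ∂Q'|}

/-- The bounded Lipschitz distance. -/
def DBL (Q Q' : Measure ℝ) : ℝ :=
  sSup {r : ℝ | ∃ h : ℝ → ℝ, (∀ x, |h x| ≤ 1) ∧ LipschitzWith 1 h ∧
    r = |(∫ x, h x ∂Q) - ∫ x, h x ∂Q'|}

/-- The Kolmogorov–Smirnov distance. -/
def DKS (Q Q' : Measure ℝ) : ℝ :=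
  ⨆ t : ℝ, |(Q' (Set.Iic t)).toReal - (Q (Set.Iic t)).toReal|

/-- Convolution of two measures. -/
def mconv {E : Type*} [NormedAddCommGroup E] [MeasurableSpace E] (Q R : Measure E) : Measure E :=
  (Q.prod R).map (fun p => p.1 + p.2)

/-- The empirical measure of a finite tuple of real numbers. -/
def empQ {n : ℕ} (v : Fin n → ℝ) : Measure ℝ :=
  ((n : ℝ≥0∞))⁻¹ • ∑ i, Measure.dirac (v i)

end



set_option linter.unusedSectionVars false

abbrev EE (d : ℕ) := EuclideanSpace ℝ (Fin d)

theorem toENN_eq (x : EReal) : x.toENN = x.toENNReal := rfl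

/-- real-variable form of concavity -/
def Conc {E : Type*} [NormedAddCommGroup E] [NormedSpace ℝ E] (φ : E → EReal) : Prop :=
  ∀ x y : E, ∀ a b : ℝ, 0 < a → 0 < b → a + b = 1 → ∀ s t : ℝ, (s : EReal) ≤ φ x →
    (t : EReal) ≤ φ y → ((a * s + b * t : ℝ) : EReal) ≤ φ (a • x + b • y)

section gen
variable {E : Type*} [NormedAddCommGroup E] [NormedSpace ℝ E] {φ : E → EReal}

theorem IsPhi.conc (h : IsPhi φ) : Conc φ := by
  intro x y a b ha hb hab s t hs ht
  refine le_trans ?_ (h.2.2.1 x y a b ha hb hab)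
  push_cast
  exact add_le_add (mul_le_mul_of_nonneg_left hs (by exact_mod_cast ha.le))
    (mul_le_mul_of_nonneg_left ht (by exact_mod_cast hb.le))

theorem Conc.le (h : Conc φ) {x y : E} {a b : ℝ} (ha : 0 ≤ a) (hb : 0 ≤ b) (hab : a + b = 1)
    {s t : ℝ} (hs : (s : EReal) ≤ φ x) (ht : (t : EReal) ≤ φ y) :
    ((a * s + b * t : ℝ) : EReal) ≤ φ (a • x + b • y) := by
  rcases ha.eq_or_lt with rfl | ha
  · have : b = 1 := by linarith
    subst this; simpa using ht
  rcases hb.eq_or_lt with rfl | hb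
  · have : a = 1 := by linarith
    subst this; simpa using hs
  exact h x y a b ha hb hab s t hs ht

theorem Conc.ereal (h : Conc φ) (htop : ∀ x, φ x ≠ ⊤) (x y : E) (a b : ℝ) (ha : 0 < a)
    (hb : 0 < b) (hab : a + b = 1) :
    (a : EReal) * φ x + (b : EReal) * φ y ≤ φ (a • x + b • y) := by
  by_cases hx : φ x = ⊥
  · rw [hx, EReal.coe_mul_bot_of_pos ha]; simp
  by_cases hy : φ y = ⊥
  · rw [hy, EReal.coe_mul_bot_of_pos hb]; simp
  have hx' := EReal.coe_toReal (htop x) hx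
  have hy' := EReal.coe_toReal (htop y) hy
  have := h x y a b ha hb hab _ _ hx'.le hy'.le
  push_cast at this
  rwa [hx', hy'] at this

theorem coercive_of_env {a b : ℝ} (hb : 0 < b)
    (h : ∀ x, φ x ≤ ((a - b * ‖x‖ : ℝ) : EReal)) :
    Tendsto φ (Filter.comap (fun x : E => ‖x‖) atTop) (𝓝 ⊥) := by
  have h1 : Tendsto (fun x : E => ((a - b * ‖x‖ : ℝ) : EReal))
      (Filter.comap (fun x : E => ‖x‖) atTop) (𝓝 ⊥) := by
    rw [EReal.tendsto_coe_nhds_bot_iff]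
    have : Tendsto (fun r : ℝ => a - b * r) atTop atBot := by
      have := (tendsto_id (α := ℝ) (x := atTop)).const_mul_atTop hb
      simpa [sub_eq_add_neg] using tendsto_atBot_add_const_left _ a (tendsto_neg_atTop_atBot.comp this)
    exact this.comp tendsto_comap
  exact tendsto_of_tendsto_of_tendsto_of_le_of_le tendsto_const_nhds h1 (fun _ => bot_le) h

theorem isPhi_of_env {a b : ℝ} (hb : 0 < b) (hu : UpperSemicontinuous φ) (hc : Conc φ)
    (h : ∀ x, φ x ≤ ((a - b * ‖x‖ : ℝ) : EReal)) : IsPhi φ := by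
  have ht : ∀ x, φ x ≠ ⊤ := fun x hx => by
    have := h x; rw [hx] at this; exact absurd (top_le_iff.1 this) (EReal.coe_ne_top _)
  exact ⟨hu, ht, hc.ereal ht, coercive_of_env hb h⟩

theorem IsPhi.meas [MeasurableSpace E] [BorelSpace E] (h : IsPhi φ) : Measurable φ :=
  h.1.measurable

theorem Conc.convex_ge (h : Conc φ) (t : ℝ) : Convex ℝ {x | (t : EReal) ≤ φ x} := by
  intro x hx y hy a b ha hb hab
  have := h.le ha hb hab hx hy
  change (t : EReal) ≤ _
  have e : a * t + b * t = t := by rw [← add_mul, hab, one_mul]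
  rwa [e] at this

theorem IsPhi.isClosed_ge (h : IsPhi φ) (t : EReal) : IsClosed {x | t ≤ φ x} := by
  have := h.1.isClosed_preimage t
  exact this

theorem Conc.convex_dom (h : Conc φ) : Convex ℝ {x | φ x ≠ ⊥} := by
  intro x hx y hy a b ha hb hab
  obtain ⟨s, hs⟩ := EReal.lt_iff_exists_real_btwn.1 (bot_lt_iff_ne_bot.2 hx)
  obtain ⟨t, ht⟩ := EReal.lt_iff_exists_real_btwn.1 (bot_lt_iff_ne_bot.2 hy)
  have := h.le ha hb hab hs.2.le ht.2.le
  exact fun h0 => absurd (le_bot_iff.1 (h0 ▸ this)) (EReal.coe_ne_bot _)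

/-- lower semicontinuity in the interior of the domain -/
theorem Conc.mem_interior [FiniteDimensional ℝ E] (h : Conc φ) (htop : ∀ x, φ x ≠ ⊤) {y : E}
    (hy : y ∈ interior {x | φ x ≠ ⊥}) {t : EReal} (ht : t < φ y) :
    y ∈ interior {x | t < φ x} := by
  set D := {x | φ x ≠ ⊥}
  have hco : ConcaveOn ℝ D (fun x => (φ x).toReal) := by
    refine ⟨h.convex_dom, ?_⟩
    intro x hx y hy a b ha hb hab
    have := h.le ha hb hab (EReal.coe_toReal (htop x) hx).le (EReal.coe_toReal (htop y) hy).le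
    simp only [smul_eq_mul]
    rw [← EReal.coe_toReal (htop _) (h.convex_dom hx hy ha hb hab)] at this
    exact_mod_cast this
  have hcont := hco.continuousOn_interior y hy
  have hcont : ContinuousAt (fun x => (φ x).toReal) y :=
    hcont.continuousAt (isOpen_interior.mem_nhds hy)
  have hD : y ∈ D := interior_subset hy
  have h2 : ContinuousAt φ y := by
    have : ContinuousAt (fun x => (((φ x).toReal : ℝ) : EReal)) y :=
      continuous_coe_real_ereal.continuousAt.comp hcont
    refine this.congr ?_
    filter_upwards [isOpen_interior.mem_nhds hy] with x hx
    exact EReal.coe_toReal (htop x) (interior_subset hx)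
  rw [mem_interior_iff_mem_nhds]
  exact h2.eventually (lt_mem_nhds ht)

/-- maximum exists -/
theorem IsPhi.exists_max [ProperSpace E] (h : IsPhi φ) {p : E} (hp : φ p ≠ ⊥) :
    ∃ m, ∀ x, φ x ≤ φ m := by
  have h1 : ∀ᶠ x in Filter.comap (fun x : E => ‖x‖) atTop, φ x < φ p :=
    h.2.2.2.eventually (gt_mem_nhds (bot_lt_iff_ne_bot.2 hp))
  rw [eventually_comap] at h1
  obtain ⟨R, hR⟩ := eventually_atTop.1 h1
  obtain ⟨m, hm, hmm⟩ := (h.1.upperSemicontinuousOn (Metric.closedBall 0 R)).exists_isMaxOn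
    (s := Metric.closedBall (0:E) R) ⟨p, by
      rw [mem_closedBall_zero_iff]; by_contra hc; push Not at hc
      exact lt_irrefl _ (hR _ hc.le p rfl)⟩ (isCompact_closedBall 0 R)
  have hpm : p ∈ Metric.closedBall (0:E) R := by
      rw [mem_closedBall_zero_iff]; by_contra hc; push Not at hc
      exact lt_irrefl _ (hR _ hc.le p rfl)
  refine ⟨m, fun x => ?_⟩
  by_cases hx : ‖x‖ ≤ R
  · exact hmm (mem_closedBall_zero_iff.2 hx)
  · exact (hR _ (not_le.1 hx).le x rfl).le.trans (hmm hpm)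

/-- ray argument -/
theorem Conc.ray (h : Conc φ) {x0 : E} {t0 a0 R0 : ℝ} (hR : 0 < R0)
    (h0 : (t0 : EReal) ≤ φ x0)
    (ha : ∀ x, φ x ≤ (a0 : EReal)) (hf : ∀ x, R0 ≤ ‖x - x0‖ → φ x ≤ ((t0 - 1 : ℝ) : EReal)) (x : E) :
    φ x ≤ ((a0 + 1 - ‖x - x0‖ / R0 : ℝ) : EReal) := by
  have hta : t0 ≤ a0 := by exact_mod_cast h0.trans (ha x0)
  by_cases hx : ‖x - x0‖ ≤ R0
  · refine (ha x).trans ?_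
    have : ‖x - x0‖ / R0 ≤ 1 := by rw [div_le_one hR]; exact hx
    exact_mod_cast (by linarith : a0 ≤ a0 + 1 - ‖x - x0‖ / R0)
  push Not at hx
  by_contra hcon
  push Not at hcon
  have hRR : 0 < ‖x - x0‖ := hR.trans hx
  set s := R0 / ‖x - x0‖ with hs
  have hs0 : 0 < s := by positivity
  have hs1 : s < 1 := by rw [hs, div_lt_one hRR]; exact hx
  have := h.le hs0.le (sub_nonneg.2 hs1.le) (by ring) hcon.le h0
  have h2 := this.trans (hf (s • x + (1 - s) • x0) (by
    have : s • x + (1 - s) • x0 - x0 = s • (x - x0) := by module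
    rw [this, norm_smul, Real.norm_of_nonneg hs0.le, hs]; field_simp; exact le_refl _))
  have h3 : s * (a0 + 1 - ‖x - x0‖ / R0) + (1 - s) * t0 ≤ t0 - 1 := by exact_mod_cast h2
  have h4 : s * (‖x - x0‖ / R0) = 1 := by rw [hs]; field_simp
  nlinarith

theorem env_shift {x0 : E} {c R0 : ℝ} (hR : 1 ≤ R0) (x : E) :
    c - ‖x - x0‖ / R0 ≤ c + ‖x0‖ - (1 / R0) * ‖x‖ := by
  have h1 : ‖x‖ ≤ ‖x - x0‖ + ‖x0‖ := by
    have := norm_add_le (x - x0) x0; simpa using this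
  have h0 : 0 < R0 := by linarith
  have h2 : ‖x‖ / R0 ≤ ‖x - x0‖ / R0 + ‖x0‖ / R0 := by
    rw [← add_div]; gcongr
  have h3 : ‖x0‖ / R0 ≤ ‖x0‖ := div_le_self (norm_nonneg _) hR
  have : 1 / R0 * ‖x‖ = ‖x‖ / R0 := by ring
  linarith

/-- every function in Φ has a linear envelope -/
theorem IsPhi.env [ProperSpace E] (h : IsPhi φ) :
    ∃ a b : ℝ, 0 < b ∧ b ≤ 1 ∧ ∀ x, φ x ≤ ((a - b * ‖x‖ : ℝ) : EReal) := by
  by_cases hp : ∃ p, φ p ≠ ⊥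
  swap
  · push Not at hp
    exact ⟨0, 1, one_pos, le_refl _, fun x => by rw [hp x]; exact bot_le⟩
  obtain ⟨p, hp⟩ := hp
  obtain ⟨m, hm⟩ := h.exists_max hp
  have h0 := EReal.coe_toReal (h.2.1 p) hp
  set t0 := (φ p).toReal
  have hmb : φ m ≠ ⊥ := fun hh => hp (le_bot_iff.1 (hh ▸ hm p))
  have hmr := EReal.coe_toReal (h.2.1 m) hmb
  set a0 := (φ m).toReal
  have h1 : ∀ᶠ x in Filter.comap (fun x : E => ‖x‖) atTop, φ x < ((t0 - 1 : ℝ) : EReal) :=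
    h.2.2.2.eventually (gt_mem_nhds (EReal.bot_lt_coe _))
  rw [eventually_comap] at h1
  obtain ⟨R, hR⟩ := eventually_atTop.1 h1
  have hR1 : 1 ≤ max 1 (R + ‖p‖) := le_max_left _ _
  have := h.conc.ray (x0 := p) (t0 := t0) (a0 := a0) (R0 := max 1 (R + ‖p‖)) (by linarith) h0.le
    (fun x => hmr ▸ hm x) (fun x hx => by
      refine (hR _ ?_ x rfl).le
      have h2 := norm_sub_le x p
      have h3 := le_max_right 1 (R + ‖p‖)
      linarith)
  refine ⟨a0 + 1 + ‖p‖, 1 / max 1 (R + ‖p‖), by positivity, ?_, fun x => (this x).trans ?_⟩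
  · rw [div_le_one (by linarith)]; exact hR1
  · exact_mod_cast env_shift hR1 x

end gen

/-- key identity -/
theorem eint_eq {E : Type*} [MeasurableSpace E] (Q : Measure E) {φ : E → EReal} {l : E → ℝ}
    (hφ : Measurable φ) (hl : Integrable l Q) (h : ∀ x, φ x ≤ (l x : EReal)) :
    eint Q φ = ((∫ x, l x ∂Q : ℝ) : EReal)
      - ((∫⁻ x, ((l x : EReal) - φ x).toENNReal ∂Q : ℝ≥0∞) : EReal) := by
  have hpt : ∀ x, (φ x).toENNReal + (ENNReal.ofReal (-l x) + ((l x : EReal) - φ x).toENNReal)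
      = (-(φ x)).toENNReal + ENNReal.ofReal (l x) := by
    intro x
    have hx := h x
    induction hφx : φ x with
    | bot => simp
    | top => rw [hφx] at hx; exact absurd (top_le_iff.1 hx) (EReal.coe_ne_top _)
    | coe r =>
      rw [hφx] at hx
      have hr : r ≤ l x := by exact_mod_cast hx
      rw [← EReal.coe_sub, ← EReal.coe_neg]
      simp only [EReal.toENNReal_of_ne_top (EReal.coe_ne_top _), EReal.toReal_coe]
      rcases le_total 0 r with h1 | h1 <;> rcases le_total 0 (l x) with h2 | h2 
      · rw [ENNReal.ofReal_of_nonpos (neg_nonpos.2 h1), ENNReal.ofReal_of_nonpos (neg_nonpos.2 h2),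
          zero_add, zero_add, ← ENNReal.ofReal_add h1 (by linarith)]; congr 1; ring
      · have : r = 0 := by linarith
        have h3 : l x = 0 := by linarith
        simp [this, h3]
      · rw [ENNReal.ofReal_of_nonpos h1, ENNReal.ofReal_of_nonpos (neg_nonpos.2 h2),
          zero_add, zero_add, ← ENNReal.ofReal_add (by linarith) (by linarith)]; congr 1; ring
      · rw [ENNReal.ofReal_of_nonpos h1, ENNReal.ofReal_of_nonpos h2,
          zero_add, add_zero, ← ENNReal.ofReal_add (by linarith) (by linarith)]; congr 1; ring
  have hm1 : Measurable fun x => (φ x).toENNReal := hφ.ereal_toENNReal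
  have hm2 : Measurable fun x => (-(φ x)).toENNReal := hφ.neg.ereal_toENNReal
  have hIntg := lintegral_congr (μ := Q) hpt
  rw [lintegral_add_left hm1, lintegral_add_left' (f := fun x => ENNReal.ofReal (-l x))
      (hl.aemeasurable.neg.ennreal_ofReal),
    lintegral_add_left hm2] at hIntg
  have hP : ∫⁻ x, ENNReal.ofReal (l x) ∂Q ≠ ⊤ := hl.lintegral_lt_top.ne
  have hN : ∫⁻ x, ENNReal.ofReal (-l x) ∂Q ≠ ⊤ := hl.neg.lintegral_lt_top.ne
  have hA : ∫⁻ x, (φ x).toENNReal ∂Q ≠ ⊤ := by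
    refine ne_top_of_le_ne_top hP (lintegral_mono fun x => ?_)
    have := EReal.toENNReal_le_toENNReal (h x)
    simpa using this
  have hI := integral_eq_lintegral_pos_part_sub_lintegral_neg_part hl
  unfold eint
  simp only [toENN_eq]
  rw [hI]
  generalize ∫⁻ x, (φ x).toENNReal ∂Q = A at *
  generalize ∫⁻ x, (-(φ x)).toENNReal ∂Q = B at *
  generalize ∫⁻ x, ((l x : EReal) - φ x).toENNReal ∂Q = D at *
  generalize ∫⁻ x, ENNReal.ofReal (l x) ∂Q = P at *
  generalize ∫⁻ x, ENNReal.ofReal (-l x) ∂Q = N at *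
  lift A to NNReal using hA
  lift P to NNReal using hP
  lift N to NNReal using hN
  by_cases hB : B = ⊤
  · have : D = ⊤ := by
      by_contra hD
      lift D to NNReal using hD
      rw [hB, top_add] at hIntg
      exact absurd hIntg (by exact_mod_cast ENNReal.coe_ne_top)
    rw [hB, this]
    simp [sub_eq_add_neg]
  · lift B to NNReal using hB
    have : D ≠ ⊤ := by
      intro hD
      rw [hD] at hIntg
      simp only [add_top] at hIntg
      exact absurd hIntg.symm (by exact_mod_cast ENNReal.coe_ne_top)
    lift D to NNReal using this
    have h3 : (A : ℝ) + (N + D) = B + P := by exact_mod_cast hIntg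
    simp only [EReal.coe_nnreal_eq_coe_real, ENNReal.coe_toReal]
    have h4 : ((A:ℝ) - B : ℝ) = (P - N) - D := by linarith
    exact_mod_cast congrArg (fun r : ℝ => (r : EReal)) h4

section L
variable {d : ℕ} {φ : EE d → EReal} {Q : Measure (EE d)}

/-- deficit functional -/
noncomputable def Dfun (l : EE d → ℝ) (φ : EE d → EReal) (Q : Measure (EE d)) : ℝ≥0∞ :=
  ∫⁻ x, ((l x : EReal) - φ x).toENNReal ∂Q + ∫⁻ x, EReal.exp (φ x)

theorem Lfun_eq {l : EE d → ℝ}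
    (hφ : Measurable φ) (hl : Integrable l Q) (h : ∀ x, φ x ≤ (l x : EReal)) :
    Lfun φ Q = ((∫ x, l x ∂Q + 1 : ℝ) : EReal) - ((Dfun l φ Q : ℝ≥0∞) : EReal) := by
  unfold Lfun Dfun
  rw [eint_eq Q hφ hl h]
  generalize ∫⁻ x, ((l x : EReal) - φ x).toENNReal ∂Q = D
  generalize ∫⁻ x, EReal.exp (φ x) = I
  generalize ∫ x, l x ∂Q = r
  by_cases hD : D = ⊤
  · simp [hD, sub_eq_add_neg]
  by_cases hI : I = ⊤
  · simp [hI, sub_eq_add_neg]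
  lift D to NNReal using hD
  lift I to NNReal using hI
  have : ((r - D - I + 1 : ℝ)) = (r + 1) - (D + I) := by ring
  rw [EReal.coe_ennreal_add, EReal.coe_nnreal_eq_coe_real, EReal.coe_nnreal_eq_coe_real]
  exact_mod_cast congrArg (fun r : ℝ => (r : EReal)) this

theorem Lfun_ge_iff {l : EE d → ℝ} {c : ℝ}
    (hφ : Measurable φ) (hl : Integrable l Q) (h : ∀ x, φ x ≤ (l x : EReal)) :
    (c : EReal) ≤ Lfun φ Q ↔ Dfun l φ Q ≠ ⊤ ∧ c + (Dfun l φ Q).toReal ≤ ∫ x, l x ∂Q + 1 := by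
  rw [Lfun_eq hφ hl h]
  generalize Dfun l φ Q = D
  by_cases hD : D = ⊤
  · simp [hD, sub_eq_add_neg]
  lift D to NNReal using hD
  simp only [ne_eq, ENNReal.coe_ne_top, not_false_eq_true, ENNReal.coe_toReal, true_and]
  have : (((∫ x, l x ∂Q + 1 : ℝ) : EReal) - (((D : ℝ≥0∞)) : EReal)) =
    (((∫ x, l x ∂Q + 1) - D : ℝ) : EReal) := by push_cast; rfl
  rw [this, EReal.coe_le_coe_iff]
  constructor <;> intro h <;> linarith

end L


section P2
variable {d : ℕ}

theorem sep_unit {C : Set (EE d)} (hC : IsClosed C) (hcv : Convex ℝ C) (hne : C.Nonempty)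
    {z : EE d} (hz : z ∉ C) : ∃ u : EE d, ‖u‖ = 1 ∧ ∀ y ∈ C, ⟪u, y⟫ < ⟪u, z⟫ := by
  obtain ⟨f, s, hf, hs⟩ := geometric_hahn_banach_closed_point hcv hC hz
  set w := (InnerProductSpace.toDual ℝ (EE d)).symm f with hw
  have hin : ∀ x, ⟪w, x⟫ = f x := fun x => InnerProductSpace.toDual_symm_apply
  obtain ⟨q, hq⟩ := hne
  have hw0 : w ≠ 0 := by
    intro h0
    have h1 := hin q; have h2 := hin z
    rw [h0, inner_zero_left] at h1 h2
    have := hf q hq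
    linarith
  have hwn : 0 < ‖w‖ := norm_pos_iff.2 hw0
  refine ⟨‖w‖⁻¹ • w, ?_, fun y hy => ?_⟩
  · rw [norm_smul, norm_inv, norm_norm, inv_mul_cancel₀ hwn.ne']
  · rw [real_inner_smul_left, real_inner_smul_left, hin, hin]
    have := hf y hy
    exact mul_lt_mul_of_pos_left (by linarith) (inv_pos.2 hwn)

def Fat (Q : Measure (EE d)) (x0 : EE d) (ε η : ℝ) : Prop :=
  ∀ C : Set (EE d), IsClosed C → Convex ℝ C → Q Cᶜ < ENNReal.ofReal η → Metric.ball x0 ε ⊆ C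

/-- bundled probability measure -/
def pmk (Q : Measure (EE d)) [h : IsProbabilityMeasure Q] : ProbabilityMeasure (EE d) := ⟨Q, h⟩

theorem tendstoPM {Qn : ℕ → Measure (EE d)} {Q : Measure (EE d)}
    [∀ n, IsProbabilityMeasure (Qn n)] [IsProbabilityMeasure Q] (hw : WConv Qn Q) :
    Tendsto (fun n => pmk (Qn n)) atTop (𝓝 (pmk Q)) := by
  rw [ProbabilityMeasure.tendsto_iff_forall_integral_tendsto]
  exact hw

theorem open_liminf {Qn : ℕ → Measure (EE d)} {Q : Measure (EE d)}
    [∀ n, IsProbabilityMeasure (Qn n)] [IsProbabilityMeasure Q] (hw : WConv Qn Q)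
    {U : Set (EE d)} (hU : IsOpen U) :
    Q U ≤ liminf (fun n => Qn n U) atTop :=
  ProbabilityMeasure.le_liminf_measure_open_of_tendsto (tendstoPM hw) hU

theorem fat_of_wconv {Qn : ℕ → Measure (EE d)} {Q : Measure (EE d)}
    [∀ n, IsProbabilityMeasure (Qn n)] [IsProbabilityMeasure Q]
    (hQ : (interior (csupp Q)).Nonempty) (hw : WConv Qn Q) :
    ∃ (x0 : EE d) (ε η : ℝ), 0 < ε ∧ 0 < η ∧ η ≤ 1 ∧ ∀ᶠ n in atTop, Fat (Qn n) x0 ε η := by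
  obtain ⟨x0, hx0⟩ := hQ
  obtain ⟨ε', hε', hball⟩ := Metric.isOpen_iff.1 isOpen_interior x0 hx0
  set ε := ε' / 4 with hεdef
  have hε : 0 < ε := by positivity
  refine ⟨x0, ε, ?_⟩
  -- positivity of halfspaces
  have hpos : ∀ u : EE d, ‖u‖ = 1 → Q {y | 2 * ε < ⟪u, y - x0⟫} ≠ 0 := by
    intro u hu h0
    have hcl : IsClosed {y : EE d | ⟪u, y - x0⟫ ≤ 2 * ε} :=
      isClosed_le (by fun_prop) continuous_const
    have hcv : Convex ℝ {y : EE d | ⟪u, y - x0⟫ ≤ 2 * ε} := by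
      intro y hy z hz a b ha hb hab
      have hy' : ⟪u, y - x0⟫ ≤ 2 * ε := hy
      have hz' : ⟪u, z - x0⟫ ≤ 2 * ε := hz
      change ⟪u, a • y + b • z - x0⟫ ≤ 2 * ε
      have : a • y + b • z - x0 = a • (y - x0) + b • (z - x0) := by
        have : x0 = (a + b) • x0 := by rw [hab, one_smul]
        nth_rewrite 1 [this]; module
      rw [this, inner_add_right, real_inner_smul_right, real_inner_smul_right]
      nlinarith
    have h1 : Q {y : EE d | ⟪u, y - x0⟫ ≤ 2 * ε} = 1 := by
      rw [← prob_compl_eq_zero_iff hcl.measurableSet]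
      convert h0 using 2
      ext y; simp
    have h2 : x0 + (3 * ε) • u ∈ csupp Q := by
      apply interior_subset; apply hball
      rw [Metric.mem_ball, dist_eq_norm, add_sub_cancel_left, norm_smul, hu,
        Real.norm_of_nonneg (by positivity)]
      linarith
    have h3 : x0 + (3 * ε) • u ∈ {y : EE d | ⟪u, y - x0⟫ ≤ 2 * ε} := h2 _ ⟨hcl, hcv, h1⟩
    have h4 : ⟪u, x0 + (3 * ε) • u - x0⟫ ≤ 2 * ε := h3
    rw [add_sub_cancel_left, real_inner_smul_right, real_inner_self_eq_norm_sq, hu] at h4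
    linarith
  have key : ∃ η : ℝ, 0 < η ∧ η ≤ 1 ∧ ∀ᶠ n in atTop, ∀ u ∈ Metric.sphere (0 : EE d) 1,
      ENNReal.ofReal η ≤ Qn n {y | ε < ⟪u, y - x0⟫} := by
    refine (isCompact_sphere (0 : EE d) 1).induction_on
      (p := fun S => ∃ η : ℝ, 0 < η ∧ η ≤ 1 ∧ ∀ᶠ n in atTop, ∀ u ∈ S,
        ENNReal.ofReal η ≤ Qn n {y | ε < ⟪u, y - x0⟫}) ?_ ?_ ?_ ?_
    · exact ⟨1, one_pos, le_refl _, by simp⟩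
    · rintro s t hst ⟨η, h1, h2, h3⟩
      exact ⟨η, h1, h2, h3.mono fun n hn u hu => hn u (hst hu)⟩
    · rintro s t ⟨η, h1, h2, h3⟩ ⟨η', h1', h2', h3'⟩
      refine ⟨min η η', lt_min h1 h1', (min_le_left _ _).trans h2, ?_⟩
      filter_upwards [h3, h3'] with n hn hn' u hu
      rcases hu with hu | hu
      · exact (ENNReal.ofReal_le_ofReal (min_le_left _ _)).trans (hn u hu)
      · exact (ENNReal.ofReal_le_ofReal (min_le_right _ _)).trans (hn' u hu)
    · intro u hu
      have hu1 : ‖u‖ = 1 := by simpa using hu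
      have hR : ∃ R : ℕ, Q ({y | 2 * ε < ⟪u, y - x0⟫} ∩ Metric.ball x0 (R + 1)) ≠ 0 := by
        by_contra hcon
        push Not at hcon
        apply hpos u hu1
        have := measure_iUnion_null hcon
        refine measure_mono_null ?_ this
        intro y hy
        obtain ⟨R, hR⟩ := exists_nat_gt (dist y x0)
        exact mem_iUnion.2 ⟨R, hy, by rw [Metric.mem_ball]; linarith⟩
      obtain ⟨R, hR⟩ := hR
      set U := {y | 2 * ε < ⟪u, y - x0⟫} ∩ Metric.ball x0 (R + 1) with hU
      have hUo : IsOpen U := (isOpen_lt continuous_const (by fun_prop)).inter Metric.isOpen_ball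
      have hQU : Q U ≤ 1 := prob_le_one
      have hQUt : Q U ≠ ⊤ := ne_top_of_le_ne_top ENNReal.one_ne_top hQU
      have hQr : 0 < (Q U).toReal := ENNReal.toReal_pos hR hQUt
      have hQr1 : (Q U).toReal ≤ 1 := by
        simpa using ENNReal.toReal_mono ENNReal.one_ne_top hQU
      refine ⟨_, mem_nhdsWithin_of_mem_nhds (Metric.ball_mem_nhds u (ε := ε / (R + 1)) (by positivity)), (Q U).toReal / 2,
        by positivity, by linarith, ?_⟩
      have hlt : ENNReal.ofReal ((Q U).toReal / 2) < Q U := by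
        rw [ENNReal.ofReal_lt_iff_lt_toReal (by positivity) hQUt]; linarith
      have := eventually_lt_of_lt_liminf (lt_of_lt_of_le hlt (open_liminf hw hUo))
      filter_upwards [this] with n hn v hv
      refine hn.le.trans (measure_mono ?_)
      rintro y ⟨hy1, hy2⟩
      have hy1' : 2 * ε < ⟪u, y - x0⟫ := hy1
      change ε < ⟪v, y - x0⟫
      rw [Metric.mem_ball, dist_eq_norm] at hy2 hv
      have h5 : ⟪u - v, y - x0⟫ ≤ ε := by
        refine (real_inner_le_norm _ _).trans ?_
        rw [norm_sub_rev]
        calc ‖v - u‖ * ‖y - x0‖ ≤ (ε / (R + 1)) * (R + 1) := by gcongr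
          _ = ε := by field_simp
      rw [inner_sub_left] at h5
      linarith
  obtain ⟨η, hη, hη1, hev⟩ := key
  refine ⟨η, hε, hη, hη1, hev.mono fun n hn C hC hcv hQC z hz => ?_⟩
  by_contra hzC
  have hne : C.Nonempty := by
    by_contra hne
    rw [not_nonempty_iff_eq_empty] at hne
    rw [hne, compl_empty, measure_univ] at hQC
    have := ENNReal.ofReal_le_ofReal hη1
    rw [ENNReal.ofReal_one] at this
    exact absurd hQC (not_lt.2 this)
  obtain ⟨u, hu, hsep⟩ := sep_unit hC hcv hne hzC
  refine absurd hQC (not_lt.2 ((hn u (by simpa using hu)).trans (measure_mono ?_)))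
  intro y hy hyC
  have hy' : ε < ⟪u, y - x0⟫ := hy
  have h1 := hsep y hyC
  have h2 : ⟪u, z - x0⟫ ≤ ε := by
    refine (real_inner_le_norm _ _).trans ?_
    rw [hu, one_mul, ← dist_eq_norm]; exact (Metric.mem_ball.1 hz).le
  rw [inner_sub_right] at hy' h2
  linarith

/-- level set lower bound on the exponential integral -/
theorem exp_int_ge {φ : EE d → EReal} {S : Set (EE d)} (hS : MeasurableSet S) {t : ℝ}
    (h : ∀ x ∈ S, (t : EReal) ≤ φ x) :
    ENNReal.ofReal (Real.exp t) * volume S ≤ ∫⁻ x, EReal.exp (φ x) := by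
  rw [← setLIntegral_const]
  refine (setLIntegral_mono' hS fun x hx => ?_).trans (setLIntegral_le_lintegral S _)
  have := EReal.exp_monotone (h x hx)
  simpa using this

/-- far away values are small -/
theorem far_bound (x0 : EE d) {ε t0 Y : ℝ} (hε : 0 < ε) :
    ∃ R0 : ℝ, 1 ≤ R0 ∧ ∀ φ : EE d → EReal, Conc φ → (∀ x ∈ Metric.ball x0 ε, (t0 : EReal) ≤ φ x) →
      ∫⁻ x, EReal.exp (φ x) ≤ ENNReal.ofReal Y → ∀ x, R0 ≤ ‖x - x0‖ →
      φ x ≤ ((t0 - 1 : ℝ) : EReal) := by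
  set v := (volume (Metric.ball (0 : EE d) (ε / 2))) with hv
  have hv0 : 0 < v := Metric.measure_ball_pos _ _ (by positivity)
  have hvt : v ≠ ⊤ := measure_ball_lt_top.ne
  set c := ENNReal.ofReal (Real.exp (t0 - 1)) * v with hc
  have hc0 : c ≠ 0 := mul_ne_zero (by simpa using Real.exp_pos _) hv0.ne'
  obtain ⟨N, hN⟩ := ENNReal.exists_nat_mul_gt hc0 (ENNReal.ofReal_ne_top (r := Y))
  refine ⟨max 1 (2 * N * ε), le_max_left _ _, fun φ hφ hb hI x hx => ?_⟩
  by_contra hcon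
  push Not at hcon
  set R := ‖x - x0‖ with hR
  have hR1 : 1 ≤ R := (le_max_left _ _).trans hx
  have hR2 : 2 * N * ε ≤ R := (le_max_right _ _).trans hx
  have hR0 : 0 < R := by linarith
  let cj : ℕ → EE d := fun j => x0 + (j * ε / R) • (x - x0)
  have hsub : ∀ j ∈ Finset.range N, ∀ z ∈ Metric.ball (cj j) (ε / 2), ((t0 - 1 : ℝ) : EReal) ≤ φ z := by
    intro j hj z hz
    have hjN : (j : ℝ) ≤ N := by exact_mod_cast (Finset.mem_range.1 hj).le
    set s := j * ε / R with hs
    have hs0 : 0 ≤ s := by positivity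
    have hs1 : s ≤ 1 / 2 := by
      rw [hs, div_le_div_iff₀ hR0 two_pos]; nlinarith
    have h1s : 0 < 1 - s := by linarith
    have hw : ‖z - cj j‖ < ε / 2 := by rw [← dist_eq_norm]; exact hz
    have hy : x0 + (1 - s)⁻¹ • (z - cj j) ∈ Metric.ball x0 ε := by
      rw [Metric.mem_ball, dist_eq_norm, add_sub_cancel_left, norm_smul, norm_inv,
        Real.norm_of_nonneg h1s.le, inv_mul_lt_iff₀ h1s]
      nlinarith
    have := hφ.le hs0 h1s.le (by ring) hcon.le (hb _ hy)
    have e : s • x + (1 - s) • (x0 + (1 - s)⁻¹ • (z - cj j)) = z := by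
      rw [smul_add, smul_smul, mul_inv_cancel₀ h1s.ne', one_smul]
      simp only [cj]; module
    rw [e] at this
    refine le_trans ?_ this
    exact_mod_cast (by nlinarith : t0 - 1 ≤ s * (t0 - 1) + (1 - s) * t0)
  have hdisj : PairwiseDisjoint (↑(Finset.range N)) (fun j => Metric.ball (cj j) (ε / 2)) := by
    intro i _ j _ hij
    apply Metric.ball_disjoint_ball
    have : dist (cj i) (cj j) = |(i : ℝ) - j| * ε := by
      rw [dist_eq_norm]
      have : cj i - cj j = (((i : ℝ) - j) * ε / R) • (x - x0) := by
        simp only [cj]; module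
      rw [this, norm_smul, ← hR, Real.norm_eq_abs, abs_div, abs_mul, abs_of_pos hε, abs_of_pos hR0]
      field_simp
    rw [this]
    have h1 : 1 ≤ |(i : ℝ) - j| := by
      have : (1 : ℤ) ≤ |(i : ℤ) - j| := Int.one_le_abs (by omega)
      exact_mod_cast this
    nlinarith
  have hvol : volume (⋃ j ∈ Finset.range N, Metric.ball (cj j) (ε / 2)) = N * v := by
    rw [measure_biUnion_finset hdisj (fun _ _ => Metric.isOpen_ball.measurableSet)]
    simp only [Measure.addHaar_ball_center volume (cj _) (ε/2)]
    simp [hv]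
  have := exp_int_ge (φ := φ) (S := ⋃ j ∈ Finset.range N, Metric.ball (cj j) (ε / 2)) (t := t0 - 1)
    (Finset.measurableSet_biUnion _ (fun _ _ => Metric.isOpen_ball.measurableSet)) (by
      intro z hz
      simp only [mem_iUnion] at hz
      obtain ⟨j, hj, hz⟩ := hz
      exact hsub j hj z hz)
  rw [hvol] at this
  have h2 := this.trans hI
  have e : ENNReal.ofReal (Real.exp (t0 - 1)) * (N * v) = N * c := by rw [hc]; ring
  rw [e] at h2
  exact absurd hN (not_lt.2 h2)

theorem poly_exp (d : ℕ) {κ : ℝ} (hκ : 0 < κ) : ∃ Y0 : ℝ, 1 ≤ Y0 ∧ ∀ y, κ * Real.exp y ≤ y ^ (d + 1) → y ≤ Y0 := by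
  have := (Real.tendsto_pow_mul_exp_neg_atTop_nhds_zero (d + 1)).eventually (gt_mem_nhds hκ)
  obtain ⟨Y, hY⟩ := eventually_atTop.1 this
  refine ⟨max 1 Y, le_max_left _ _, fun y hy => ?_⟩
  by_contra hcon
  push Not at hcon
  have h1 := hY y ((le_max_right _ _).trans hcon.le)
  rw [Real.exp_neg, ← div_eq_mul_inv, div_lt_iff₀ (Real.exp_pos _)] at h1
  linarith

theorem exists_ne_bot {φ : EE d → EReal} {Q : Measure (EE d)} [IsProbabilityMeasure Q]
    (hφ : IsPhi φ) {c : ℝ} (hc : (c : EReal) ≤ Lfun φ Q) : ∃ p, φ p ≠ ⊥ := by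
  by_contra hcon
  push Not at hcon
  have := ((Lfun_ge_iff (l := fun _ => 0) hφ.meas (integrable_const _)
    (fun x => by rw [hcon x]; exact bot_le)).1 hc).1
  apply this
  unfold Dfun
  simp [hcon]

theorem env_uniform (x0 : EE d) {ε η : ℝ} (c : ℝ) (hε : 0 < ε) (hη : 0 < η) (hη1 : η ≤ 1) :
    ∃ a b t0 : ℝ, 0 < b ∧ b ≤ 1 ∧ ∀ (Q : Measure (EE d)) [IsProbabilityMeasure Q],
      Fat Q x0 ε η → ∀ φ : EE d → EReal, IsPhi φ → (c : EReal) ≤ Lfun φ Q →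
      (∀ x, φ x ≤ ((a - b * ‖x‖ : ℝ) : EReal)) ∧ ∀ x ∈ Metric.ball x0 ε, (t0 : EReal) ≤ φ x := by
  set v := (volume (Metric.ball (0 : EE d) ε)).toReal with hv
  have hvt : volume (Metric.ball (0 : EE d) ε) ≠ ⊤ := measure_ball_lt_top.ne
  have hv0 : 0 < v := ENNReal.toReal_pos (Metric.measure_ball_pos _ _ (by positivity)).ne' hvt
  obtain ⟨Y0, hY1, hY0⟩ := poly_exp d (κ := v * Real.exp (c - 3) * (η / 2) ^ d) (by positivity)
  set t0 := c - 1 - 2 * Y0 / η with ht0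
  obtain ⟨R0, hR1, hfar⟩ := far_bound x0 (t0 := t0) (Y := Y0) hε
  refine ⟨Y0 + c - 2 + 1 + ‖x0‖, 1 / R0, t0, by positivity, by rw [div_le_one (by linarith)]; exact hR1, ?_⟩
  intro Q _ hF φ hφ hc
  obtain ⟨p, hp⟩ := exists_ne_bot hφ hc
  obtain ⟨m, hm⟩ := hφ.exists_max hp
  have hmb : φ m ≠ ⊥ := fun hh => hp (le_bot_iff.1 (hh ▸ hm p))
  have hmr := EReal.coe_toReal (hφ.2.1 m) hmb
  set M := (φ m).toReal with hM
  have hmM : ∀ x, φ x ≤ (M : EReal) := fun x => hmr ▸ hm x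
  obtain ⟨hDt, hD⟩ := (Lfun_ge_iff (l := fun _ => M) hφ.meas (integrable_const _) hmM).1 hc
  rw [integral_const, probReal_univ, one_smul] at hD
  set K := M + 1 - c with hK
  have hK0 : 0 ≤ K := by have := ENNReal.toReal_nonneg (a := Dfun (fun _ => M) φ Q); linarith
  have hDK : Dfun (fun _ => M) φ Q ≤ ENNReal.ofReal K := by
    rw [← ENNReal.ofReal_toReal hDt]; exact ENNReal.ofReal_le_ofReal (by linarith)
  have hD1 : ∫⁻ x, ((M : EReal) - φ x).toENNReal ∂Q ≤ ENNReal.ofReal K := le_self_add.trans hDK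
  have hD2 : ∫⁻ x, EReal.exp (φ x) ≤ ENNReal.ofReal K := le_add_self.trans hDK
  set T := 2 * (K + 1) / η with hT
  have hT2 : 2 ≤ T := by rw [hT, le_div_iff₀ hη]; nlinarith
  have hball : ∀ x ∈ Metric.ball x0 ε, ((M - T : ℝ) : EReal) ≤ φ x := by
    refine hF {x | ((M - T : ℝ) : EReal) ≤ φ x} (hφ.isClosed_ge _) (hφ.conc.convex_ge _) ?_
    by_contra hcon
    push Not at hcon
    have hmark := mul_meas_ge_le_lintegral₀ (μ := Q) (f := fun x => ((M : EReal) - φ x).toENNReal)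
      ((measurable_const.sub hφ.meas).ereal_toENNReal.aemeasurable) (ENNReal.ofReal T)
    have hsub : {x | ((M - T : ℝ) : EReal) ≤ φ x}ᶜ ⊆
        {x | ENNReal.ofReal T ≤ ((M : EReal) - φ x).toENNReal} := by
      intro x hx
      have hx' : φ x < ((M - T : ℝ) : EReal) := not_le.1 hx
      change ENNReal.ofReal T ≤ ((M : EReal) - φ x).toENNReal
      have h3 : ((T : ℝ) : EReal) ≤ (M : EReal) - φ x := by
        have e : (T : EReal) = (M : EReal) - ((M - T : ℝ) : EReal) := by
          rw [← EReal.coe_sub]; congr 1; ring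
        rw [e]
        exact EReal.sub_le_sub le_rfl hx'.le
      simpa using EReal.toENNReal_le_toENNReal h3
    have h4 : ENNReal.ofReal T * ENNReal.ofReal η ≤ ENNReal.ofReal K :=
      (mul_le_mul_right (hcon.trans (measure_mono hsub)) _).trans (hmark.trans hD1)
    rw [← ENNReal.ofReal_mul (by linarith), ENNReal.ofReal_le_ofReal_iff hK0] at h4
    have : T * η = 2 * (K + 1) := by rw [hT]; field_simp
    linarith
  have hTpos : 0 < T := by linarith
  have hball2 : ∀ z ∈ Metric.ball (m + T⁻¹ • (x0 - m)) (T⁻¹ * ε), ((M - 1 : ℝ) : EReal) ≤ φ z := by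
    intro z hz
    have hz' : ‖z - (m + T⁻¹ • (x0 - m))‖ < T⁻¹ * ε := by rw [← dist_eq_norm]; exact hz
    have hy : x0 + T • (z - (m + T⁻¹ • (x0 - m))) ∈ Metric.ball x0 ε := by
      rw [Metric.mem_ball, dist_eq_norm, add_sub_cancel_left, norm_smul, Real.norm_of_nonneg hTpos.le]
      calc _ < T * (T⁻¹ * ε) := mul_lt_mul_of_pos_left hz' hTpos
        _ = ε := by field_simp
    have hTi : T⁻¹ ≤ 1 := inv_le_one_of_one_le₀ (by linarith)
    have := hφ.conc.le (sub_nonneg.2 hTi) (inv_nonneg.2 hTpos.le) (by ring) hmr.le (hball _ hy)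
    have e : (1 - T⁻¹) • m + T⁻¹ • (x0 + T • (z - (m + T⁻¹ • (x0 - m)))) = z := by
      rw [smul_add, smul_smul, inv_mul_cancel₀ hTpos.ne', one_smul]; module
    rw [e] at this
    refine le_trans ?_ this
    have : (1 - T⁻¹) * M + T⁻¹ * (M - T) = M - 1 := by field_simp; ring
    rw [this]
  have hvol := (exp_int_ge Metric.isOpen_ball.measurableSet hball2).trans hD2
  rw [Measure.addHaar_ball_mul_of_pos volume _ (by positivity : 0 < T⁻¹), ← ENNReal.ofReal_toReal hvt, ← hv,
    ← ENNReal.ofReal_mul (by positivity), ← ENNReal.ofReal_mul (by positivity),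
    ENNReal.ofReal_le_ofReal_iff hK0] at hvol
  simp only [finrank_euclideanSpace, Fintype.card_fin] at hvol
  have hKY : K + 1 ≤ Y0 := by
    apply hY0
    have e1 : Real.exp (c - 3) * Real.exp (K + 1) = Real.exp (M - 1) := by
      rw [← Real.exp_add]; congr 1; rw [hK]; ring
    have e2 : T⁻¹ ^ d = (η / 2) ^ d * ((K + 1) ^ d)⁻¹ := by
      have : T⁻¹ = (η / 2) * (K + 1)⁻¹ := by rw [hT]; field_simp
      rw [this, mul_pow, inv_pow]
    rw [e2] at hvol
    have hKd : 0 < (K + 1) ^ d := by positivity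
    calc v * Real.exp (c - 3) * (η / 2) ^ d * Real.exp (K + 1)
        = (Real.exp (M - 1) * ((η / 2) ^ d * ((K + 1) ^ d)⁻¹ * v)) * (K + 1) ^ d := by
          rw [← e1]; field_simp
      _ ≤ K * (K + 1) ^ d := by gcongr
      _ ≤ (K + 1) * (K + 1) ^ d := by gcongr; linarith
      _ = _ := by ring
  have hball3 : ∀ x ∈ Metric.ball x0 ε, (t0 : EReal) ≤ φ x := by
    intro x hx
    refine le_trans ?_ (hball x hx)
    have : T ≤ 2 * Y0 / η := by rw [hT]; gcongr
    exact_mod_cast (by linarith : t0 ≤ M - T)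
  refine ⟨fun x => ?_, hball3⟩
  have hray := hφ.conc.ray (x0 := x0) (t0 := t0) (a0 := Y0 + c - 2) (R0 := R0) (by linarith)
    (hball3 x0 (Metric.mem_ball_self hε))
    (fun x => (hmM x).trans (by exact_mod_cast (by linarith : M ≤ Y0 + c - 2)))
    (hfar φ hφ.conc hball3 (hD2.trans (ENNReal.ofReal_le_ofReal (by linarith)))) x
  exact hray.trans (by exact_mod_cast env_shift hR1 x)

end P2


section P3
variable {d : ℕ}

/-- `φ ≤ a - b‖x‖` -/
def Env (φ : EE d → EReal) (a b : ℝ) : Prop := ∀ x, φ x ≤ ((a - b * ‖x‖ : ℝ) : EReal)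

theorem Env.real {φ : EE d → EReal} {a b : ℝ} (h : Env φ a b) {x : EE d} {s : ℝ}
    (hs : (s : EReal) ≤ φ x) : s ≤ a - b * ‖x‖ := by exact_mod_cast hs.trans (h x)

theorem Env.ne_top {φ : EE d → EReal} {a b : ℝ} (h : Env φ a b) (x : EE d) : φ x ≠ ⊤ := fun hx => by
  have := h x; rw [hx] at this; exact absurd (top_le_iff.1 this) (EReal.coe_ne_top _)

theorem Env.le_const {φ : EE d → EReal} {a b : ℝ} (h : Env φ a b) (hb : 0 < b) (x : EE d) :
    φ x ≤ (a : EReal) := by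
  refine (h x).trans ?_
  have := norm_nonneg x
  exact_mod_cast (by nlinarith : a - b * ‖x‖ ≤ a)

def rset (k : ℝ) (φ : EE d → EReal) (x : EE d) : Set ℝ :=
  {q | ∃ y, ∃ s : ℝ, (s : EReal) ≤ φ y ∧ q = s - k * ‖x - y‖}

/-- Lipschitz regularisation -/
noncomputable def rr (k : ℝ) (φ : EE d → EReal) (x : EE d) : ℝ := sSup (rset k φ x)

theorem rset_le {k a b : ℝ} {φ : EE d → EReal} (he : Env φ a b) (hb : 0 < b) (hk : b ≤ k) {x : EE d}
    {q : ℝ} (hq : q ∈ rset k φ x) : q ≤ a - b * ‖x‖ := by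
  obtain ⟨y, s, hs, rfl⟩ := hq
  have h1 := he.real hs
  have h2 : ‖x‖ ≤ ‖x - y‖ + ‖y‖ := by simpa using norm_add_le (x - y) y
  have h3 := norm_nonneg (x - y)
  nlinarith

theorem rset_bdd {k a b : ℝ} {φ : EE d → EReal} (he : Env φ a b) (hb : 0 < b) (hk : b ≤ k) (x : EE d) :
    BddAbove (rset k φ x) := ⟨_, fun _ hq => rset_le he hb hk hq⟩

theorem rset_ne {k t0 : ℝ} {x0 : EE d} {φ : EE d → EReal} (h0 : (t0 : EReal) ≤ φ x0) (x : EE d) :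
    (rset k φ x).Nonempty := ⟨_, x0, t0, h0, rfl⟩

section props
variable {k a b t0 : ℝ} {x0 : EE d} {φ : EE d → EReal} (he : Env φ a b) (hb : 0 < b) (hk : b ≤ k)
  (h0 : (t0 : EReal) ≤ φ x0)

include he hb hk in
theorem rr_ge {y : EE d} {s : ℝ} (hs : (s : EReal) ≤ φ y) (x : EE d) : s - k * ‖x - y‖ ≤ rr k φ x :=
  le_csSup (rset_bdd he hb hk x) ⟨y, s, hs, rfl⟩

include h0 in
theorem rr_lt {x : EE d} {t : ℝ} (ht : t < rr k φ x) :
    ∃ y, ∃ s : ℝ, (s : EReal) ≤ φ y ∧ t < s - k * ‖x - y‖ := by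
  obtain ⟨q, ⟨y, s, hs, rfl⟩, hq⟩ := exists_lt_of_lt_csSup (rset_ne h0 x) ht
  exact ⟨y, s, hs, hq⟩

include he hb hk h0 in
theorem rr_le (x : EE d) : rr k φ x ≤ a - b * ‖x‖ :=
  csSup_le (rset_ne h0 x) fun _ hq => rset_le he hb hk hq

include he hb hk in
theorem le_rr (x : EE d) : φ x ≤ (rr k φ x : EReal) := by
  by_cases hx : φ x = ⊥
  · rw [hx]; exact bot_le
  have h1 := EReal.coe_toReal (he.ne_top x) hx
  have := rr_ge he hb hk h1.le x
  rw [sub_self, norm_zero, mul_zero, sub_zero] at this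
  rw [← h1]; exact_mod_cast this

include he hb hk h0 in
theorem rr_lip (x x' : EE d) : rr k φ x ≤ rr k φ x' + k * ‖x - x'‖ := by
  refine csSup_le (rset_ne h0 x) ?_
  rintro _ ⟨y, s, hs, rfl⟩
  have h1 := rr_ge he hb hk hs x'
  have h2 : ‖x' - y‖ ≤ ‖x - x'‖ + ‖x - y‖ := by
    rw [norm_sub_rev x x']
    simpa using norm_add_le (x' - x) (x - y)
  have : 0 ≤ k := hb.le.trans hk
  nlinarith

include he hb hk h0 in
theorem rr_abs (x x' : EE d) : |rr k φ x - rr k φ x'| ≤ k * ‖x - x'‖ := by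
  rw [abs_le]
  have h1 := rr_lip he hb hk h0 x x'
  have h2 := rr_lip he hb hk h0 x' x
  rw [norm_sub_rev x' x] at h2
  constructor <;> linarith

include he hb hk h0 in
theorem rr_anti {k' : ℝ} (hkk : k ≤ k') (x : EE d) : rr k' φ x ≤ rr k φ x := by
  refine csSup_le (rset_ne h0 x) ?_
  rintro _ ⟨y, s, hs, rfl⟩
  have h1 := rr_ge he hb hk hs x
  have := norm_nonneg (x - y)
  nlinarith

include he hb hk h0 in
theorem rr_conc (hc : Conc φ) {x y : EE d} {α β : ℝ} (hα : 0 < α) (hβ : 0 < β) (hαβ : α + β = 1) :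
    α * rr k φ x + β * rr k φ y ≤ rr k φ (α • x + β • y) := by
  refine le_of_forall_pos_le_add fun e hepos => ?_
  obtain ⟨y1, s1, hs1, h1⟩ := rr_lt (k := k) h0 (sub_lt_self (rr k φ x) hepos)
  obtain ⟨y2, s2, hs2, h2⟩ := rr_lt (k := k) h0 (sub_lt_self (rr k φ y) hepos)
  have h3 := hc y1 y2 α β hα hβ hαβ s1 s2 hs1 hs2
  have h4 := rr_ge he hb hk h3 (α • x + β • y)
  have h5 : ‖α • x + β • y - (α • y1 + β • y2)‖ ≤ α * ‖x - y1‖ + β * ‖y - y2‖ := by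
    have : α • x + β • y - (α • y1 + β • y2) = α • (x - y1) + β • (y - y2) := by module
    rw [this]
    refine (norm_add_le _ _).trans ?_
    rw [norm_smul, norm_smul, Real.norm_of_nonneg hα.le, Real.norm_of_nonneg hβ.le]
  have hk0 : 0 ≤ k := hb.le.trans hk
  have h6 := mul_le_mul_of_nonneg_left h5 hk0
  have h7 := mul_le_mul_of_nonneg_left h1.le hα.le
  have h8 := mul_le_mul_of_nonneg_left h2.le hβ.le
  have : e = α * e + β * e := by rw [← add_mul, hαβ, one_mul]
  nlinarith

include he hb h0 in
theorem rr_eventually (hu : UpperSemicontinuous φ) {x : EE d} {t : ℝ} (ht : φ x < (t : EReal)) :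
    ∃ k0 : ℝ, ∀ k, k0 ≤ k → rr k φ x ≤ t := by
  have h1 := hu x t ht
  obtain ⟨δ, hδ, hball⟩ := Metric.eventually_nhds_iff.1 h1
  refine ⟨max b ((a - t) / δ), fun k hk => ?_⟩
  have hkb : b ≤ k := (le_max_left _ _).trans hk
  have hk2 : (a - t) / δ ≤ k := (le_max_right _ _).trans hk
  by_contra hcon
  push Not at hcon
  obtain ⟨y, s, hs, hlt⟩ := rr_lt h0 hcon
  have hsa : s ≤ a := by
    have := he.real hs; have := norm_nonneg y; nlinarith
  have hn := norm_nonneg (x - y)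
  have hts : t < s := by nlinarith
  have hδ2 : δ ≤ ‖x - y‖ := by
    by_contra hc
    push Not at hc
    have := hball (y := y) (by rw [dist_eq_norm, norm_sub_rev]; exact hc)
    have h3 : s < t := by exact_mod_cast hs.trans_lt this
    linarith
  rw [div_le_iff₀ hδ] at hk2
  nlinarith
end props

theorem lip_cont {f : EE d → ℝ} {K : ℝ} (h : ∀ x y, |f x - f y| ≤ K * ‖x - y‖) : Continuous f := by
  have : LipschitzWith (Real.toNNReal K) f := by
    refine LipschitzWith.of_dist_le_mul fun x y => ?_
    rw [Real.dist_eq, dist_eq_norm]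
    exact (h x y).trans (mul_le_mul_of_nonneg_right (Real.le_coe_toNNReal K) (norm_nonneg _))
  exact this.continuous

/-- compactness of pointwise bounded equi-Lipschitz families -/
theorem compact_lip {r : ℕ → ℕ → EE d → ℝ} {l u : ℕ → EE d → ℝ}
    (hlip : ∀ n k x y, |r n k x - r n k y| ≤ (k + 1 : ℝ) * ‖x - y‖)
    (hl : ∀ n k x, l k x ≤ r n k x) (hu : ∀ n k x, r n k x ≤ u k x) :
    ∃ σ : ℕ → ℕ, StrictMono σ ∧ ∃ g : ℕ → EE d → ℝ, ∀ k x,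
      Tendsto (fun n => r (σ n) k x) atTop (𝓝 (g k x)) := by
  let D := TopologicalSpace.denseSeq (EE d)
  let F : ℕ → (ℕ × ℕ → EReal) := fun n p => ((r n p.1 (D p.2) : ℝ) : EReal)
  obtain ⟨G, σ, hσ, hG⟩ := CompactSpace.tendsto_subseq F
  refine ⟨σ, hσ, ?_⟩
  rw [tendsto_pi_nhds] at hG
  have hD : ∀ k j, ∃ q : ℝ, Tendsto (fun n => r (σ n) k (D j)) atTop (𝓝 q) := by
    intro k j
    have h1 := hG (k, j)
    have hlow : ((l k (D j) : ℝ) : EReal) ≤ G (k, j) :=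
      ge_of_tendsto' h1 fun n => EReal.coe_le_coe_iff.2 (hl (σ n) k (D j))
    have hup : G (k, j) ≤ ((u k (D j) : ℝ) : EReal) :=
      le_of_tendsto' h1 fun n => EReal.coe_le_coe_iff.2 (hu (σ n) k (D j))
    have hne1 : G (k, j) ≠ ⊥ := fun hh => by
      rw [hh] at hlow; exact absurd (le_bot_iff.1 hlow) (EReal.coe_ne_bot _)
    have hne2 : G (k, j) ≠ ⊤ := fun hh => by
      rw [hh] at hup; exact absurd (top_le_iff.1 hup) (EReal.coe_ne_top _)
    refine ⟨(G (k, j)).toReal, ?_⟩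
    rw [← EReal.tendsto_coe, EReal.coe_toReal hne2 hne1]
    exact h1
  have hall : ∀ k x, ∃ q : ℝ, Tendsto (fun n => r (σ n) k x) atTop (𝓝 q) := by
    intro k x
    apply cauchySeq_tendsto_of_complete
    rw [Metric.cauchySeq_iff]
    intro ε hε
    have hk : (0 : ℝ) < k + 1 := by positivity
    obtain ⟨j, hj⟩ := (TopologicalSpace.denseRange_denseSeq (EE d)).exists_dist_lt x
      (ε := ε / 4 / (k + 1)) (by positivity)
    obtain ⟨q, hq⟩ := hD k j
    obtain ⟨N, hN⟩ := Metric.cauchySeq_iff.1 hq.cauchySeq (ε / 4) (by positivity)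
    refine ⟨N, fun m hm n hn => ?_⟩
    have h1 := hN m hm n hn
    have hx : (k + 1 : ℝ) * ‖x - D j‖ ≤ ε / 4 := by
      rw [← dist_eq_norm]
      calc _ ≤ (k + 1 : ℝ) * (ε / 4 / (k + 1)) := by gcongr
        _ = ε / 4 := by field_simp
    have h2 := (hlip (σ m) k x (D j)).trans hx
    have h3 := (hlip (σ n) k x (D j)).trans hx
    rw [Real.dist_eq, abs_lt] at *
    rw [abs_le] at h2 h3
    constructor <;> linarith [h1.1, h1.2, h2.1, h2.2, h3.1, h3.2]
  choose g hg using hall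
  exact ⟨g, hg⟩

/-- Fatou lemma under weak convergence -/
theorem weak_fatou_const {Qn : ℕ → Measure (EE d)} {Q : Measure (EE d)}
    [∀ n, IsProbabilityMeasure (Qn n)] [IsProbabilityMeasure Q] (hw : WConv Qn Q)
    {f : EE d → ℝ} (hf : Continuous f) (h0 : ∀ x, 0 ≤ f x) :
    ∫⁻ x, ENNReal.ofReal (f x) ∂Q ≤ liminf (fun n => ∫⁻ x, ENNReal.ofReal (f x) ∂(Qn n)) atTop :=
  lintegral_le_liminf_lintegral_of_forall_isOpen_measure_le_liminf_measure hf h0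
    fun _ hG => open_liminf hw hG

theorem weak_fatou {Qn : ℕ → Measure (EE d)} {Q : Measure (EE d)}
    [∀ n, IsProbabilityMeasure (Qn n)] [IsProbabilityMeasure Q] (hw : WConv Qn Q)
    {h : ℕ → EE d → ℝ} {g : EE d → ℝ} {K : ℝ} (hlip : ∀ n x y, |h n x - h n y| ≤ K * ‖x - y‖)
    (h0 : ∀ n x, 0 ≤ h n x) (hg : ∀ x, Tendsto (fun n => h n x) atTop (𝓝 (g x))) :
    ∫⁻ x, ENNReal.ofReal (g x) ∂Q ≤ liminf (fun n => ∫⁻ x, ENNReal.ofReal (h n x) ∂(Qn n)) atTop := by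
  let low : ℕ → EE d → ℝ := fun m x => ⨅ j : ℕ, h (m + j) x
  have hbdd : ∀ m x, BddBelow (range fun j : ℕ => h (m + j) x) :=
    fun m x => ⟨0, by rintro _ ⟨j, rfl⟩; exact h0 _ _⟩
  have hlow0 : ∀ m x, 0 ≤ low m x := fun m x => le_ciInf fun j => h0 _ _
  have hlowle : ∀ m n, m ≤ n → ∀ x, low m x ≤ h n x := by
    intro m n hmn x
    have := ciInf_le (hbdd m x) (n - m)
    simpa [Nat.add_sub_cancel' hmn] using this
  have hlowlip : ∀ m x y, low m x ≤ low m y + K * ‖x - y‖ := by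
    intro m x y
    rw [← sub_le_iff_le_add]
    refine le_ciInf fun j => ?_
    have h1 := ciInf_le (hbdd m x) j
    have h2 := (abs_le.1 (hlip (m + j) x y)).2
    change low m x ≤ _ at h1
    linarith
  have hcont : ∀ m, Continuous (low m) := fun m => lip_cont (K := K) fun x y => by
    rw [abs_le]
    have h1 := hlowlip m x y
    have h2 := hlowlip m y x
    rw [norm_sub_rev y x] at h2
    constructor <;> linarith
  have hmono : Monotone low := by
    intro m n hmn x
    refine le_ciInf fun j => hlowle m (n + j) (by omega) x
  have hsup : ∀ x, ENNReal.ofReal (g x) ≤ ⨆ m, ENNReal.ofReal (low m x) := by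
    intro x
    refine le_of_forall_lt fun c hc => ?_
    have hct : c ≠ ⊤ := (hc.trans_le le_top).ne
    rw [ENNReal.lt_ofReal_iff_toReal_lt hct] at hc
    obtain ⟨q, hq1, hq2⟩ := exists_between hc
    obtain ⟨m, hm⟩ := eventually_atTop.1 ((hg x).eventually (lt_mem_nhds hq2))
    have h1 : q ≤ low m x := le_ciInf fun j => (hm _ (by omega)).le
    refine lt_of_lt_of_le ?_ (le_iSup (fun m => ENNReal.ofReal (low m x)) m)
    rw [ENNReal.lt_ofReal_iff_toReal_lt hct]
    linarith
  calc ∫⁻ x, ENNReal.ofReal (g x) ∂Q ≤ ∫⁻ x, ⨆ m, ENNReal.ofReal (low m x) ∂Q := lintegral_mono hsup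
    _ = ⨆ m, ∫⁻ x, ENNReal.ofReal (low m x) ∂Q := by
        refine lintegral_iSup (fun m => (hcont m).measurable.ennreal_ofReal) ?_
        intro m n hmn x
        exact ENNReal.ofReal_le_ofReal (hmono hmn x)
    _ ≤ _ := by
        refine iSup_le fun m => (weak_fatou_const hw (hcont m) (hlow0 m)).trans ?_
        refine liminf_le_liminf ?_
        filter_upwards [eventually_ge_atTop m] with n hn
        exact lintegral_mono fun x => ENNReal.ofReal_le_ofReal (hlowle m n hn x)

theorem integrable_env (d : ℕ) (a : ℝ) {b : ℝ} (hb : 0 < b) :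
    Integrable (fun x : EE d => Real.exp (a - b * ‖x‖)) := by
  have h1 := integrable_one_add_norm (E := EE d) (μ := volume) (r := ((d + 1 : ℕ) : ℝ)) (by simp)
  refine (h1.const_mul (Real.exp (a + b) * ((d + 1).factorial / b ^ (d + 1)))).mono'
    (by fun_prop) (Eventually.of_forall fun x => ?_)
  rw [Real.norm_of_nonneg (Real.exp_pos _).le]
  have hn := norm_nonneg x
  have h2 := Real.pow_div_factorial_le_exp (x := b * (1 + ‖x‖)) (by positivity) (d + 1)
  rw [Real.rpow_neg (by positivity), Real.rpow_natCast]
  have e : Real.exp (a - b * ‖x‖) = Real.exp (a + b) * (Real.exp (b * (1 + ‖x‖)))⁻¹ := by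
    rw [← Real.exp_neg, ← Real.exp_add]; congr 1; ring
  rw [e, mul_assoc]
  gcongr
  rw [inv_le_comm₀ (Real.exp_pos _) (by positivity)]
  refine le_trans (le_of_eq ?_) h2
  rw [mul_pow]; field_simp

theorem exp_env_le {φ : EE d → EReal} {a b : ℝ} (h : Env φ a b) (x : EE d) :
    EReal.exp (φ x) ≤ ENNReal.ofReal (Real.exp (a - b * ‖x‖)) := by
  have := EReal.exp_monotone (h x)
  rwa [EReal.exp_coe] at this

theorem exp_int_lt_top {φ : EE d → EReal} {a b : ℝ} (h : Env φ a b) (hb : 0 < b) :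
    ∫⁻ x, EReal.exp (φ x) ≠ ⊤ := by
  refine ne_top_of_le_ne_top (integrable_env d a hb).lintegral_lt_top.ne
    (lintegral_mono fun x => exp_env_le h x)

end P3


section P4
variable {d : ℕ}

/-- limit of the regularisations -/
noncomputable def glim (g : ℕ → EE d → ℝ) (x : EE d) : EReal := ⨅ k, (g k x : EReal)

section lim
variable {φn : ℕ → EE d → EReal} {a b t0 : ℝ} {x0 : EE d} {g : ℕ → EE d → ℝ}
  (hb : 0 < b) (hb1 : b ≤ 1) (hphi : ∀ n, IsPhi (φn n)) (he : ∀ n, Env (φn n) a b)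
  (h0 : ∀ n, (t0 : EReal) ≤ φn n x0)
  (hg : ∀ (k : ℕ) x, Tendsto (fun n => rr ((k : ℝ) + 1) (φn n) x) atTop (𝓝 (g k x)))

theorem hkb (hb1 : b ≤ 1) (k : ℕ) : b ≤ (k : ℝ) + 1 := by
  have : (0 : ℝ) ≤ k := by positivity
  linarith

include hb hb1 he h0 in
theorem exists_glim : ∃ σ : ℕ → ℕ, StrictMono σ ∧ ∃ g : ℕ → EE d → ℝ,
    ∀ (k : ℕ) x, Tendsto (fun n => rr ((k : ℝ) + 1) (φn (σ n)) x) atTop (𝓝 (g k x)) := by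
  exact compact_lip (r := fun n k x => rr ((k : ℝ) + 1) (φn n) x)
    (l := fun k x => t0 - ((k : ℝ) + 1) * ‖x - x0‖) (u := fun k x => a - b * ‖x‖)
    (fun n k x y => rr_abs (he n) hb (hkb hb1 k) (h0 n) x y)
    (fun n k x => rr_ge (he n) hb (hkb hb1 k) (h0 n) x)
    (fun n k x => rr_le (he n) hb (hkb hb1 k) (h0 n) x)

include hb hb1 he h0 hg in
theorem g_lip (k : ℕ) (x y : EE d) : |g k x - g k y| ≤ ((k : ℝ) + 1) * ‖x - y‖ :=
  le_of_tendsto' ((hg k x).sub (hg k y)).abs fun n => rr_abs (he n) hb (hkb hb1 k) (h0 n) x y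

include hb hb1 he h0 hg in
theorem g_le (k : ℕ) (x : EE d) : g k x ≤ a - b * ‖x‖ :=
  le_of_tendsto' (hg k x) fun n => rr_le (he n) hb (hkb hb1 k) (h0 n) x

include hb hb1 he h0 hg in
theorem g_anti {k k' : ℕ} (h : k ≤ k') (x : EE d) : g k' x ≤ g k x :=
  le_of_tendsto_of_tendsto' (hg k' x) (hg k x) fun n =>
    rr_anti (he n) hb (hkb hb1 k) (h0 n) (by gcongr) x

theorem glim_le (k : ℕ) (x : EE d) : glim g x ≤ (g k x : EReal) := iInf_le _ k

include hb hb1 he h0 hg in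
theorem glim_env : Env (glim g) a b := fun x =>
  (glim_le 0 x).trans (EReal.coe_le_coe_iff.2 (g_le hb hb1 he h0 hg 0 x))

include hb hb1 hphi he h0 hg in
theorem glim_phi : IsPhi (glim g) := by
  refine isPhi_of_env hb ?_ ?_ (glim_env hb hb1 he h0 hg)
  · refine upperSemicontinuous_iInf fun k => Continuous.upperSemicontinuous ?_
    exact continuous_coe_real_ereal.comp (lip_cont (g_lip hb hb1 he h0 hg k))
  · intro x y α β hα hβ hαβ s t hs ht
    refine le_iInf fun k => ?_
    have h1 : s ≤ g k x := by exact_mod_cast hs.trans (glim_le k x)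
    have h2 : t ≤ g k y := by exact_mod_cast ht.trans (glim_le k y)
    have h3 : α * g k x + β * g k y ≤ g k (α • x + β • y) :=
      le_of_tendsto_of_tendsto' (((hg k x).const_mul α).add ((hg k y).const_mul β)) (hg k _)
        fun n => rr_conc (he n) hb (hkb hb1 k) (h0 n) (hphi n).conc hα hβ hαβ
    refine EReal.coe_le_coe_iff.2 (le_trans ?_ h3)
    gcongr

include hb hb1 he h0 hg in
theorem glim_U {x : ℕ → EE d} {y : EE d} (hx : Tendsto x atTop (𝓝 y)) {t : EReal}
    (ht : glim g y < t) : ∀ᶠ n in atTop, φn n (x n) < t := by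
  obtain ⟨k, hk⟩ := iInf_lt_iff.1 ht
  have h1 : Tendsto (fun n => rr ((k : ℝ) + 1) (φn n) y + ((k : ℝ) + 1) * ‖x n - y‖) atTop
      (𝓝 (g k y)) := by
    have h2 : Tendsto (fun n => ‖x n - y‖) atTop (𝓝 0) := tendsto_iff_norm_sub_tendsto_zero.1 hx
    simpa using (hg k y).add (h2.const_mul ((k : ℝ) + 1))
  have h2 := (EReal.tendsto_coe.2 h1).eventually_lt_const hk
  filter_upwards [h2] with n hn
  refine lt_of_le_of_lt ?_ hn
  refine (le_rr (he n) hb (hkb hb1 k) (x n)).trans (EReal.coe_le_coe_iff.2 ?_)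
  exact rr_lip (he n) hb (hkb hb1 k) (h0 n) (x n) y

include hb hb1 hphi he h0 hg in
theorem glim_L {y : EE d} (hy : y ∈ interior {x | glim g x ≠ ⊥}) {t : ℝ}
    (ht : (t : EReal) < glim g y) :
    ∃ δ > 0, ∀ᶠ n in atTop, ∀ z ∈ Metric.ball y δ, (t : EReal) ≤ φn n z := by
  have hgp := glim_phi hb hb1 hphi he h0 hg
  have h1 := hgp.conc.mem_interior (hgp.2.1) hy ht
  obtain ⟨r, hr, hball⟩ := Metric.isOpen_iff.1 isOpen_interior y h1
  have hball2 := hball.trans interior_subset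
  obtain ⟨δ, hδ, hδr⟩ : ∃ δ > 0, 2 * δ < r := ⟨r / 3, by positivity, by linarith⟩
  refine ⟨δ, hδ, ?_⟩
  obtain ⟨k, hk⟩ := exists_nat_gt ((a - t) / δ)
  have hkpos : (0 : ℝ) < (k : ℝ) + 1 := by positivity
  have hk2 : a - t < ((k : ℝ) + 1) * δ := by
    rw [div_lt_iff₀ hδ] at hk; linarith
  have key : ∀ᶠ n in atTop, ∀ x ∈ Metric.closedBall y (2 * δ), t < rr ((k : ℝ) + 1) (φn n) x := by
    refine IsCompact.induction_on (isCompact_closedBall y (2 * δ))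
      (p := fun s => ∀ᶠ n in atTop, ∀ x ∈ s, t < rr ((k : ℝ) + 1) (φn n) x) (by simp) ?_ ?_ ?_
    · intro s s' hs h
      filter_upwards [h] with n hn x hx using hn x (hs hx)
    · intro s s' h h'
      filter_upwards [h, h'] with n hn hn' x hx
      rcases hx with hx | hx
      exacts [hn x hx, hn' x hx]
    · intro x hx
      have h3 : (t : EReal) < glim g x :=
        hball2 (Metric.closedBall_subset_ball hδr hx)
      have h4 : t < g k x := by exact_mod_cast h3.trans_le (glim_le k x)
      obtain ⟨q, hq1, hq2⟩ := exists_between h4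
      refine ⟨Metric.ball x ((q - t) / (k + 1)),
        mem_nhdsWithin_of_mem_nhds (Metric.ball_mem_nhds x (div_pos (by linarith) hkpos)), ?_⟩
      filter_upwards [(hg k x).eventually (lt_mem_nhds hq2)] with n hn z hz
      have h5 := rr_lip (he n) hb (hkb hb1 k) (h0 n) x z
      rw [Metric.mem_ball, dist_comm, dist_eq_norm, lt_div_iff₀ hkpos] at hz
      linarith
  filter_upwards [key] with n hn z hz
  by_contra hcon
  have hC : IsClosed {x | (t : EReal) ≤ φn n x} := (hphi n).isClosed_ge _
  have hCne : {x | (t : EReal) ≤ φn n x}.Nonempty := by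
    obtain ⟨q, s, hs, hlt⟩ := rr_lt (h0 n) (hn y (Metric.mem_closedBall_self (by positivity)))
    refine ⟨q, le_trans (EReal.coe_le_coe_iff.2 ?_) hs⟩
    have := norm_nonneg (y - q)
    nlinarith
  obtain ⟨u, hu, hsep⟩ := sep_unit hC ((hphi n).conc.convex_ge t) hCne hcon
  have hp : y + (2 * δ) • u ∈ Metric.closedBall y (2 * δ) := by
    rw [Metric.mem_closedBall, dist_eq_norm, add_sub_cancel_left, norm_smul, hu,
      Real.norm_of_nonneg (by positivity), mul_one]
  obtain ⟨q, s, hs, hlt⟩ := rr_lt (h0 n) (hn _ hp)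
  set p := y + (2 * δ) • u with hpdef
  have hpq0 := norm_nonneg (p - q)
  have hsa : s ≤ a := by
    have := (he n).real hs; have := norm_nonneg q; nlinarith
  have hpq : ‖p - q‖ < δ := by
    by_contra hc
    push Not at hc
    have : ((k : ℝ) + 1) * δ ≤ ((k : ℝ) + 1) * ‖p - q‖ := by gcongr
    linarith
  have hqC : (t : EReal) ≤ φn n q := by
    refine le_trans (EReal.coe_le_coe_iff.2 ?_) hs
    have := mul_nonneg hkpos.le hpq0
    linarith
  have h6 := hsep q hqC
  have h7 : ⟪u, p - q⟫ ≤ ‖p - q‖ := by simpa [hu] using real_inner_le_norm u (p - q)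
  have h8 : ⟪u, z - y⟫ ≤ ‖z - y‖ := by simpa [hu] using real_inner_le_norm u (z - y)
  rw [Metric.mem_ball, dist_eq_norm] at hz
  have h9 : ⟪u, p⟫ = ⟪u, y⟫ + 2 * δ := by
    rw [hpdef, inner_add_right, inner_smul_right, real_inner_self_eq_norm_sq, hu]; ring
  rw [inner_sub_right] at h7 h8
  linarith

include hb hb1 hphi he h0 hg in
theorem glim_T {x : ℕ → EE d} {y : EE d} (hx : Tendsto x atTop (𝓝 y))
    (hy : y ∉ frontier {x | glim g x ≠ ⊥}) :
    Tendsto (fun n => φn n (x n)) atTop (𝓝 (glim g y)) := by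
  refine tendsto_order.2 ⟨fun t ht => ?_, fun t ht => glim_U hb hb1 he h0 hg hx ht⟩
  have hyd : y ∈ {x | glim g x ≠ ⊥} := fun h => by
    rw [h] at ht; exact absurd ht not_lt_bot
  have hyi : y ∈ interior {x | glim g x ≠ ⊥} := by
    by_contra hc
    exact hy ⟨subset_closure hyd, hc⟩
  obtain ⟨q, hq1, hq2⟩ := EReal.lt_iff_exists_real_btwn.1 ht
  obtain ⟨δ, hδ, hev⟩ := glim_L hb hb1 hphi he h0 hg hyi hq2
  filter_upwards [hev, hx.eventually (Metric.ball_mem_nhds y hδ)] with n hn hn2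
  exact hq1.trans_le (hn _ hn2)

include hb hb1 hphi he h0 hg in
theorem glim_F : ∫⁻ x, EReal.exp (glim g x) ≤ liminf (fun n => ∫⁻ x, EReal.exp (φn n x)) atTop := by
  have hgp := glim_phi hb hb1 hphi he h0 hg
  have hnull : volume (frontier {x | glim g x ≠ ⊥}) = 0 := hgp.conc.convex_dom.addHaar_frontier _
  have hae : ∀ᵐ x, x ∉ frontier {x | glim g x ≠ ⊥} := measure_eq_zero_iff_ae_notMem.1 hnull
  calc _ ≤ ∫⁻ x, liminf (fun n => EReal.exp (φn n x)) atTop := by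
        refine lintegral_mono_ae ?_
        filter_upwards [hae] with x hx
        have h1 := glim_T hb hb1 hphi he h0 hg (tendsto_const_nhds (x := x)) hx
        have h2 := (EReal.expOrderIso.continuous.tendsto _).comp h1
        exact h2.liminf_eq.symm.le
    _ ≤ _ := lintegral_liminf_le fun n => EReal.measurable_exp.comp (hphi n).meas

theorem toENN_iSup {l : ℝ} {x : EReal} {q : ℕ → ℝ} (hx : x = ⨅ k, (q k : EReal)) :
    ((l : EReal) - x).toENNReal ≤ ⨆ k, ENNReal.ofReal (l - q k) := by
  refine le_of_forall_lt fun c hc => ?_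
  have hct : c ≠ ⊤ := (hc.trans_le le_top).ne
  have h1 : x < ((l - c.toReal : ℝ) : EReal) := by
    by_contra hcon
    push Not at hcon
    have h2 : (l : EReal) - x ≤ ((c.toReal : ℝ) : EReal) := by
      refine (EReal.sub_le_sub le_rfl hcon).trans (le_of_eq ?_)
      rw [← EReal.coe_sub]; congr 1; ring
    have h3 := EReal.toENNReal_le_toENNReal h2
    rw [EReal.toENNReal_of_ne_top (EReal.coe_ne_top _), EReal.toReal_coe, ENNReal.ofReal_toReal hct] at h3
    exact absurd hc (not_lt.2 h3)
  rw [hx] at h1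
  obtain ⟨k, hk⟩ := iInf_lt_iff.1 h1
  refine lt_of_lt_of_le ?_ (le_iSup (fun k => ENNReal.ofReal (l - q k)) k)
  rw [ENNReal.lt_ofReal_iff_toReal_lt hct]
  have : q k < l - c.toReal := by exact_mod_cast hk
  linarith

theorem norm_lip (x y : EE d) : |‖x‖ - ‖y‖| ≤ ‖x - y‖ := abs_norm_sub_norm_le x y

include hb hb1 he h0 hg in
theorem glim_I {Qn : ℕ → Measure (EE d)} {Q : Measure (EE d)}
    [∀ n, IsProbabilityMeasure (Qn n)] [IsProbabilityMeasure Q] (hw : WConv Qn Q) :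
    ∫⁻ x, (((a - b * ‖x‖ : ℝ) : EReal) - glim g x).toENNReal ∂Q ≤
      liminf (fun n => ∫⁻ x, (((a - b * ‖x‖ : ℝ) : EReal) - φn n x).toENNReal ∂(Qn n)) atTop := by
  calc _ ≤ ∫⁻ x, ⨆ k, ENNReal.ofReal ((a - b * ‖x‖) - g k x) ∂Q :=
        lintegral_mono fun x => toENN_iSup rfl
    _ = ⨆ k, ∫⁻ x, ENNReal.ofReal ((a - b * ‖x‖) - g k x) ∂Q := by
        refine lintegral_iSup (fun k => ?_) ?_
        · have := lip_cont (g_lip hb hb1 he h0 hg k)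
          exact (by fun_prop : Continuous fun x => (a - b * ‖x‖) - g k x).measurable.ennreal_ofReal
        · intro k k' hkk x
          exact ENNReal.ofReal_le_ofReal (sub_le_sub_left (g_anti hb hb1 he h0 hg hkk x) _)
    _ ≤ _ := by
        refine iSup_le fun k => ?_
        refine (weak_fatou hw (h := fun n x => (a - b * ‖x‖) - rr ((k : ℝ) + 1) (φn n) x)
          (K := b + (k + 1)) ?_ ?_ ?_).trans ?_
        · intro n x y
          have h1 := rr_abs (he n) hb (hkb hb1 k) (h0 n) x y
          have h2 := mul_le_mul_of_nonneg_left (norm_lip x y) hb.le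
          rw [abs_le] at h1
          have h3 := mul_le_mul_of_nonneg_left (neg_abs_le (‖x‖ - ‖y‖)) hb.le
          have h4 := mul_le_mul_of_nonneg_left (le_abs_self (‖x‖ - ‖y‖)) hb.le
          rw [abs_le]
          constructor <;> nlinarith [h1.1, h1.2]
        · intro n x
          exact sub_nonneg.2 (rr_le (he n) hb (hkb hb1 k) (h0 n) x)
        · intro x
          exact tendsto_const_nhds.sub (hg k x)
        · refine liminf_le_liminf (Eventually.of_forall fun n => lintegral_mono fun x => ?_)
          have h1 := EReal.toENNReal_le_toENNReal
            (EReal.sub_le_sub (le_refl ((a - b * ‖x‖ : ℝ) : EReal)) (le_rr (he n) hb (hkb hb1 k) x))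
          refine le_trans (le_of_eq ?_) h1
          rw [← EReal.coe_sub, EReal.toENNReal_of_ne_top (EReal.coe_ne_top _), EReal.toReal_coe]

theorem le_liminf_add' (u v : ℕ → ℝ≥0∞) :
    liminf u atTop + liminf v atTop ≤ liminf (fun n => u n + v n) atTop := by
  rw [liminf_eq_iSup_iInf_of_nat, liminf_eq_iSup_iInf_of_nat, liminf_eq_iSup_iInf_of_nat,
    ENNReal.iSup_add_iSup_of_monotone]
  · refine iSup_mono fun n => le_iInf₂ fun i hi => ?_
    exact add_le_add (iInf₂_le i hi) (iInf₂_le i hi)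
  · exact fun m n hmn => le_iInf₂ fun i hi => iInf₂_le i (hmn.trans hi)
  · exact fun m n hmn => le_iInf₂ fun i hi => iInf₂_le i (hmn.trans hi)

include hb hb1 hphi he h0 hg in
theorem glim_D {Qn : ℕ → Measure (EE d)} {Q : Measure (EE d)}
    [∀ n, IsProbabilityMeasure (Qn n)] [IsProbabilityMeasure Q] (hw : WConv Qn Q) :
    Dfun (fun x => a - b * ‖x‖) (glim g) Q ≤
      liminf (fun n => Dfun (fun x => a - b * ‖x‖) (φn n) (Qn n)) atTop :=
  (add_le_add (glim_I hb hb1 he h0 hg hw) (glim_F hb hb1 hphi he h0 hg)).trans (le_liminf_add' _ _)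

end lim
end P4


section P5
variable {d : ℕ}

/-- first absolute moment -/
noncomputable abbrev mom (Q : Measure (EE d)) : ℝ≥0∞ := ∫⁻ x, (‖x‖₊ : ℝ≥0∞) ∂Q

theorem mom_eq (Q : Measure (EE d)) : mom Q = ∫⁻ x, ENNReal.ofReal ‖x‖ ∂Q := by
  refine lintegral_congr fun x => ?_
  rw [ofReal_norm]; rfl

theorem mom_int {Q : Measure (EE d)} (h : mom Q ≠ ⊤) : Integrable (fun x => ‖x‖) Q := by
  refine ⟨by fun_prop, ?_⟩
  rw [hasFiniteIntegral_iff_ofReal (Eventually.of_forall fun x => norm_nonneg x), ← mom_eq]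
  exact h.lt_top

theorem mom_toReal (Q : Measure (EE d)) : ∫ x, ‖x‖ ∂Q = (mom Q).toReal := by
  rw [integral_eq_lintegral_of_nonneg_ae (Eventually.of_forall fun x => norm_nonneg x) (by fun_prop),
    ← mom_eq]

theorem lin_int {Q : Measure (EE d)} [IsProbabilityMeasure Q] (h : mom Q ≠ ⊤) (a b : ℝ) :
    Integrable (fun x => a - b * ‖x‖) Q := (integrable_const a).sub ((mom_int h).const_mul b)

theorem lin_val {Q : Measure (EE d)} [IsProbabilityMeasure Q] (h : mom Q ≠ ⊤) (a b : ℝ) :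
    ∫ x, (a - b * ‖x‖) ∂Q = a - b * (mom Q).toReal := by
  rw [integral_sub (integrable_const a) ((mom_int h).const_mul b), integral_const_mul, mom_toReal]
  simp

theorem sub_bot_aux {r : ℝ} {D : ℝ≥0∞} (hD : D ≠ ⊤) :
    ((r : ℝ) : EReal) - (D : EReal) = ((r - D.toReal : ℝ) : EReal) := by
  rw [EReal.coe_sub, EReal.coe_ennreal_toReal hD]

theorem Lfun_le {Q : Measure (EE d)} [IsProbabilityMeasure Q] {φ : EE d → EReal} (hφ : IsPhi φ)
    {a b : ℝ} (hb : 0 < b) (he : Env φ a b) : Lfun φ Q ≤ ((a + 1 : ℝ) : EReal) := by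
  rw [Lfun_eq hφ.meas (integrable_const a) (fun x => he.le_const hb x)]
  simp only [integral_const, probReal_univ, smul_eq_mul, one_mul]
  refine (EReal.sub_le_sub le_rfl (EReal.coe_ennreal_nonneg _)).trans ?_
  simp

theorem Lfun_real {Q : Measure (EE d)} [IsProbabilityMeasure Q] {φ : EE d → EReal} (hφ : IsPhi φ)
    {a b : ℝ} (he : Env φ a b) (hm : mom Q ≠ ⊤) (hD : Dfun (fun x => a - b * ‖x‖) φ Q ≠ ⊤) :
    Lfun φ Q =
      ((a - b * (mom Q).toReal + 1 - (Dfun (fun x => a - b * ‖x‖) φ Q).toReal : ℝ) : EReal) := by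
  rw [Lfun_eq hφ.meas (lin_int hm a b) he, lin_val hm, sub_bot_aux hD]

theorem moment_bd {Q : Measure (EE d)} [IsProbabilityMeasure Q] {φ : EE d → EReal} (hφ : IsPhi φ)
    {a b c : ℝ} (hb : 0 < b) (he : Env φ a b) (hc : (c : EReal) ≤ Lfun φ Q) :
    ENNReal.ofReal b * mom Q ≤ ENNReal.ofReal (a + 1 - c) := by
  obtain ⟨h1, h2⟩ := (Lfun_ge_iff hφ.meas (integrable_const a) (fun x => he.le_const hb x)).1 hc
  simp only [integral_const, probReal_univ, smul_eq_mul, one_mul] at h2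
  have h3 : Dfun (fun _ => a) φ Q ≤ ENNReal.ofReal (a + 1 - c) := by
    rw [← ENNReal.ofReal_toReal h1]
    exact ENNReal.ofReal_le_ofReal (by linarith)
  refine le_trans ?_ h3
  rw [mom_eq, ← lintegral_const_mul _ (by fun_prop)]
  refine le_trans (lintegral_mono fun x => ?_) le_self_add
  have h4 : ((b * ‖x‖ : ℝ) : EReal) ≤ (a : EReal) - φ x := by
    refine le_trans (le_of_eq ?_) (EReal.sub_le_sub le_rfl (he x))
    rw [← EReal.coe_sub]; congr 1; ring
  have h5 := EReal.toENNReal_le_toENNReal h4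
  rw [EReal.toENNReal_of_ne_top (EReal.coe_ne_top _), EReal.toReal_coe, ENNReal.ofReal_mul hb.le] at h5
  exact h5

theorem moment_bd' {Q : Measure (EE d)} [IsProbabilityMeasure Q] {φ : EE d → EReal} (hφ : IsPhi φ)
    {a b c : ℝ} (hb : 0 < b) (he : Env φ a b) (hc : (c : EReal) ≤ Lfun φ Q) :
    mom Q ≤ ENNReal.ofReal (a + 1 - c) / ENNReal.ofReal b := by
  have hb' : ENNReal.ofReal b ≠ 0 := by simpa using hb
  rw [ENNReal.le_div_iff_mul_le (Or.inl hb') (Or.inl ENNReal.ofReal_ne_top), mul_comm]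
  exact moment_bd hφ hb he hc

theorem mom_le {Qn : ℕ → Measure (EE d)} {Q : Measure (EE d)}
    [∀ n, IsProbabilityMeasure (Qn n)] [IsProbabilityMeasure Q] (hw : WConv Qn Q) {gam : ℝ≥0∞}
    (hgam : Tendsto (fun n => mom (Qn n)) atTop (𝓝 gam)) : mom Q ≤ gam := by
  have := weak_fatou_const hw (f := fun x => ‖x‖) continuous_norm (fun x => norm_nonneg x)
  simp only [← mom_eq] at this
  rwa [hgam.liminf_eq] at this

theorem WConv.subseq {Qn : ℕ → Measure (EE d)} {Q : Measure (EE d)} (hw : WConv Qn Q) {σ : ℕ → ℕ}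
    (hσ : Tendsto σ atTop atTop) : WConv (fun n => Qn (σ n)) Q := fun g => (hw g).comp hσ

theorem lemmaB {Qn : ℕ → Measure (EE d)} {Q : Measure (EE d)}
    [∀ n, IsProbabilityMeasure (Qn n)] [IsProbabilityMeasure Q]
    (hQ : (interior (csupp Q)).Nonempty) (hw : WConv Qn Q)
    {φn : ℕ → EE d → EReal} {lam : EReal} {gam : ℝ≥0∞}
    (hphi : ∀ᶠ n in atTop, IsPhi (φn n)) (hlam : lam ≠ ⊥)
    (hl : Tendsto (fun n => Lfun (φn n) (Qn n)) atTop (𝓝 lam))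
    (hgam : Tendsto (fun n => mom (Qn n)) atTop (𝓝 gam)) :
    gam ≠ ⊤ ∧ lam ≠ ⊤ ∧ ∃ σ : ℕ → ℕ, StrictMono σ ∧ ∃ φ : EE d → EReal, ∃ a b A : ℝ, 0 < b ∧
      IsPhi φ ∧ Env φ a b ∧ (∀ n, Env (φn (σ n)) a b) ∧
      (∀ (x : ℕ → EE d) (y : EE d), Tendsto x atTop (𝓝 y) → ∀ t, φ y < t →
        ∀ᶠ n in atTop, φn (σ n) (x n) < t) ∧
      (∀ (x : ℕ → EE d) (y : EE d), Tendsto x atTop (𝓝 y) → y ∉ frontier {x | φ x ≠ ⊥} →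
        Tendsto (fun n => φn (σ n) (x n)) atTop (𝓝 (φ y))) ∧
      Lfun φ Q = (A : EReal) ∧ lam.toReal + b * gam.toReal ≤ A + b * (mom Q).toReal := by
  obtain ⟨c, hc1, hc2⟩ := EReal.lt_iff_exists_real_btwn.1 (bot_lt_iff_ne_bot.2 hlam)
  obtain ⟨x0, ε, η, hε, hη, hη1, hfat⟩ := fat_of_wconv hQ hw
  obtain ⟨a, b, t0, hb, hb1, henv⟩ := env_uniform x0 c hε hη hη1
  obtain ⟨N, hN⟩ := eventually_atTop.1 ((hphi.and hfat).and (hl.eventually (lt_mem_nhds hc2)))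
  have hp' : ∀ n, IsPhi (φn (n + N)) := fun n => (hN (n + N) (by omega)).1.1
  have hc' : ∀ n, (c : EReal) ≤ Lfun (φn (n + N)) (Qn (n + N)) :=
    fun n => (hN (n + N) (by omega)).2.le
  have hb' := fun n => henv (Qn (n + N)) (hN (n + N) (by omega)).1.2 _ (hp' n) (hc' n)
  have he' : ∀ n, Env (φn (n + N)) a b := fun n => (hb' n).1
  have h0' : ∀ n, (t0 : EReal) ≤ φn (n + N) x0 := fun n => (hb' n).2 x0 (Metric.mem_ball_self hε)
  have hshift : Tendsto (fun n : ℕ => n + N) atTop atTop := tendsto_add_atTop_nat N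
  have hmn : ∀ n, mom (Qn (n + N)) ≤ ENNReal.ofReal (a + 1 - c) / ENNReal.ofReal b :=
    fun n => moment_bd' (hp' n) hb (he' n) (hc' n)
  have hKt : ENNReal.ofReal (a + 1 - c) / ENNReal.ofReal b ≠ ⊤ :=
    ENNReal.div_ne_top ENNReal.ofReal_ne_top (by simpa using hb)
  have hgt : gam ≠ ⊤ := ne_top_of_le_ne_top hKt (le_of_tendsto' (hgam.comp hshift) hmn)
  have hlle : lam ≤ ((a + 1 : ℝ) : EReal) :=
    le_of_tendsto' (hl.comp hshift) fun n => Lfun_le (hp' n) hb (he' n)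
  have hlt : lam ≠ ⊤ := ne_top_of_le_ne_top (EReal.coe_ne_top _) hlle
  refine ⟨hgt, hlt, ?_⟩
  obtain ⟨σ', hσ', g, hg⟩ := exists_glim (φn := fun n => φn (n + N)) hb hb1 he' h0'
  have hσ : StrictMono fun n => σ' n + N := fun m n h => Nat.add_lt_add_right (hσ' h) N
  have hpσ := fun n => hp' (σ' n)
  have heσ := fun n => he' (σ' n)
  have h0σ := fun n => h0' (σ' n)
  have hmQ : mom Q ≠ ⊤ := ne_top_of_le_ne_top hgt (mom_le hw hgam)
  have hP := glim_phi (φn := fun n => φn (σ' n + N)) hb hb1 hpσ heσ h0σ hg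
  have hE := glim_env (φn := fun n => φn (σ' n + N)) hb hb1 heσ h0σ hg
  have hDl := glim_D (φn := fun n => φn (σ' n + N)) hb hb1 hpσ heσ h0σ hg
    (hw.subseq hσ.tendsto_atTop)
  have hmσ : ∀ n, mom (Qn (σ' n + N)) ≠ ⊤ := fun n => ne_top_of_le_ne_top hKt (hmn (σ' n))
  have hDn : ∀ n, Dfun (fun x => a - b * ‖x‖) (φn (σ' n + N)) (Qn (σ' n + N)) ≠ ⊤ :=
    fun n => ((Lfun_ge_iff (hpσ n).meas (lin_int (hmσ n) a b) (heσ n)).1 (hc' (σ' n))).1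
  have hLn := fun n => Lfun_real (hpσ n) (heσ n) (hmσ n) (hDn n)
  have hDr : Tendsto (fun n =>
      (Dfun (fun x => a - b * ‖x‖) (φn (σ' n + N)) (Qn (σ' n + N))).toReal) atTop
      (𝓝 (a - b * gam.toReal + 1 - lam.toReal)) := by
    have e : (fun n => (Dfun (fun x => a - b * ‖x‖) (φn (σ' n + N)) (Qn (σ' n + N))).toReal) =
        fun n => a - b * (mom (Qn (σ' n + N))).toReal + 1
          - (Lfun (φn (σ' n + N)) (Qn (σ' n + N))).toReal := by
      funext n
      rw [hLn n, EReal.toReal_coe]; ring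
    rw [e]
    have h1 : Tendsto (fun n => (mom (Qn (σ' n + N))).toReal) atTop (𝓝 gam.toReal) :=
      (ENNReal.tendsto_toReal hgt).comp (hgam.comp hσ.tendsto_atTop)
    have h2 : Tendsto (fun n => (Lfun (φn (σ' n + N)) (Qn (σ' n + N))).toReal) atTop
        (𝓝 lam.toReal) :=
      (EReal.tendsto_toReal hlt hlam).comp (hl.comp hσ.tendsto_atTop)
    exact (((h1.const_mul b).const_sub a).add_const 1).sub h2
  have hR0 : 0 ≤ a - b * gam.toReal + 1 - lam.toReal :=
    ge_of_tendsto' hDr fun n => ENNReal.toReal_nonneg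
  have hDE : Tendsto (fun n => Dfun (fun x => a - b * ‖x‖) (φn (σ' n + N)) (Qn (σ' n + N))) atTop
      (𝓝 (ENNReal.ofReal (a - b * gam.toReal + 1 - lam.toReal))) := by
    have := ENNReal.tendsto_ofReal hDr
    refine this.congr fun n => ?_
    rw [ENNReal.ofReal_toReal (hDn n)]
  rw [hDE.liminf_eq] at hDl
  have hDt := ne_top_of_le_ne_top ENNReal.ofReal_ne_top hDl
  have hDl' := ENNReal.toReal_le_of_le_ofReal hR0 hDl
  refine ⟨fun n => σ' n + N, hσ, glim g, a, b, _, hb, hP, hE, heσ, ?_, ?_,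
    Lfun_real hP hE hmQ hDt, ?_⟩
  · intro x y hx t ht
    exact glim_U (φn := fun n => φn (σ' n + N)) hb hb1 heσ h0σ hg hx ht
  · intro x y hx hy
    exact glim_T (φn := fun n => φn (σ' n + N)) hb hb1 hpσ heσ h0σ hg hx hy
  · linarith

end P5


section P6
variable {d : ℕ}

theorem Lfun_le_Lprof {Q : Measure (EE d)} {φ : EE d → EReal} (h : IsPhi φ) : Lfun φ Q ≤ Lprof Q :=
  le_iSup₂ (f := fun φ (_ : φ ∈ {φ : EE d → EReal | IsPhi φ}) => Lfun φ Q) φ h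

theorem IsMLE.eq {Q : Measure (EE d)} {ψ : EE d → EReal} (h : IsMLE Q ψ) : Lprof Q = Lfun ψ Q :=
  le_antisymm (iSup₂_le fun φ hφ => h.2 φ hφ) (Lfun_le_Lprof h.1)

theorem coe_isPhi {r : EE d → ℝ} {a b : ℝ} (hb : 0 < b) (hr : Continuous r)
    (hc : ∀ x y, ∀ α β : ℝ, 0 < α → 0 < β → α + β = 1 → α * r x + β * r y ≤ r (α • x + β • y))
    (he : ∀ x, r x ≤ a - b * ‖x‖) : IsPhi (fun x => (r x : EReal)) := by
  refine isPhi_of_env hb (continuous_coe_real_ereal.comp hr).upperSemicontinuous ?_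
    (fun x => EReal.coe_le_coe_iff.2 (he x))
  intro x y α β hα hβ hαβ s t hs ht
  have h1 : s ≤ r x := EReal.coe_le_coe_iff.1 hs
  have h2 : t ≤ r y := EReal.coe_le_coe_iff.1 ht
  refine EReal.coe_le_coe_iff.2 (le_trans ?_ (hc x y α β hα hβ hαβ))
  gcongr

theorem negnorm_phi : IsPhi (fun x : EE d => ((0 - 1 * ‖x‖ : ℝ) : EReal)) := by
  refine coe_isPhi (a := 0) one_pos (by fun_prop) ?_ (fun x => le_rfl)
  intro x y α β hα hβ hαβ
  have := norm_add_le (α • x) (β • y)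
  rw [norm_smul, norm_smul, Real.norm_of_nonneg hα.le, Real.norm_of_nonneg hβ.le] at this
  linarith

theorem Lprof_ge0 (d : ℕ) : ∃ C : ℝ, ∀ Q : Measure (EE d), ∀ [IsProbabilityMeasure Q], mom Q ≠ ⊤ →
    ((C - (mom Q).toReal : ℝ) : EReal) ≤ Lprof Q := by
  have he : Env (fun x : EE d => ((0 - 1 * ‖x‖ : ℝ) : EReal)) 0 1 := fun x => le_rfl
  have hE := exp_int_lt_top he one_pos
  refine ⟨1 - (∫⁻ x : EE d, EReal.exp ((0 - 1 * ‖x‖ : ℝ) : EReal)).toReal, fun Q _ hm => ?_⟩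
  have hD : Dfun (fun x : EE d => 0 - 1 * ‖x‖) (fun x => ((0 - 1 * ‖x‖ : ℝ) : EReal)) Q =
      ∫⁻ x : EE d, EReal.exp ((0 - 1 * ‖x‖ : ℝ) : EReal) := by
    unfold Dfun
    have : ∀ x : EE d, (((0 - 1 * ‖x‖ : ℝ) : EReal) - ((0 - 1 * ‖x‖ : ℝ) : EReal)).toENNReal = 0 := by
      intro x
      rw [← EReal.coe_sub, sub_self]; simp
    simp only [this, lintegral_zero, zero_add]
  refine le_trans (le_of_eq ?_) (Lfun_le_Lprof (Q := Q) negnorm_phi)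
  rw [Lfun_real negnorm_phi he hm (by rw [hD]; exact hE), hD]
  congr 1; ring

theorem exists_mle {Q : Measure (EE d)} [IsProbabilityMeasure Q]
    (hQ : (interior (csupp Q)).Nonempty) (hL : Lprof Q ≠ ⊥) :
    mom Q ≠ ⊤ ∧ Lprof Q ≠ ⊤ ∧ ∃ ψ, IsMLE Q ψ := by
  have e : Lprof Q = sSup ((fun φ => Lfun φ Q) '' {φ : EE d → EReal | IsPhi φ}) := by
    rw [sSup_image]; rfl
  obtain ⟨u, -, hu, hmem⟩ := exists_seq_tendsto_sSup
    (S := (fun φ => Lfun φ Q) '' {φ : EE d → EReal | IsPhi φ}) ⟨_, _, negnorm_phi, rfl⟩ (OrderTop.bddAbove _)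
  rw [← e] at hu
  choose φn hφn hφu using hmem
  have hw : WConv (fun _ : ℕ => Q) Q := fun g => tendsto_const_nhds
  obtain ⟨hgt, hlt, σ, hσ, φ, a, b, A, hb, hφ, -, -, -, -, hA, hle⟩ := lemmaB (Qn := fun _ : ℕ => Q) hQ hw
    (φn := φn) (lam := Lprof Q) (gam := mom Q) (Eventually.of_forall hφn) hL
    (by simpa only [hφu] using hu) tendsto_const_nhds
  refine ⟨hgt, hlt, φ, hφ, fun φ' hφ' => ?_⟩
  refine (Lfun_le_Lprof hφ').trans ?_
  rw [hA, ← EReal.coe_toReal hlt hL]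
  exact EReal.coe_le_coe_iff.2 (by linarith)

/-- lower part of the continuity statement -/
theorem lower_part {Qn : ℕ → Measure (EE d)} {Q : Measure (EE d)}
    [∀ n, IsProbabilityMeasure (Qn n)] [IsProbabilityMeasure Q] (hw : WConv Qn Q) {lam : EReal}
    (hl : Tendsto (fun n => Lprof (Qn n)) atTop (𝓝 lam))
    (hgam : Tendsto (fun n => mom (Qn n)) atTop (𝓝 (mom Q))) (hm : mom Q ≠ ⊤)
    {φ : EE d → EReal} (hφ : IsPhi φ) : Lfun φ Q ≤ lam := by
  by_cases hbot : Lfun φ Q = ⊥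
  · rw [hbot]; exact bot_le
  obtain ⟨c, hc1, hc2⟩ := EReal.lt_iff_exists_real_btwn.1 (bot_lt_iff_ne_bot.2 hbot)
  obtain ⟨a, b, hb, hb1, he⟩ := hφ.env
  obtain ⟨p, hp⟩ := exists_ne_bot hφ hc2.le
  have h0 : (((φ p).toReal : ℝ) : EReal) ≤ φ p := (EReal.coe_toReal (hφ.2.1 p) hp).le
  set t0 := (φ p).toReal
  change Env φ a b at he
  have hD : Dfun (fun x => a - b * ‖x‖) φ Q ≠ ⊤ :=
    ((Lfun_ge_iff hφ.meas (lin_int hm a b) he).1 hc2.le).1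
  have hI : ∫⁻ x, (((a - b * ‖x‖ : ℝ) : EReal) - φ x).toENNReal ∂Q ≠ ⊤ :=
    ne_top_of_le_ne_top hD le_self_add
  have hmn : ∀ᶠ n in atTop, mom (Qn n) ≠ ⊤ := by
    filter_upwards [hgam.eventually (gt_mem_nhds hm.lt_top)] with n hn using hn.ne
  have hmr : Tendsto (fun n => (mom (Qn n)).toReal) atTop (𝓝 (mom Q).toReal) :=
    (ENNReal.tendsto_toReal hm).comp hgam
  -- step 1
  have step1 : ∀ k : ℕ, Lfun (fun x => (rr ((k : ℝ) + 1) φ x : EReal)) Q ≤ lam := by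
    intro k
    have hk := hkb hb1 k
    have hcont : Continuous (rr ((k : ℝ) + 1) φ) := lip_cont (rr_abs he hb hk h0)
    have hP : IsPhi (fun x => (rr ((k : ℝ) + 1) φ x : EReal)) :=
      coe_isPhi hb hcont (fun x y α β hα hβ hαβ => rr_conc he hb hk h0 hφ.conc hα hβ hαβ)
        (rr_le he hb hk h0)
    have hEnv : Env (fun x => (rr ((k : ℝ) + 1) φ x : EReal)) a b :=
      fun x => EReal.coe_le_coe_iff.2 (rr_le he hb hk h0 x)
    have hEt := exp_int_lt_top hEnv hb
    set B : ℝ := (k : ℝ) + 1 with hB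
    have hB0 : 0 ≤ B := by positivity
    set A : ℝ := B * ‖p‖ - t0 with hA
    have hh0 : ∀ x, 0 ≤ rr B φ x + A + B * ‖x‖ := by
      intro x
      have h1 := rr_ge he hb hk h0 x
      have h2 := mul_le_mul_of_nonneg_left (norm_sub_le x p) hB0
      linarith
    have hhc : Continuous fun x => rr B φ x + A + B * ‖x‖ := by fun_prop
    have hIntg : ∀ ν : Measure (EE d), ∀ [IsProbabilityMeasure ν], mom ν ≠ ⊤ →
        Integrable (fun x => rr B φ x + A + B * ‖x‖) ν := by
      intro ν _ hR
      refine (lin_int hR (a + A) (-B)).mono' hhc.aestronglyMeasurable (Eventually.of_forall fun x => ?_)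
      rw [Real.norm_of_nonneg (hh0 x)]
      have h1 := rr_le he hb hk h0 x
      have := mul_nonneg hb.le (norm_nonneg x)
      linarith
    have hIntgr : ∀ ν : Measure (EE d), ∀ [IsProbabilityMeasure ν], mom ν ≠ ⊤ →
        Integrable (rr B φ) ν := by
      intro ν _ hR
      refine ((hIntg ν hR).sub (lin_int hR A (-B))).congr (Eventually.of_forall fun x => ?_)
      simp only [Pi.sub_apply]; ring
    have hval : ∀ ν : Measure (EE d), ∀ [IsProbabilityMeasure ν], mom ν ≠ ⊤ →
        ∫ x, (rr B φ x + A + B * ‖x‖) ∂ν = ∫ x, rr B φ x ∂ν + A + B * (mom ν).toReal := by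
      intro ν _ hR
      have h1 := integral_add (hIntgr ν hR) (lin_int hR A (-B))
      rw [lin_val hR] at h1
      rw [add_assoc, ← sub_neg_eq_add A, ← neg_mul, ← h1]
      refine integral_congr_ae (Eventually.of_forall fun x => ?_)
      simp only; ring
    have hLR : ∀ ν : Measure (EE d), ∀ [IsProbabilityMeasure ν], mom ν ≠ ⊤ →
        Lfun (fun x => (rr B φ x : EReal)) ν =
          ((∫ x, rr B φ x ∂ν + 1 - (∫⁻ x, EReal.exp (rr B φ x : EReal)).toReal : ℝ) : EReal) := by
      intro ν _ hR
      have hD' : Dfun (rr B φ) (fun x => (rr B φ x : EReal)) ν =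
          ∫⁻ x, EReal.exp (rr B φ x : EReal) := by
        unfold Dfun
        have : ∀ x : EE d, ((rr B φ x : EReal) - (rr B φ x : EReal)).toENNReal = 0 := by
          intro x
          rw [← EReal.coe_sub, sub_self]; simp
        simp only [this, lintegral_zero, zero_add]
      rw [Lfun_eq hP.meas (hIntgr ν hR) (fun x => le_rfl), hD', sub_bot_aux hEt]
    have hfat := weak_fatou_const hw hhc hh0
    rw [hLR Q hm]
    refine EReal.ge_of_forall_gt_iff_ge.1 fun z hz => ?_
    have hz' : z < ∫ x, rr B φ x ∂Q + 1 - (∫⁻ x, EReal.exp (rr B φ x : EReal)).toReal := by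
      exact_mod_cast hz
    set E := (∫⁻ x, EReal.exp (rr B φ x : EReal)).toReal
    obtain ⟨w, hw1, hw2⟩ := exists_between hz'
    -- `w - 1 + E + A + B m < ∫ h dQ`
    have hlt : ENNReal.ofReal (w - 1 + E + A + B * (mom Q).toReal) <
        ∫⁻ x, ENNReal.ofReal (rr B φ x + A + B * ‖x‖) ∂Q ∨
        w - 1 + E + A + B * (mom Q).toReal < 0 := by
      by_cases hneg : w - 1 + E + A + B * (mom Q).toReal < 0
      · exact Or.inr hneg
      · left
        rw [← ofReal_integral_eq_lintegral_ofReal (hIntg Q hm) (Eventually.of_forall hh0), hval Q hm]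
        exact (ENNReal.ofReal_lt_ofReal_iff_of_nonneg (not_lt.1 hneg)).2 (by linarith)
    have hev : ∀ᶠ n in atTop, w - 1 + E + A + B * (mom Q).toReal <
        ∫ x, rr B φ x ∂(Qn n) + A + B * (mom (Qn n)).toReal := by
      rcases hlt with hlt | hlt
      · filter_upwards [eventually_lt_of_lt_liminf (hlt.trans_le hfat), hmn] with n hn hn2
        rw [← ofReal_integral_eq_lintegral_ofReal (hIntg _ hn2) (Eventually.of_forall hh0),
          hval _ hn2] at hn
        exact lt_of_not_ge fun hge => absurd hn (not_lt.2 (ENNReal.ofReal_le_ofReal hge))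
      · filter_upwards [hmn] with n hn
        rw [← hval _ hn]
        exact hlt.trans_le (integral_nonneg hh0)
    have hev2 : ∀ᶠ n in atTop, B * (mom (Qn n)).toReal < B * (mom Q).toReal + (w - z) :=
      (hmr.const_mul B).eventually (gt_mem_nhds (by linarith))
    refine ge_of_tendsto hl ?_
    filter_upwards [hev, hev2, hmn] with n h1 h2 h3
    refine le_trans ?_ (Lfun_le_Lprof hP)
    rw [hLR _ h3]
    exact EReal.coe_le_coe_iff.2 (by linarith)
  -- step 2
  have hEk : Tendsto (fun k : ℕ => ∫⁻ x, EReal.exp (rr ((k : ℝ) + 1) φ x : EReal)) atTop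
      (𝓝 (∫⁻ x, EReal.exp (φ x))) := by
    refine tendsto_lintegral_of_dominated_convergence
      (fun x => ENNReal.ofReal (Real.exp (a - b * ‖x‖))) (fun k => ?_) (fun k => ?_)
      (integrable_env d a hb).lintegral_lt_top.ne (Eventually.of_forall fun x => ?_)
    · have hcont : Continuous (rr ((k : ℝ) + 1) φ) := lip_cont (rr_abs he hb (hkb hb1 k) h0)
      exact EReal.measurable_exp.comp (continuous_coe_real_ereal.comp hcont).measurable
    · refine Eventually.of_forall fun x => ?_
      exact exp_env_le (φ := fun x => (rr ((k : ℝ) + 1) φ x : EReal))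
        (fun x => EReal.coe_le_coe_iff.2 (rr_le he hb (hkb hb1 k) h0 x)) x
    · suffices hs : Tendsto (fun k : ℕ => (rr ((k : ℝ) + 1) φ x : EReal)) atTop (𝓝 (φ x)) from
        (EReal.expOrderIso.continuous.tendsto (φ x)).comp hs
      refine tendsto_order.2 ⟨fun t ht => Eventually.of_forall fun k =>
        ht.trans_le (le_rr he hb (hkb hb1 k) x), fun t ht => ?_⟩
      obtain ⟨q, hq1, hq2⟩ := EReal.lt_iff_exists_real_btwn.1 ht
      obtain ⟨k0, hk0⟩ := rr_eventually he hb h0 hφ.1 hq1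
      obtain ⟨K, hK⟩ := exists_nat_ge k0
      filter_upwards [eventually_ge_atTop K] with k hk
      have : (K : ℝ) ≤ k := by exact_mod_cast hk
      exact lt_of_le_of_lt (EReal.coe_le_coe_iff.2 (hk0 _ (by linarith))) hq2
  have hEφ : ∫⁻ x, EReal.exp (φ x) ≠ ⊤ := exp_int_lt_top he hb
  have hEkr := (ENNReal.tendsto_toReal hEφ).comp hEk
  set I := (∫⁻ x, (((a - b * ‖x‖ : ℝ) : EReal) - φ x).toENNReal ∂Q).toReal with hIdef
  have hT : Tendsto (fun k : ℕ => ((a - b * (mom Q).toReal + 1 - (I +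
      (∫⁻ x, EReal.exp (rr ((k : ℝ) + 1) φ x : EReal)).toReal) : ℝ) : EReal)) atTop
      (𝓝 (Lfun φ Q)) := by
    rw [Lfun_real hφ he hm hD]
    unfold Dfun
    rw [ENNReal.toReal_add hI hEφ]
    exact EReal.tendsto_coe.2 ((hEkr.const_add I).const_sub _)
  refine le_of_tendsto' hT fun k => le_trans ?_ (step1 k)
  have hk := hkb hb1 k
  have hcont : Continuous (rr ((k : ℝ) + 1) φ) := lip_cont (rr_abs he hb hk h0)
  have hP : IsPhi (fun x => (rr ((k : ℝ) + 1) φ x : EReal)) :=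
    coe_isPhi hb hcont (fun x y α β hα hβ hαβ => rr_conc he hb hk h0 hφ.conc hα hβ hαβ)
      (rr_le he hb hk h0)
  have hEnv : Env (fun x => (rr ((k : ℝ) + 1) φ x : EReal)) a b :=
    fun x => EReal.coe_le_coe_iff.2 (rr_le he hb hk h0 x)
  have hEt := exp_int_lt_top hEnv hb
  have hIk : ∫⁻ x, (((a - b * ‖x‖ : ℝ) : EReal) - (rr ((k : ℝ) + 1) φ x : EReal)).toENNReal ∂Q ≤
      ∫⁻ x, (((a - b * ‖x‖ : ℝ) : EReal) - φ x).toENNReal ∂Q :=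
    lintegral_mono fun x => EReal.toENNReal_le_toENNReal
      (EReal.sub_le_sub le_rfl (le_rr he hb hk x))
  have hIkt := ne_top_of_le_ne_top hI hIk
  rw [Lfun_real hP hEnv hm (by unfold Dfun; exact ENNReal.add_ne_top.2 ⟨hIkt, hEt⟩)]
  unfold Dfun
  rw [ENNReal.toReal_add hIkt hEt]
  have := ENNReal.toReal_mono hI hIk
  exact EReal.coe_le_coe_iff.2 (by linarith)

end P6


section P7
variable {d : ℕ}

theorem le_of_ae_eq {φ ψ : EE d → EReal} (hφ : IsPhi φ) (hψ : IsPhi ψ) (h : φ =ᵐ[volume] ψ)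
    {x0 : EE d} {ε t0 : ℝ} (hε : 0 < ε) (h0 : ∀ z ∈ Metric.ball x0 ε, (t0 : EReal) ≤ ψ z) (x : EE d) :
    ψ x ≤ φ x := by
  by_contra hcon
  push Not at hcon
  obtain ⟨q, hq1, hq⟩ := EReal.lt_iff_exists_real_btwn.1 hcon
  obtain ⟨q', hq2, hq3⟩ := EReal.lt_iff_exists_real_btwn.1 hq
  have hqq : q < q' := by exact_mod_cast hq2
  obtain ⟨r, hr, hball⟩ := Metric.eventually_nhds_iff.1 (hφ.1 x q hq1)
  have h1 : Tendsto (fun s : ℝ => (1 - s) * q' + s * t0) (𝓝 0) (𝓝 q') := by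
    have : Continuous fun s : ℝ => (1 - s) * q' + s * t0 := by fun_prop
    simpa using this.tendsto 0
  have h2 : Tendsto (fun s : ℝ => s * (‖x0 - x‖ + ε)) (𝓝 0) (𝓝 0) := by
    have : Continuous fun s : ℝ => s * (‖x0 - x‖ + ε) := by fun_prop
    simpa using this.tendsto 0
  have hev : ∀ᶠ s in 𝓝[>] (0 : ℝ), q < (1 - s) * q' + s * t0 ∧ s * (‖x0 - x‖ + ε) < r ∧ s < 1 ∧ 0 < s := by
    filter_upwards [nhdsWithin_le_nhds (h1.eventually (lt_mem_nhds hqq)),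
      nhdsWithin_le_nhds (h2.eventually (gt_mem_nhds hr)),
      nhdsWithin_le_nhds (gt_mem_nhds (one_pos : (0 : ℝ) < 1)), self_mem_nhdsWithin]
      with s a1 a2 a3 a4 using ⟨a1, a2, a3, a4⟩
  obtain ⟨s, hs1, hs2, hs3, hs4⟩ := hev.exists
  have hsub : Metric.ball ((1 - s) • x + s • x0) (s * ε) ⊆ {y | ¬ φ y = ψ y} := by
    intro y hy
    rw [Metric.mem_ball, dist_eq_norm] at hy
    set z : EE d := x0 + s⁻¹ • (y - ((1 - s) • x + s • x0)) with hz
    have hzb : z ∈ Metric.ball x0 ε := by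
      rw [Metric.mem_ball, dist_eq_norm, hz, add_sub_cancel_left, norm_smul, norm_inv,
        Real.norm_of_nonneg hs4.le, inv_mul_lt_iff₀ hs4]
      exact hy
    have hy2 : y = (1 - s) • x + s • z := by
      rw [hz, smul_add, smul_smul, mul_inv_cancel₀ hs4.ne', one_smul]; abel
    have h3 : (((1 - s) * q' + s * t0 : ℝ) : EReal) ≤ ψ y := by
      rw [hy2]
      exact hψ.conc x z (1 - s) s (by linarith) hs4 (by ring) q' t0 hq3.le (h0 z hzb)
    have h4 : φ y < q := by
      apply hball
      rw [dist_eq_norm]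
      have e : y - x = s • (z - x) := by rw [hy2]; module
      rw [e, norm_smul, Real.norm_of_nonneg hs4.le]
      rw [Metric.mem_ball, dist_eq_norm] at hzb
      have : ‖z - x‖ ≤ ‖z - x0‖ + ‖x0 - x‖ := norm_sub_le_norm_sub_add_norm_sub z x0 x
      refine lt_of_le_of_lt ?_ hs2
      gcongr
      linarith
    intro he
    rw [he] at h4
    have : ((q : ℝ) : EReal) < ψ y := lt_of_lt_of_le (EReal.coe_lt_coe_iff.2 hs1) h3
    exact absurd h4 (not_lt.2 this.le)
  have hpos := Metric.measure_ball_pos (volume : Measure (EE d)) ((1 - s) • x + s • x0) (mul_pos hs4 hε)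
  have hz : volume {y | ¬ φ y = ψ y} = 0 := h
  exact absurd (measure_mono hsub) (by rw [hz]; exact not_le.2 hpos)

/-- midpoint of two functions -/
noncomputable def mid (φ ψ : EE d → EReal) (x : EE d) : EReal :=
  ((1 / 2 : ℝ) : EReal) * φ x + ((1 / 2 : ℝ) : EReal) * ψ x

theorem half_real (f p : ℝ) :
    ((1 / 2 : ℝ) : EReal) * (f : EReal) + ((1 / 2 : ℝ) : EReal) * (p : EReal)
      = ((1 / 2 * f + 1 / 2 * p : ℝ) : EReal) := by
  rw [EReal.coe_add, EReal.coe_mul, EReal.coe_mul]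

theorem half_bot : ((1 / 2 : ℝ) : EReal) * ⊥ = ⊥ := EReal.coe_mul_bot_of_pos (by norm_num)

theorem mid_cases {φ ψ : EE d → EReal} (hφ : ∀ x, φ x ≠ ⊤) (hψ : ∀ x, ψ x ≠ ⊤) (x : EE d) :
    (φ x = ⊥ ∧ mid φ ψ x = ⊥) ∨ (ψ x = ⊥ ∧ mid φ ψ x = ⊥) ∨
      ∃ f p : ℝ, φ x = f ∧ ψ x = p ∧ mid φ ψ x = ((1 / 2 * f + 1 / 2 * p : ℝ) : EReal) := by
  by_cases h1 : φ x = ⊥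
  · left; exact ⟨h1, by rw [mid, h1, half_bot, EReal.bot_add]⟩
  by_cases h2 : ψ x = ⊥
  · right; left; exact ⟨h2, by rw [mid, h2, half_bot, EReal.add_bot]⟩
  right; right
  refine ⟨(φ x).toReal, (ψ x).toReal, (EReal.coe_toReal (hφ x) h1).symm,
    (EReal.coe_toReal (hψ x) h2).symm, ?_⟩
  rw [← half_real, EReal.coe_toReal (hφ x) h1, EReal.coe_toReal (hψ x) h2, mid]

theorem mid_phi {φ ψ : EE d → EReal} (hφ : IsPhi φ) (hψ : IsPhi ψ) : IsPhi (mid φ ψ) := by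
  obtain ⟨a, b, hb, -, he⟩ := hφ.env
  obtain ⟨a', b', hb', -, he'⟩ := hψ.env
  refine isPhi_of_env (a := 1 / 2 * a + 1 / 2 * a') (b := 1 / 2 * b + 1 / 2 * b') (by positivity) ?_ ?_ ?_
  · have hm : Monotone fun z : EReal => ((1 / 2 : ℝ) : EReal) * z := fun z w h =>
      mul_le_mul_of_nonneg_left h (by exact_mod_cast (by norm_num : (0 : ℝ) ≤ 1 / 2))
    have hc : Continuous fun z : EReal => ((1 / 2 : ℝ) : EReal) * z :=
      continuous_iff_continuousAt.2 fun z => EReal.Tendsto.const_mul tendsto_id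
        (Or.inl (EReal.coe_ne_bot _)) (Or.inl (EReal.coe_ne_top _))
    have h1 := hc.comp_upperSemicontinuous hφ.1 hm
    have h2 := hc.comp_upperSemicontinuous hψ.1 hm
    refine h1.add' h2 fun x => EReal.continuousAt_add ?_ ?_
    · left
      change ((1 / 2 : ℝ) : EReal) * φ x ≠ ⊤
      by_cases h : φ x = ⊥
      · rw [h, half_bot]; exact bot_ne_top
      · rw [← EReal.coe_toReal (hφ.2.1 x) h, ← EReal.coe_mul]; exact EReal.coe_ne_top _
    · right
      change ((1 / 2 : ℝ) : EReal) * ψ x ≠ ⊤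
      by_cases h : ψ x = ⊥
      · rw [h, half_bot]; exact bot_ne_top
      · rw [← EReal.coe_toReal (hψ.2.1 x) h, ← EReal.coe_mul]; exact EReal.coe_ne_top _
  · intro x y α β hα hβ hαβ s t hs ht
    have hnb : ∀ s : ℝ, ¬ ((s : EReal) ≤ ⊥) := fun s h => EReal.coe_ne_bot s (le_bot_iff.1 h)
    rcases mid_cases hφ.2.1 hψ.2.1 x with ⟨_, h⟩ | ⟨_, h⟩ | ⟨f, p, hf, hp, h⟩
    · rw [h] at hs; exact absurd hs (hnb s)
    · rw [h] at hs; exact absurd hs (hnb s)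
    rcases mid_cases hφ.2.1 hψ.2.1 y with ⟨_, h'⟩ | ⟨_, h'⟩ | ⟨f', p', hf', hp', h'⟩
    · rw [h'] at ht; exact absurd ht (hnb t)
    · rw [h'] at ht; exact absurd ht (hnb t)
    rw [h] at hs
    rw [h'] at ht
    have hs' := EReal.coe_le_coe_iff.1 hs
    have ht' := EReal.coe_le_coe_iff.1 ht
    have e1 := hφ.conc x y α β hα hβ hαβ f f' hf.symm.le hf'.symm.le
    have e2 := hψ.conc x y α β hα hβ hαβ p p' hp.symm.le hp'.symm.le
    rcases mid_cases hφ.2.1 hψ.2.1 (α • x + β • y) with ⟨h_two, _⟩ | ⟨h_two, _⟩ | ⟨f_two, p_two, hf_two, hp_two, h_two⟩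
    · rw [h_two] at e1; exact absurd e1 (hnb _)
    · rw [h_two] at e2; exact absurd e2 (hnb _)
    rw [hf_two] at e1
    rw [hp_two] at e2
    have e1' := EReal.coe_le_coe_iff.1 e1
    have e2' := EReal.coe_le_coe_iff.1 e2
    rw [h_two]
    refine EReal.coe_le_coe_iff.2 ?_
    nlinarith
  · intro x
    rcases mid_cases hφ.2.1 hψ.2.1 x with ⟨_, h⟩ | ⟨_, h⟩ | ⟨f, p, hf, hp, h⟩
    · rw [h]; exact bot_le
    · rw [h]; exact bot_le
    have e1 := he x
    have e2 := he' x
    rw [hf] at e1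
    rw [hp] at e2
    have e1' := EReal.coe_le_coe_iff.1 e1
    have e2' := EReal.coe_le_coe_iff.1 e2
    rw [h]
    refine EReal.coe_le_coe_iff.2 ?_
    nlinarith

theorem half_ofReal {r : ℝ} : ENNReal.ofReal (1 / 2 * r) = ENNReal.ofReal (1 / 2) * ENNReal.ofReal r :=
  ENNReal.ofReal_mul (by norm_num)

theorem half_ne : ENNReal.ofReal (1 / 2) ≠ 0 := by
  rw [Ne, ENNReal.ofReal_eq_zero]; norm_num

theorem mid_lin {φ ψ : EE d → EReal} (hφ : ∀ x, φ x ≠ ⊤) (hψ : ∀ x, ψ x ≠ ⊤) {a : ℝ} (x : EE d)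
    (h1 : φ x ≤ a) (h2 : ψ x ≤ a) :
    ((a : EReal) - mid φ ψ x).toENNReal ≤ ENNReal.ofReal (1 / 2) * ((a : EReal) - φ x).toENNReal
      + ENNReal.ofReal (1 / 2) * ((a : EReal) - ψ x).toENNReal := by
  have hsb : (a : EReal) - ⊥ = ⊤ := EReal.coe_sub_bot a
  rcases mid_cases hφ hψ x with ⟨h, _⟩ | ⟨h, _⟩ | ⟨f, p, hf, hp, h⟩
  · rw [h, hsb, EReal.toENNReal_top, ENNReal.mul_top half_ne, top_add]; exact le_top
  · rw [h, hsb, EReal.toENNReal_top, ENNReal.mul_top half_ne, add_top]; exact le_top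
  · rw [h, hf, hp]
    rw [hf] at h1
    rw [hp] at h2
    have h1' := EReal.coe_le_coe_iff.1 h1
    have h2' := EReal.coe_le_coe_iff.1 h2
    simp only [← EReal.coe_sub, EReal.toENNReal_of_ne_top (EReal.coe_ne_top _), EReal.toReal_coe]
    rw [← half_ofReal, ← half_ofReal, ← ENNReal.ofReal_add (by linarith) (by linarith)]
    exact ENNReal.ofReal_le_ofReal (by linarith)

theorem mid_exp {φ ψ : EE d → EReal} (hφ : ∀ x, φ x ≠ ⊤) (hψ : ∀ x, ψ x ≠ ⊤) (x : EE d) :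
    EReal.exp (mid φ ψ x) ≤ ENNReal.ofReal (1 / 2) * EReal.exp (φ x)
      + ENNReal.ofReal (1 / 2) * EReal.exp (ψ x) ∧
    (EReal.exp (mid φ ψ x) = ENNReal.ofReal (1 / 2) * EReal.exp (φ x)
      + ENNReal.ofReal (1 / 2) * EReal.exp (ψ x) → φ x = ψ x) := by
  have hz : ∀ u v : EReal, 0 = ENNReal.ofReal (1 / 2) * EReal.exp u
      + ENNReal.ofReal (1 / 2) * EReal.exp v → u = v := by
    intro u v h
    have h3 := add_eq_zero.1 h.symm
    have e1 := (mul_eq_zero.1 h3.1).resolve_left half_ne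
    have e2 := (mul_eq_zero.1 h3.2).resolve_left half_ne
    rw [EReal.exp_eq_zero_iff] at e1 e2
    rw [e1, e2]
  rcases mid_cases hφ hψ x with ⟨_, h⟩ | ⟨_, h⟩ | ⟨f, p, hf, hp, h⟩
  · rw [h, EReal.exp_bot]; exact ⟨zero_le, hz _ _⟩
  · rw [h, EReal.exp_bot]; exact ⟨zero_le, hz _ _⟩
  · rw [h, hf, hp, EReal.exp_coe, EReal.exp_coe, EReal.exp_coe, ← half_ofReal, ← half_ofReal,
      ← ENNReal.ofReal_add (by positivity) (by positivity)]
    constructor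
    · refine ENNReal.ofReal_le_ofReal ?_
      exact convexOn_exp.2 (mem_univ f) (mem_univ p) (by norm_num) (by norm_num) (by norm_num)
    · intro he
      rw [ENNReal.ofReal_eq_ofReal_iff (by positivity) (by positivity)] at he
      by_contra hne
      have hne' : f ≠ p := fun h => hne (by rw [h])
      have := strictConvexOn_exp.2 (mem_univ f) (mem_univ p) hne' (by norm_num : (0 : ℝ) < 1 / 2)
        (by norm_num : (0 : ℝ) < 1 / 2) (by norm_num)
      simp only [smul_eq_mul] at this
      linarith

theorem mle_unique {Q : Measure (EE d)} [IsProbabilityMeasure Q]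
    (hQ : (interior (csupp Q)).Nonempty) (hL : Lprof Q ≠ ⊥) {φ ψ : EE d → EReal}
    (hφ : IsMLE Q φ) (hψ : IsMLE Q ψ) : φ = ψ := by
  obtain ⟨c, hc1, hc2⟩ := EReal.lt_iff_exists_real_btwn.1 (bot_lt_iff_ne_bot.2 hL)
  have hcφ : (c : EReal) ≤ Lfun φ Q := hφ.eq ▸ hc2.le
  have hcψ : (c : EReal) ≤ Lfun ψ Q := hψ.eq ▸ hc2.le
  have hw : WConv (fun _ : ℕ => Q) Q := fun g => tendsto_const_nhds
  obtain ⟨x0, ε, η, hε, hη, hη1, hfat⟩ := fat_of_wconv hQ hw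
  have hfat := hfat.exists.choose_spec
  obtain ⟨a, b, t0, hb, hb1, henv⟩ := env_uniform x0 c hε hη hη1
  obtain ⟨heφ, h0φ⟩ := henv Q hfat φ hφ.1 hcφ
  obtain ⟨heψ, h0ψ⟩ := henv Q hfat ψ hψ.1 hcψ
  have hχ := mid_phi hφ.1 hψ.1
  have hφa : ∀ x, φ x ≤ ((a : ℝ) : EReal) := fun x => Env.le_const heφ hb x
  have hψa : ∀ x, ψ x ≤ ((a : ℝ) : EReal) := fun x => Env.le_const heψ hb x
  have hχa : ∀ x, mid φ ψ x ≤ ((a : ℝ) : EReal) := by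
    intro x
    rcases mid_cases hφ.1.2.1 hψ.1.2.1 x with ⟨_, h⟩ | ⟨_, h⟩ | ⟨f, p, hf, hp, h⟩
    · rw [h]; exact bot_le
    · rw [h]; exact bot_le
    have e1 := hφa x
    have e2 := hψa x
    rw [hf] at e1
    rw [hp] at e2
    have e1' := EReal.coe_le_coe_iff.1 e1
    have e2' := EReal.coe_le_coe_iff.1 e2
    rw [h]
    exact EReal.coe_le_coe_iff.2 (by linarith)
  have hDφ := ((Lfun_ge_iff hφ.1.meas (integrable_const a) hφa).1 hcφ).1
  have hDψ := ((Lfun_ge_iff hψ.1.meas (integrable_const a) hψa).1 hcψ).1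
  have hLφ := Lfun_eq (Q := Q) hφ.1.meas (integrable_const a) hφa
  have hLψ := Lfun_eq (Q := Q) hψ.1.meas (integrable_const a) hψa
  rw [sub_bot_aux hDφ] at hLφ
  rw [sub_bot_aux hDψ] at hLψ
  have hDeq : (Dfun (fun _ => a) φ Q).toReal = (Dfun (fun _ => a) ψ Q).toReal := by
    have h := hφ.eq.symm.trans hψ.eq
    rw [hLφ, hLψ] at h
    have := EReal.coe_eq_coe_iff.1 h
    linarith
  set Iφ := ∫⁻ x, ((a : EReal) - φ x).toENNReal ∂Q with hIφ
  set Iψ := ∫⁻ x, ((a : EReal) - ψ x).toENNReal ∂Q with hIψ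
  set Iχ := ∫⁻ x, ((a : EReal) - mid φ ψ x).toENNReal ∂Q with hIχ
  set Eφ := ∫⁻ x, EReal.exp (φ x) with hEφ
  set Eψ := ∫⁻ x, EReal.exp (ψ x) with hEψ
  set Eχ := ∫⁻ x, EReal.exp (mid φ ψ x) with hEχ
  have d1 : Dfun (fun _ => a) φ Q = Iφ + Eφ := rfl
  have d2 : Dfun (fun _ => a) ψ Q = Iψ + Eψ := rfl
  have d3 : Dfun (fun _ => a) (mid φ ψ) Q = Iχ + Eχ := rfl
  rw [d1] at hDφ hDeq hLφ
  rw [d2] at hDψ hDeq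
  have hm1 : Measurable fun x => ((a : EReal) - φ x).toENNReal := by
    have := hφ.1.meas
    fun_prop
  have hm2 : Measurable fun x => ((a : EReal) - ψ x).toENNReal := by
    have := hψ.1.meas
    fun_prop
  have hx1 : Measurable fun x => EReal.exp (φ x) := EReal.measurable_exp.comp hφ.1.meas
  have hx2 : Measurable fun x => EReal.exp (ψ x) := EReal.measurable_exp.comp hψ.1.meas
  obtain ⟨hIφt, hEφt⟩ := ENNReal.add_ne_top.1 hDφ
  obtain ⟨hIψt, hEψt⟩ := ENNReal.add_ne_top.1 hDψ
  have hIle : Iχ ≤ ENNReal.ofReal (1 / 2) * Iφ + ENNReal.ofReal (1 / 2) * Iψ := by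
    rw [hIφ, hIψ, ← lintegral_const_mul _ hm1, ← lintegral_const_mul _ hm2,
      ← lintegral_add_left (hm1.const_mul _)]
    exact lintegral_mono fun x => mid_lin hφ.1.2.1 hψ.1.2.1 x (hφa x) (hψa x)
  have hEavg : ∫⁻ x, (ENNReal.ofReal (1 / 2) * EReal.exp (φ x)
      + ENNReal.ofReal (1 / 2) * EReal.exp (ψ x)) =
      ENNReal.ofReal (1 / 2) * Eφ + ENNReal.ofReal (1 / 2) * Eψ := by
    rw [hEφ, hEψ, ← lintegral_const_mul _ hx1, ← lintegral_const_mul _ hx2,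
      ← lintegral_add_left (hx1.const_mul _)]
  have hEle : Eχ ≤ ENNReal.ofReal (1 / 2) * Eφ + ENNReal.ofReal (1 / 2) * Eψ := by
    rw [← hEavg]
    exact lintegral_mono fun x => (mid_exp hφ.1.2.1 hψ.1.2.1 x).1
  have hRt : ∀ u v : ℝ≥0∞, u ≠ ⊤ → v ≠ ⊤ →
      ENNReal.ofReal (1 / 2) * u + ENNReal.ofReal (1 / 2) * v ≠ ⊤ := fun u v hu hv =>
    ENNReal.add_ne_top.2 ⟨ENNReal.mul_ne_top ENNReal.ofReal_ne_top hu,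
      ENNReal.mul_ne_top ENNReal.ofReal_ne_top hv⟩
  have hRv : ∀ u v : ℝ≥0∞, u ≠ ⊤ → v ≠ ⊤ →
      (ENNReal.ofReal (1 / 2) * u + ENNReal.ofReal (1 / 2) * v).toReal
        = 1 / 2 * u.toReal + 1 / 2 * v.toReal := fun u v hu hv => by
    rw [ENNReal.toReal_add (ENNReal.mul_ne_top ENNReal.ofReal_ne_top hu)
      (ENNReal.mul_ne_top ENNReal.ofReal_ne_top hv), ENNReal.toReal_mul, ENNReal.toReal_mul,
      ENNReal.toReal_ofReal (by norm_num)]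
  have hIχt : Iχ ≠ ⊤ := ne_top_of_le_ne_top (hRt _ _ hIφt hIψt) hIle
  have hEχt : Eχ ≠ ⊤ := ne_top_of_le_ne_top (hRt _ _ hEφt hEψt) hEle
  have hIr := ENNReal.toReal_mono (hRt _ _ hIφt hIψt) hIle
  rw [hRv _ _ hIφt hIψt] at hIr
  have hle := hφ.2 _ hχ
  rw [hLφ, Lfun_eq (Q := Q) hχ.meas (integrable_const a) hχa, d3,
    sub_bot_aux (ENNReal.add_ne_top.2 ⟨hIχt, hEχt⟩)] at hle
  have hle' := EReal.coe_le_coe_iff.1 hle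
  rw [ENNReal.toReal_add hIχt hEχt, ENNReal.toReal_add hIφt hEφt] at hle'
  rw [ENNReal.toReal_add hIψt hEψt, ENNReal.toReal_add hIφt hEφt] at hDeq
  have hge : ENNReal.ofReal (1 / 2) * Eφ + ENNReal.ofReal (1 / 2) * Eψ ≤ Eχ := by
    rw [← ENNReal.toReal_le_toReal (hRt _ _ hEφt hEψt) hEχt, hRv _ _ hEφt hEψt]
    linarith
  have hae := ae_eq_of_ae_le_of_lintegral_le
    (Eventually.of_forall fun x => (mid_exp hφ.1.2.1 hψ.1.2.1 x).1) hEχt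
    ((hx1.const_mul _).add (hx2.const_mul _)).aemeasurable (hEavg.le.trans hge)
  have hae2 : φ =ᵐ[volume] ψ := by
    filter_upwards [hae] with x hx using (mid_exp hφ.1.2.1 hψ.1.2.1 x).2 hx
  funext x
  exact le_antisymm (le_of_ae_eq hψ.1 hφ.1 hae2.symm hε h0φ x) (le_of_ae_eq hφ.1 hψ.1 hae2 hε h0ψ x)

end P7


section P8
variable {d : ℕ}

theorem expR_contAt {z : EReal} (hz : z ≠ ⊤) : ContinuousAt EReal.expR z := by
  have h1 : Continuous EReal.exp := EReal.expOrderIso.continuous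
  have h2 : EReal.exp z ≠ ⊤ := by
    induction z using EReal.rec with
    | bot => simp
    | coe r => simp
    | top => exact absurd rfl hz
  exact (ENNReal.tendsto_toReal h2).comp h1.continuousAt

theorem expR_pos_iff {z : EReal} (hz : z ≠ ⊤) : 0 < EReal.expR z ↔ z ≠ ⊥ := by
  induction z using EReal.rec with
  | bot => simp [EReal.expR]
  | coe r => simp [EReal.expR, ENNReal.toReal_ofReal (Real.exp_pos r).le, Real.exp_pos]
  | top => exact absurd rfl hz

theorem expR_nonneg (z : EReal) : 0 ≤ EReal.expR z := ENNReal.toReal_nonneg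

theorem expR_lt_of {z : EReal} {c : ℝ} (hc : 0 < c) : z < (Real.log c : EReal) → EReal.expR z < c := by
  intro h
  induction z using EReal.rec with
  | bot => simpa [EReal.expR] using hc
  | coe r =>
    have h' : r < Real.log c := by exact_mod_cast h
    have := (Real.lt_log_iff_exp_lt hc).1 h'
    simpa [EReal.expR, ENNReal.toReal_ofReal (Real.exp_pos r).le] using this
  | top => exact absurd h (by simp)

theorem lt_of_expR_lt {z : EReal} (hz : z ≠ ⊤) {c : ℝ} (h : EReal.expR z < c) :
    z < (Real.log c : EReal) := by
  have hc : 0 < c := (expR_nonneg z).trans_lt h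
  induction z using EReal.rec with
  | bot => exact EReal.bot_lt_coe _
  | coe r =>
    have : Real.exp r < c := by
      simpa [EReal.expR, ENNReal.toReal_ofReal (Real.exp_pos r).le] using h
    exact_mod_cast (Real.lt_log_iff_exp_lt hc).2 this
  | top => exact absurd rfl hz

theorem expR_env_le {φ : EE d → EReal} {a b : ℝ} (h : Env φ a b) (x : EE d) :
    EReal.expR (φ x) ≤ Real.exp (a - b * ‖x‖) := by
  have := ENNReal.toReal_mono ENNReal.ofReal_ne_top (exp_env_le h x)
  rwa [ENNReal.toReal_ofReal (Real.exp_pos _).le] at this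

theorem expR_meas {φ : EE d → EReal} (h : IsPhi φ) : Measurable fun x => EReal.expR (φ x) := by
  have h1 : Continuous EReal.exp := EReal.expOrderIso.continuous
  exact (h1.measurable.comp h.meas).ennreal_toReal

/-- A choice of maximizers along the sequence. -/
theorem choose_mle {Qn : ℕ → Measure (EE d)} [∀ n, IsProbabilityMeasure (Qn n)]
    (hQn : ∀ n, (interior (csupp (Qn n))).Nonempty) {lam : EReal} (hne : lam ≠ ⊥)
    (hlam : Tendsto (fun n => Lprof (Qn n)) atTop (𝓝 lam)) :
    ∃ (N : ℕ) (ψn : ℕ → EE d → EReal), (∀ n, IsPhi (ψn n)) ∧ (∀ n, N ≤ n → IsMLE (Qn n) (ψn n)) ∧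
      Tendsto (fun n => Lfun (ψn n) (Qn n)) atTop (𝓝 lam) := by
  have hev : ∀ᶠ n in atTop, Lprof (Qn n) ≠ ⊥ :=
    hlam.eventually (isOpen_ne.mem_nhds hne)
  obtain ⟨N, hN⟩ := eventually_atTop.1 hev
  have hex : ∀ n, ∃ ψ : EE d → EReal, IsPhi ψ ∧ (N ≤ n → IsMLE (Qn n) ψ) := by
    intro n
    by_cases h : N ≤ n
    · obtain ⟨-, -, ψ, hψ⟩ := exists_mle (hQn n) (hN n h)
      exact ⟨ψ, hψ.1, fun _ => hψ⟩
    · exact ⟨_, negnorm_phi, fun h' => absurd h' h⟩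
  choose ψn h1 h2 using hex
  refine ⟨N, ψn, h1, h2, hlam.congr' ?_⟩
  filter_upwards [eventually_ge_atTop N] with n hn
  exact (h2 n hn).eq

theorem sub_key {Qn : ℕ → Measure (EE d)} {Q : Measure (EE d)}
    [∀ n, IsProbabilityMeasure (Qn n)] [IsProbabilityMeasure Q]
    (hQ : (interior (csupp Q)).Nonempty) (hw : WConv Qn Q) (hb : Lprof Q ≠ ⊥)
    (hgam : Tendsto (fun n => mom (Qn n)) atTop (𝓝 (mom Q)))
    {ψn : ℕ → EE d → EReal} (hphi : ∀ n, IsPhi (ψn n))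
    (hl : Tendsto (fun n => Lfun (ψn n) (Qn n)) atTop (𝓝 (Lprof Q)))
    {ψ : EE d → EReal} (hψ : IsMLE Q ψ) {ns : ℕ → ℕ} (hns : Tendsto ns atTop atTop) :
    ∃ σ : ℕ → ℕ, StrictMono σ ∧ ∃ a b : ℝ, 0 < b ∧ Env ψ a b ∧ (∀ n, Env (ψn (ns (σ n))) a b) ∧
      (∀ (x : ℕ → EE d) (y : EE d), Tendsto x atTop (𝓝 y) → ∀ t, ψ y < t →
        ∀ᶠ n in atTop, ψn (ns (σ n)) (x n) < t) ∧
      (∀ (x : ℕ → EE d) (y : EE d), Tendsto x atTop (𝓝 y) → y ∉ frontier {x | ψ x ≠ ⊥} →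
        Tendsto (fun n => ψn (ns (σ n)) (x n)) atTop (𝓝 (ψ y))) := by
  obtain ⟨-, hlt, σ, hσ, φ, a, b, A, hb0, hφ, he, hen, hU, hC, hA, hle⟩ :=
    lemmaB (Qn := fun n => Qn (ns n)) hQ (hw.subseq hns) (φn := fun n => ψn (ns n)) (lam := Lprof Q)
      (gam := mom Q) (Eventually.of_forall fun n => hphi (ns n)) hb (hl.comp hns) (hgam.comp hns)
  have hm : IsMLE Q φ := by
    refine ⟨hφ, fun φ' hφ' => (Lfun_le_Lprof hφ').trans ?_⟩
    rw [hA, ← EReal.coe_toReal hlt hb]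
    exact EReal.coe_le_coe_iff.2 (by linarith)
  obtain rfl : φ = ψ := mle_unique hQ hb hm hψ
  exact ⟨σ, hσ, a, b, hb0, he, hen, hU, hC⟩

end P8

theorem Lprof_semicontinuity_full {d : ℕ}
    (Qn : ℕ → Measure (EuclideanSpace ℝ (Fin d))) (Q : Measure (EuclideanSpace ℝ (Fin d)))
    [∀ n, IsProbabilityMeasure (Qn n)] [IsProbabilityMeasure Q]
    (hQn : ∀ n, (interior (csupp (Qn n))).Nonempty) (hQ : (interior (csupp Q)).Nonempty)
    (hw : WConv Qn Q)
    (lam : EReal) (hlam : Tendsto (fun n => Lprof (Qn n)) atTop (𝓝 lam))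
    (gam : ℝ≥0∞) (hgam : Tendsto (fun n => ∫⁻ x, (‖x‖₊ : ℝ≥0∞) ∂(Qn n)) atTop (𝓝 gam)) :
    (∫⁻ x, (‖x‖₊ : ℝ≥0∞) ∂Q) ≤ gam ∧
    (lam ≠ ⊥ ↔ gam ≠ ⊤) ∧
    ((∫⁻ x, (‖x‖₊ : ℝ≥0∞) ∂Q) < gam → lam < Lprof Q) ∧
    (gam = (∫⁻ x, (‖x‖₊ : ℝ≥0∞) ∂Q) → gam ≠ ⊤ →
      (lam = Lprof Q ∧ Lprof Q ≠ ⊥ ∧ Lprof Q ≠ ⊤) ∧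
      ∀ ψ : EuclideanSpace ℝ (Fin d) → EReal, IsMLE Q ψ →
      ∃ (N : ℕ) (ψn : ℕ → EuclideanSpace ℝ (Fin d) → EReal),
        (∀ n, N ≤ n → IsMLE (Qn n) (ψn n)) ∧
        (∀ y : EuclideanSpace ℝ (Fin d), y ∉ frontier {x | 0 < EReal.expR (ψ x)} →
          ∀ x : ℕ → EuclideanSpace ℝ (Fin d), Tendsto x atTop (𝓝 y) →
            Tendsto (fun n => EReal.expR (ψn n (x n))) atTop (𝓝 (EReal.expR (ψ y)))) ∧
        (∀ y ∈ frontier {x | 0 < EReal.expR (ψ x)},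
          ∀ x : ℕ → EuclideanSpace ℝ (Fin d), Tendsto x atTop (𝓝 y) →
            Filter.limsup (fun n => EReal.expR (ψn n (x n))) atTop ≤ EReal.expR (ψ y)) ∧
        Tendsto (fun n => ∫ x, |EReal.expR (ψn n x) - EReal.expR (ψ x)|) atTop (𝓝 0)) := by
  change Tendsto (fun n => mom (Qn n)) atTop (𝓝 gam) at hgam
  change mom Q ≤ gam ∧ _ ∧ (mom Q < gam → _) ∧ (gam = mom Q → _)
  have hmle : mom Q ≤ gam := mom_le hw hgam
  obtain ⟨C, hC⟩ := Lprof_ge0 d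
  have hback : gam ≠ ⊤ → lam ≠ ⊥ := by
    intro hg
    have hev : ∀ᶠ n in atTop, mom (Qn n) ≠ ⊤ := hgam.eventually (isOpen_ne.mem_nhds hg)
    have ht : Tendsto (fun n => ((C - (mom (Qn n)).toReal : ℝ) : EReal)) atTop
        (𝓝 ((C - gam.toReal : ℝ) : EReal)) :=
      (continuous_coe_real_ereal.tendsto _).comp
        (tendsto_const_nhds.sub ((ENNReal.tendsto_toReal hg).comp hgam))
    have := le_of_tendsto_of_tendsto ht hlam (by
      filter_upwards [hev] with n hn
      exact hC (Qn n) hn)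
    intro hb
    rw [hb, le_bot_iff] at this
    exact EReal.coe_ne_bot _ this
  have hforw : lam ≠ ⊥ → gam ≠ ⊤ := by
    intro hl
    obtain ⟨N, ψn, h1, h2, h3⟩ := choose_mle hQn hl hlam
    exact (lemmaB hQ hw (Eventually.of_forall h1) hl h3 hgam).1
  refine ⟨hmle, ⟨hforw, hback⟩, ?_, ?_⟩
  · intro hlt
    by_cases hb : lam = ⊥
    · rw [hb]
      exact (EReal.bot_lt_coe _).trans_le (hC Q hlt.ne_top)
    obtain ⟨N, ψn, h1, h2, h3⟩ := choose_mle hQn hb hlam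
    obtain ⟨hg, hlt', σ, hσ, φ, a, b, A, hb0, hφ, -, -, -, -, hA, hle⟩ :=
      lemmaB hQ hw (Eventually.of_forall h1) hb h3 hgam
    refine lt_of_lt_of_le ?_ (Lfun_le_Lprof hφ)
    rw [hA, ← EReal.coe_toReal hlt' hb]
    have h4 : (mom Q).toReal < gam.toReal := (ENNReal.toReal_lt_toReal hlt.ne_top hg).2 hlt
    have h5 := mul_lt_mul_of_pos_left h4 hb0
    exact EReal.coe_lt_coe_iff.2 (by linarith)
  intro hgeq hg
  subst hgeq
  have hb := hback hg
  obtain ⟨N, ψn, h1, h2, h3⟩ := choose_mle hQn hb hlam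
  have hfin : lam ≠ ⊤ ∧ lam ≤ Lprof Q := by
    obtain ⟨-, hlt', σ, hσ, φ, a, b, A, hb0, hφ, -, -, -, -, hA, hle⟩ :=
      lemmaB hQ hw (Eventually.of_forall h1) hb h3 hgam
    refine ⟨hlt', le_trans ?_ (Lfun_le_Lprof hφ)⟩
    rw [hA, ← EReal.coe_toReal hlt' hb]
    exact EReal.coe_le_coe_iff.2 (by linarith)
  have heq : lam = Lprof Q :=
    le_antisymm hfin.2 (iSup₂_le fun φ hφ => lower_part hw hlam hgam hg hφ)
  subst heq
  refine ⟨⟨rfl, hb, hfin.1⟩, fun ψ hψ => ⟨N, ψn, h2, ?_, ?_, ?_⟩⟩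
  · intro y hy x hx
    have hset : {x | 0 < EReal.expR (ψ x)} = {x | ψ x ≠ ⊥} := by
      ext z; exact expR_pos_iff (hψ.1.2.1 z)
    rw [hset] at hy
    refine tendsto_of_subseq_tendsto fun ns hns => ?_
    obtain ⟨σ, hσ, a, b, hb0, he, hen, hU, hCt⟩ := sub_key hQ hw hb hgam h1 h3 hψ hns
    exact ⟨σ, (expR_contAt (hψ.1.2.1 y)).tendsto.comp
      (hCt (fun n => x (ns (σ n))) y (hx.comp (hns.comp hσ.tendsto_atTop)) hy)⟩
  · intro y _ x hx
    refine le_of_forall_gt_imp_ge_of_dense fun c hc => ?_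
    refine limsup_le_of_le (isCoboundedUnder_le_of_le atTop (x := 0) fun n => expR_nonneg _) ?_
    by_contra hcon
    have hfr : ∃ᶠ n in atTop, c ≤ EReal.expR (ψn n (x n)) := by
      refine (not_eventually.1 hcon).mono fun n hn => (not_le.1 hn).le
    obtain ⟨ns, hns, hge⟩ := extraction_of_frequently_atTop hfr
    obtain ⟨σ, hσ, a, b, hb0, he, hen, hU, hCt⟩ :=
      sub_key hQ hw hb hgam h1 h3 hψ hns.tendsto_atTop
    have hev := hU (fun n => x (ns (σ n))) y
      (hx.comp (hns.tendsto_atTop.comp hσ.tendsto_atTop)) _ (lt_of_expR_lt (hψ.1.2.1 y) hc)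
    obtain ⟨n, hn⟩ := hev.exists
    exact absurd (expR_lt_of ((expR_nonneg _).trans_lt hc) hn) (not_lt.2 (hge (σ n)))
  · refine tendsto_of_subseq_tendsto fun ns hns => ?_
    obtain ⟨σ, hσ, a, b, hb0, he, hen, hU, hCt⟩ := sub_key hQ hw hb hgam h1 h3 hψ hns
    refine ⟨σ, ?_⟩
    have hdc := tendsto_integral_of_dominated_convergence (μ := (volume : Measure (EE d)))
      (F := fun n x => |EReal.expR (ψn (ns (σ n)) x) - EReal.expR (ψ x)|) (f := fun _ => (0 : ℝ))
      (fun x => 2 * Real.exp (a - b * ‖x‖))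
      (fun n => (((expR_meas (h1 _)).sub (expR_meas hψ.1)).abs).aestronglyMeasurable)
      ((integrable_env d a hb0).const_mul 2)
      (fun n => Eventually.of_forall fun x => by
        have e1 := expR_env_le (hen n) x
        have e2 := expR_env_le he x
        have e3 := expR_nonneg (ψn (ns (σ n)) x)
        have e4 := expR_nonneg (ψ x)
        rw [Real.norm_eq_abs, abs_abs, abs_le]
        constructor <;> linarith)
      (by
        have hnull : (volume : Measure (EE d)) (frontier {x | ψ x ≠ ⊥}) = 0 :=
          hψ.1.conc.convex_dom.addHaar_frontier _
        filter_upwards [compl_mem_ae_iff.2 hnull] with y hy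
        have h := (expR_contAt (hψ.1.2.1 y)).tendsto.comp
          (hCt (fun _ => y) y tendsto_const_nhds hy)
        have h' := (h.sub_const (EReal.expR (ψ y))).abs
        simpa using h')
    simpa using hdc
end

section
/- For any probability distribution Q on ℝ with finite first moment, L(Q) ≤ −log( 2 ∫ |x − Med(Q)| Q(dx) ) ≤ −log( ∫ |x − μ(Q)| Q(dx) ), where Med(Q) is any median of Q and μ(Q) := ∫ x Q(dx) is its mean. -/
open MeasureTheory Filter Topology Set
open scoped ENNReal RealInnerProductSpace BoundedContinuousFunction

lemma IsPhi.exists_bound {φ : ℝ → EReal} (h : IsPhi φ) : ∃ C : ℝ, ∀ x, φ x ≤ C := by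
  obtain ⟨husc, htop, -, hlim⟩ := h
  have h1 : ∀ᶠ x in Filter.comap (fun x : ℝ => ‖x‖) atTop, φ x < 0 :=
    hlim.eventually (gt_mem_nhds EReal.bot_lt_zero)
  rw [Filter.eventually_comap] at h1
  obtain ⟨R, hR⟩ := Filter.eventually_atTop.1 h1
  obtain ⟨x₀, -, hx₀⟩ := UpperSemicontinuousOn.exists_isMaxOn (s := Metric.closedBall (0 : ℝ) |R|)
    ⟨0, by simp⟩ (isCompact_closedBall _ _) (husc.upperSemicontinuousOn _)
  refine ⟨max 0 (φ x₀).toReal, fun x => ?_⟩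
  rw [EReal.coe_strictMono.monotone.map_max]
  by_cases hx : ‖x‖ ≤ |R|
  · refine le_max_of_le_right ((hx₀ (by simpa using hx)).trans (EReal.le_coe_toReal (htop _)))
  · exact le_max_of_le_left (hR ‖x‖ ((le_abs_self R).trans (not_le.1 hx).le) x rfl).le

lemma IsPhi.convex_hypo {φ : ℝ → EReal} (h : IsPhi φ) :
    Convex ℝ {p : ℝ × ℝ | (p.2 : EReal) ≤ φ p.1} := by
  obtain ⟨-, -, hc, -⟩ := h
  rw [convex_iff_forall_pos]
  rintro ⟨x, s⟩ hx ⟨y, t⟩ hy a b ha hb hab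
  simp only [mem_ofPred_eq] at hx hy ⊢
  refine le_trans ?_ (hc x y a b ha hb hab)
  simp only [Prod.smul_mk, Prod.mk_add_mk, smul_eq_mul, EReal.coe_add, EReal.coe_mul]
  exact add_le_add (mul_le_mul_of_nonneg_left hx (by exact_mod_cast ha.le))
    (mul_le_mul_of_nonneg_left hy (by exact_mod_cast hb.le))

lemma IsPhi.closed_hypo {φ : ℝ → EReal} (h : IsPhi φ) :
    IsClosed {p : ℝ × ℝ | (p.2 : EReal) ≤ φ p.1} := by
  have := h.1.IsClosed_hypograph
  exact this.preimage (f := fun p : ℝ × ℝ => (p.1, (p.2 : EReal)))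
    (continuous_fst.prodMk (continuous_coe_real_ereal.comp continuous_snd))

/-- Splitting at the median. -/
lemma median_split (Q : Measure ℝ) [IsProbabilityMeasure Q] (med : ℝ)
    (hmed₁ : (1 : ℝ≥0∞) / 2 ≤ Q (Set.Iic med)) (hmed₂ : (1 : ℝ≥0∞) / 2 ≤ Q (Set.Ici med)) :
    ∃ N P : Measure ℝ, N + P = Q ∧ N univ = 1 / 2 ∧ P univ = 1 / 2 ∧
      (∀ᵐ x ∂N, x ≤ med) ∧ (∀ᵐ x ∂P, med ≤ x) := by
  have e1 : Q (Ioi med) + Q (Iic med) = 1 := by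
    rw [← compl_Iic, add_comm, prob_add_prob_compl measurableSet_Iic]
  have e2 : Q (Iio med) + Q (Ici med) = 1 := by
    rw [← compl_Ici, add_comm, prob_add_prob_compl measurableSet_Ici]
  have e3 : Q (Iio med) + Q {med} = Q (Iic med) := by
    rw [← measure_union (by simp) (measurableSet_singleton _), Set.Iio_union_right]
  have half : (1 : ℝ≥0∞) / 2 + 1 / 2 = 1 := ENNReal.add_halves 1
  have hne : (1 : ℝ≥0∞) / 2 ≠ ⊤ := by simp
  have i1 : Q (Ioi med) ≤ 1 / 2 := by
    rw [← ENNReal.add_le_add_iff_right hne, half]; exact le_trans (by gcongr) e1.le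
  have i2 : Q (Iio med) ≤ 1 / 2 := by
    rw [← ENNReal.add_le_add_iff_right hne, half]; exact le_trans (by gcongr) e2.le
  obtain ⟨c, hc⟩ := exists_add_of_le i1
  obtain ⟨d, hd⟩ := exists_add_of_le i2
  have hcd : d + c = Q {med} := by
    have : (Q (Ioi med) + Q (Iio med)) + (d + c) = (Q (Ioi med) + Q (Iio med)) + Q {med} := by
      rw [add_assoc (Q (Ioi med)) _ (Q {med}), e3, e1, ← half]
      nth_rw 1 [hc]; rw [hd]; ring
    exact (ENNReal.add_right_inj (by finiteness)).1 this
  refine ⟨Q.restrict (Iio med) + d • Measure.dirac med,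
    Q.restrict (Ioi med) + c • Measure.dirac med, ?_, ?_, ?_, ?_, ?_⟩
  · have : Q.restrict (Iio med) + d • Measure.dirac med +
        (Q.restrict (Ioi med) + c • Measure.dirac med) =
        Q.restrict (Iio med) + Q.restrict {med} + Q.restrict (Ioi med) := by
      rw [Measure.restrict_singleton, ← hcd, add_smul]; abel
    rw [this, ← Measure.restrict_union (by simp) (measurableSet_singleton _), Set.Iio_union_right,
      ← Measure.restrict_union (by simp) measurableSet_Ioi, Iic_union_Ioi, Measure.restrict_univ]
  · simp [← hd]
  · simp [← hc]
  · rw [ae_add_measure_iff]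
    refine ⟨?_, Measure.ae_smul_measure (by simp [ae_dirac_eq]) _⟩
    filter_upwards [ae_restrict_mem measurableSet_Iio] with x hx using hx.le
  · rw [ae_add_measure_iff]
    refine ⟨?_, Measure.ae_smul_measure (by simp [ae_dirac_eq]) _⟩
    filter_upwards [ae_restrict_mem measurableSet_Ioi] with x hx using le_of_lt hx

/-- Jensen for `φ ∈ Φ`. -/
lemma IsPhi.jensen {φ : ℝ → EReal} (h : IsPhi φ) (N : Measure ℝ) (hN : N univ = 1 / 2)
    (hb : ∀ᵐ x ∂N, φ x ≠ ⊥) (hx : Integrable (fun x => x) N)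
    (hf : Integrable (fun x => (φ x).toReal) N) :
    ((2 * ∫ x, (φ x).toReal ∂N : ℝ) : EReal) ≤ φ (2 * ∫ x, x ∂N) := by
  have : IsProbabilityMeasure ((2 : ℝ≥0∞) • N) := ⟨by
    rw [Measure.smul_apply, hN, smul_eq_mul, one_div, ENNReal.mul_inv_cancel (by simp) (by simp)]⟩
  have hx' := hx.smul_measure (c := 2) (by simp)
  have hf' := hf.smul_measure (c := 2) (by simp)
  have key := Convex.integral_mem (μ := (2 : ℝ≥0∞) • N) (f := fun x => (x, (φ x).toReal))
    h.convex_hypo h.closed_hypo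
    (Measure.ae_smul_measure (by
      filter_upwards [hb] with x hx
      simp [EReal.coe_toReal (h.2.1 x) hx]) _) (hx'.prodMk hf')
  simp only [mem_ofPred_eq] at key
  rw [fst_integral (hx'.prodMk hf'), snd_integral (hx'.prodMk hf')] at key
  simpa [integral_smul_measure] using key

lemma IsPhi.exp_lower {φ : ℝ → EReal} (h : IsPhi φ) {a b α β : ℝ} (hab : a < b)
    (ha : (α : EReal) ≤ φ a) (hb : (β : EReal) ≤ φ b) :
    ENNReal.ofReal ((b - a) * Real.exp ((α + β) / 2)) ≤ ∫⁻ x, EReal.exp (φ x) := by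
  set l : ℝ → ℝ := fun x => α + (x - a) / (b - a) * (β - α) with hl
  set s := (α + β) / 2 with hs
  have hba : 0 < b - a := sub_pos.2 hab
  have hlx : ∀ x ∈ Icc a b, (l x : EReal) ≤ φ x := by
    intro x hx
    have := h.convex_hypo (x := (a, α)) ha (y := (b, β)) hb (a := (b - x) / (b - a))
      (b := (x - a) / (b - a)) (div_nonneg (by linarith [hx.2]) hba.le)
      (div_nonneg (by linarith [hx.1]) hba.le) (by field_simp; ring)
    simp only [Prod.smul_mk, Prod.mk_add_mk, smul_eq_mul, mem_ofPred_eq] at this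
    convert this using 2
    · simp only [hl]; field_simp; ring
    · field_simp; ring
  have hc : Continuous fun x => Real.exp (l x) := by fun_prop
  have hc2 : Continuous fun x => Real.exp s * (1 + (l x - s)) := by fun_prop
  calc ENNReal.ofReal ((b - a) * Real.exp s)
      ≤ ENNReal.ofReal (∫ x in Icc a b, Real.exp (l x)) := by
        apply ENNReal.ofReal_le_ofReal
        have e : (b - a) * Real.exp s = ∫ x in Icc a b, Real.exp s * (1 + (l x - s)) := by
          have : ∀ x, HasDerivAt (fun x => Real.exp s *
              (x + ((α - s) * x + (x - a) ^ 2 / 2 / (b - a) * (β - α))))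
              (Real.exp s * (1 + (l x - s))) x := by
            intro x
            have h1 := (hasDerivAt_id x)
            have h2 := ((((h1.sub_const a).pow 2).div_const 2).div_const (b - a)).mul_const (β - α)
            refine ((h1.add ((h1.const_mul (α - s)).add h2)).const_mul (Real.exp s)).congr_deriv ?_
            simp [hl]; ring
          rw [integral_Icc_eq_integral_Ioc, ← intervalIntegral.integral_of_le hab.le,
            intervalIntegral.integral_eq_sub_of_hasDerivAt (fun x _ => this x)
              (hc2.intervalIntegrable _ _)]
          simp only [hs]
          field_simp
          ring
        rw [e]
        apply integral_mono (hc2.integrableOn_Icc) (hc.integrableOn_Icc)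
        intro x
        have : Real.exp (l x) = Real.exp s * Real.exp (l x - s) := by
          rw [← Real.exp_add]; congr 1; ring
        simp only [this]
        gcongr
        linarith [Real.add_one_le_exp (l x - s)]
    _ = ∫⁻ x in Icc a b, ENNReal.ofReal (Real.exp (l x)) :=
        ofReal_integral_eq_lintegral_ofReal hc.integrableOn_Icc
          (ae_of_all _ fun x => (Real.exp_pos _).le)
    _ ≤ ∫⁻ x in Icc a b, EReal.exp (φ x) := by
        apply setLIntegral_mono' measurableSet_Icc
        intro x hx
        rw [← EReal.exp_coe]
        exact EReal.exp_monotone (hlx x hx)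
    _ ≤ _ := setLIntegral_le_lintegral _ _

lemma IsPhi.eint_cases {φ : ℝ → EReal} (h : IsPhi φ) (Q : Measure ℝ) [IsProbabilityMeasure Q] :
    eint Q φ = ⊥ ∨ ((∀ᵐ x ∂Q, φ x ≠ ⊥) ∧ Integrable (fun x => (φ x).toReal) Q ∧
      eint Q φ = ((∫ x, (φ x).toReal ∂Q : ℝ) : EReal)) := by
  obtain ⟨C, hC⟩ := h.exists_bound
  have hm : Measurable φ := h.1.measurable
  have hfm : Measurable (fun x => (φ x).toReal) := measurable_ereal_toReal.comp hm
  have hpos : ∀ x, (φ x).toENN = ENNReal.ofReal (φ x).toReal := fun x => if_neg (h.2.1 x)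
  by_cases hneg : ∫⁻ x, (-(φ x)).toENN ∂Q = ⊤
  · left
    simp [eint, hneg]
  right
  have hnm : Measurable fun x => (-(φ x)).toENN := by
    unfold EReal.toENN
    exact Measurable.ite (hm.neg (measurableSet_singleton _)) measurable_const
      (measurable_ereal_toReal.comp hm.neg).ennreal_ofReal
  have hb : ∀ᵐ x ∂Q, φ x ≠ ⊥ := by
    filter_upwards [ae_lt_top hnm hneg] with x hx hx'
    simp [hx', EReal.toENN] at hx
  have hn : ∀ᵐ x ∂Q, (-(φ x)).toENN = ENNReal.ofReal (-(φ x).toReal) := by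
    filter_upwards [hb] with x hx
    rw [EReal.toENN, if_neg (by simpa using hx), EReal.toReal_neg_eq]
  rw [lintegral_congr_ae hn] at hneg
  have hposf : ∫⁻ x, ENNReal.ofReal (φ x).toReal ∂Q ≠ ⊤ := by
    refine ne_top_of_le_ne_top (b := ENNReal.ofReal C) (by simp) ?_
    calc _ ≤ ∫⁻ x, ENNReal.ofReal C ∂Q := by
          apply lintegral_mono_ae
          filter_upwards [hb] with x hx
          exact ENNReal.ofReal_le_ofReal (by
            rw [← EReal.coe_le_coe_iff, EReal.coe_toReal (h.2.1 x) hx]; exact hC x)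
      _ = _ := by simp
  have hint : Integrable (fun x => (φ x).toReal) Q := by
    refine ⟨hfm.aestronglyMeasurable, ?_⟩
    rw [hasFiniteIntegral_iff_norm]
    refine lt_of_le_of_lt (lintegral_mono (g := fun x => ENNReal.ofReal (φ x).toReal +
      ENNReal.ofReal (-(φ x).toReal)) fun x => ?_) ?_
    · simp only [Real.norm_eq_abs]
      rcases le_total 0 (φ x).toReal with h0 | h0
      · rw [abs_of_nonneg h0]; exact le_self_add
      · rw [abs_of_nonpos h0]; exact le_add_self
    · rw [lintegral_add_left hfm.ennreal_ofReal]
      exact ENNReal.add_lt_top.2 ⟨hposf.lt_top, lt_top_iff_ne_top.2 hneg⟩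
  refine ⟨hb, hint, ?_⟩
  rw [integral_eq_lintegral_pos_part_sub_lintegral_neg_part hint, eint, lintegral_congr_ae hn]
  simp only [hpos]
  rw [EReal.coe_sub, EReal.coe_ennreal_toReal hposf, EReal.coe_ennreal_toReal hneg]

lemma Lfun_le_s12 (Q : Measure ℝ) [IsProbabilityMeasure Q] (hx : Integrable (fun x => x) Q)
    (med : ℝ) (hmed₁ : (1 : ℝ≥0∞) / 2 ≤ Q (Set.Iic med))
    (hmed₂ : (1 : ℝ≥0∞) / 2 ≤ Q (Set.Ici med)) {φ : ℝ → EReal} (h : IsPhi φ)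
    (hM : 0 < ∫ x, |x - med| ∂Q) :
    Lfun φ Q ≤ ((- Real.log (2 * ∫ x, |x - med| ∂Q) : ℝ) : EReal) := by
  rcases h.eint_cases Q with he | ⟨hb, hf, he⟩
  · simp [Lfun, he]
  obtain ⟨N, P, hNP, hN, hP, hNle, hPle⟩ := median_split Q med hmed₁ hmed₂
  have hxQ := hx
  have hfQ := hf
  have hbQ := hb
  have hdQ : Integrable (fun x => |x - med|) Q := (hx.sub (integrable_const med)).abs
  have : IsFiniteMeasure N := ⟨by rw [hN]; simp⟩
  have : IsFiniteMeasure P := ⟨by rw [hP]; simp⟩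
  rw [← hNP] at hx hf hb hdQ
  rw [integrable_add_measure] at hx hf hdQ
  rw [ae_add_measure_iff] at hb
  have hNr : N.real univ = 1 / 2 := by simp [Measure.real, hN]
  have hPr : P.real univ = 1 / 2 := by simp [Measure.real, hP]
  have j1 := h.jensen N hN hb.1 hx.1 hf.1
  have j2 := h.jensen P hP hb.2 hx.2 hf.2
  have hs : ∫ x, (φ x).toReal ∂Q = ∫ x, (φ x).toReal ∂N + ∫ x, (φ x).toReal ∂P := by
    rw [← hNP, integral_add_measure hf.1 hf.2]
  have hd : ∫ x, |x - med| ∂Q = ∫ x, x ∂P - ∫ x, x ∂N := by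
    rw [← hNP, integral_add_measure hdQ.1 hdQ.2]
    have e1 : ∫ x, |x - med| ∂N = ∫ x, (med - x) ∂N := by
      apply integral_congr_ae
      filter_upwards [hNle] with x hx
      rw [abs_of_nonpos (by linarith)]; ring
    have e2 : ∫ x, |x - med| ∂P = ∫ x, (x - med) ∂P := by
      apply integral_congr_ae
      filter_upwards [hPle] with x hx
      rw [abs_of_nonneg (by linarith)]
    rw [e1, e2, integral_sub (integrable_const _) hx.1, integral_sub hx.2 (integrable_const _)]
    simp [hNr, hPr]
  have key := h.exp_lower (by linarith) j1 j2
  set s := ∫ x, (φ x).toReal ∂Q with hsdef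
  set M := ∫ x, |x - med| ∂Q with hMdef
  rw [show (2 * ∫ x, x ∂P) - 2 * ∫ x, x ∂N = 2 * M by rw [hd]; ring,
    show (2 * ∫ x, (φ x).toReal ∂N + 2 * ∫ x, (φ x).toReal ∂P) / 2 = s by rw [hs]; ring] at key
  have hpos : 0 < 2 * M * Real.exp s := by positivity
  have key2 : ((2 * M * Real.exp s : ℝ) : EReal) ≤ ((∫⁻ x, EReal.exp (φ x) : ℝ≥0∞) : EReal) := by
    have := EReal.coe_ennreal_le_coe_ennreal_iff.2 key
    rwa [EReal.coe_ennreal_ofReal, max_eq_left hpos.le] at this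
  have hlog : s - 2 * M * Real.exp s + 1 ≤ - Real.log (2 * M) := by
    have := Real.log_le_sub_one_of_pos hpos
    rw [Real.log_mul (by positivity) (by positivity), Real.log_exp] at this
    linarith
  calc Lfun φ Q = (s : EReal) - ((∫⁻ x, EReal.exp (φ x) : ℝ≥0∞) : EReal) + 1 := by rw [Lfun, he]
    _ ≤ (s : EReal) - ((2 * M * Real.exp s : ℝ) : EReal) + 1 := by
        gcongr
        exact EReal.sub_le_sub le_rfl key2
    _ = ((s - 2 * M * Real.exp s + 1 : ℝ) : EReal) := by push_cast; rfl
    _ ≤ _ := by exact_mod_cast hlog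

/-- **Lemma 3.** For any distribution `Q` on `ℝ` with finite first moment,
`L(Q) ≤ -log(2 ∫|x - Med(Q)| dQ) ≤ -log(∫|x - μ(Q)| dQ)`, where `Med(Q)` is any median and
`μ(Q)` the mean; the inequalities are in `[-∞, ∞]` with `-log 0 = ∞`. -/
theorem Lprof_le_neg_log_mean_abs_deviation
    (Q : Measure ℝ) [IsProbabilityMeasure Q] (hmom : (∫⁻ x, (‖x‖₊ : ℝ≥0∞) ∂Q) ≠ ⊤)
    (med : ℝ) (hmed₁ : (1 : ℝ≥0∞) / 2 ≤ Q (Set.Iic med)) (hmed₂ : (1 : ℝ≥0∞) / 2 ≤ Q (Set.Ici med)) :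
    Lprof Q ≤ - ENNReal.log (2 * ∫⁻ x, ENNReal.ofReal |x - med| ∂Q) ∧
    - ENNReal.log (2 * ∫⁻ x, ENNReal.ofReal |x - med| ∂Q)
      ≤ - ENNReal.log (∫⁻ x, ENNReal.ofReal |x - (∫ y, y ∂Q)| ∂Q) := by
  have hx : Integrable (fun x => x) Q :=
    ⟨measurable_id.aestronglyMeasurable, lt_top_iff_ne_top.2 hmom⟩
  have hdQ : Integrable (fun x => |x - med|) Q := (hx.sub (integrable_const med)).abs
  have hmQ : Integrable (fun x => |x - ∫ y, y ∂Q|) Q := (hx.sub (integrable_const _)).abs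
  have e1 : 2 * ∫⁻ x, ENNReal.ofReal |x - med| ∂Q = ENNReal.ofReal (2 * ∫ x, |x - med| ∂Q) := by
    rw [← ofReal_integral_eq_lintegral_ofReal hdQ (ae_of_all _ fun x => abs_nonneg _),
      ENNReal.ofReal_mul (by norm_num)]
    simp
  constructor
  · rw [e1]
    rcases (integral_nonneg (μ := Q) (f := fun x => |x - med|)
      fun x => abs_nonneg _).eq_or_lt with h0 | h0
    · rw [← h0]; simp
    · rw [ENNReal.log_ofReal_of_pos (by positivity), ← EReal.coe_neg]
      exact iSup₂_le fun φ hφ => Lfun_le_s12 Q hx med hmed₁ hmed₂ hφ h0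
  · rw [EReal.neg_le_neg_iff]
    apply ENNReal.log_monotone
    rw [e1, ← ofReal_integral_eq_lintegral_ofReal hmQ (ae_of_all _ fun x => abs_nonneg _)]
    apply ENNReal.ofReal_le_ofReal
    have h1 : |med - ∫ y, y ∂Q| ≤ ∫ x, |x - med| ∂Q := by
      have : med - ∫ y, y ∂Q = - ∫ y, (y - med) ∂Q := by
        rw [integral_sub hx (integrable_const _)]; simp
      rw [this, abs_neg]
      exact abs_integral_le_integral_abs
    calc ∫ x, |x - ∫ y, y ∂Q| ∂Q ≤ ∫ x, (|x - med| + |med - ∫ y, y ∂Q|) ∂Q :=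
          integral_mono hmQ (hdQ.add (integrable_const _)) fun x => abs_sub_le _ _ _
      _ = ∫ x, |x - med| ∂Q + |med - ∫ y, y ∂Q| := by
          rw [integral_add hdQ (integrable_const _)]; simp
      _ ≤ _ := by linarith
end

section
/- Fix n ∈ ℕ, a set X, design points x_1, …, x_n ∈ X, observations Y_1, …, Y_n ∈ ℝ, and a family M of functions m : X → ℝ such that m + c ∈ M for all m ∈ M and c ∈ ℝ. For (φ, m) ∈ Φ(1) × M define Λ̂(φ, m) := n^{−1} ∑_{i=1}^n φ(Y_i − m(x_i)) − ∫_ℝ e^{φ(x)} dx + 1. If the set M(x) := { (m(x_1), …, m(x_n)) : m ∈ M } ⊂ ℝ^n is closed and does not contain the vector Y := (Y_1, …, Y_n), then there exists a maximizer (φ̂, m̂) of Λ̂(φ, m) over all (φ, m) ∈ Φ(1) × M. -/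
open MeasureTheory Filter Topology Set
open scoped ENNReal RealInnerProductSpace BoundedContinuousFunction

/-- The regression log-likelihood
`Λ̂(φ, m) = n⁻¹ ∑ᵢ φ(Yᵢ - m(xᵢ)) - ∫ e^{φ(x)} dx + 1`. -/
noncomputable def Lhat {X : Type*} {n : ℕ} (x : Fin n → X) (Y : Fin n → ℝ)
    (φ : ℝ → EReal) (m : X → ℝ) : EReal :=
  (((n : ℝ)⁻¹ : ℝ) : EReal) * (∑ i, φ (Y i - m (x i)))
    - ((∫⁻ t, EReal.exp (φ t) : ℝ≥0∞) : EReal) + 1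


/-- Pairwise interpolation, exponentiated. -/
noncomputable def pairE {n : ℕ} (i j : Fin n) (z : (Fin n → ℝ) × (Fin n → ℝ)) (t : ℝ) : ℝ≥0∞ :=
  if 0 < (t - z.1 i) * (z.1 j - t) then
    ENNReal.ofReal (Real.exp (z.2 i + (z.2 j - z.2 i) * ((t - z.1 i) / (z.1 j - z.1 i)))) else 0

noncomputable def hullE {n : ℕ} (z : (Fin n → ℝ) × (Fin n → ℝ)) (t : ℝ) : ℝ≥0∞ :=
  ⨆ i, ⨆ j, pairE i j z t

noncomputable def Ifun {n : ℕ} (z : (Fin n → ℝ) × (Fin n → ℝ)) : ℝ≥0∞ := ∫⁻ t, hullE z t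

noncomputable def Fval {n : ℕ} (z : (Fin n → ℝ) × (Fin n → ℝ)) : EReal :=
  (((n : ℝ)⁻¹ * ∑ i, z.2 i : ℝ) : EReal) + (-(Ifun z : EReal))

lemma pairE_lsc {n : ℕ} (i j : Fin n) (t : ℝ) :
    LowerSemicontinuous (fun z : (Fin n → ℝ) × (Fin n → ℝ) => pairE i j z t) := by
  intro z
  by_cases h : 0 < (t - z.1 i) * (z.1 j - t)
  · have hne : z.1 j - z.1 i ≠ 0 := by
      intro h0
      have : z.1 j = z.1 i := by linarith
      rw [this] at h
      nlinarith [sq_nonneg (t - z.1 i)]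
    apply ContinuousAt.lowerSemicontinuousAt
    have hev : ∀ᶠ z' : (Fin n → ℝ) × (Fin n → ℝ) in 𝓝 z, 0 < (t - z'.1 i) * (z'.1 j - t) := by
      have ho : IsOpen {z' : (Fin n → ℝ) × (Fin n → ℝ) | 0 < (t - z'.1 i) * (z'.1 j - t)} :=
        isOpen_lt continuous_const (by fun_prop)
      exact ho.mem_nhds h
    have hc : ContinuousAt (fun z : (Fin n → ℝ) × (Fin n → ℝ) => ENNReal.ofReal (Real.exp
        (z.2 i + (z.2 j - z.2 i) * ((t - z.1 i) / (z.1 j - z.1 i))))) z := by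
      apply ENNReal.continuous_ofReal.continuousAt.comp
      apply Real.continuous_exp.continuousAt.comp
      fun_prop (disch := assumption)
    refine hc.congr ?_
    filter_upwards [hev] with z' hz'
    simp [pairE, hz']
  · intro y hy
    simp [pairE, h] at hy

lemma pairE_meas {n : ℕ} (i j : Fin n) (z : (Fin n → ℝ) × (Fin n → ℝ)) :
    Measurable (pairE i j z) := by
  unfold pairE
  refine Measurable.ite (measurableSet_lt (by fun_prop) (by fun_prop)) (by fun_prop) (by fun_prop)

lemma hullE_meas {n : ℕ} (z : (Fin n → ℝ) × (Fin n → ℝ)) : Measurable (hullE z) := by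
  unfold hullE
  exact Measurable.iSup fun i => Measurable.iSup fun j => pairE_meas i j z

lemma hullE_lsc {n : ℕ} (t : ℝ) :
    LowerSemicontinuous (fun z : (Fin n → ℝ) × (Fin n → ℝ) => hullE z t) :=
  lowerSemicontinuous_iSup fun i => lowerSemicontinuous_iSup fun j => pairE_lsc i j t

lemma Ifun_lsc {n : ℕ} : LowerSemicontinuous (Ifun : (Fin n → ℝ) × (Fin n → ℝ) → ℝ≥0∞) := by
  intro z y hy
  have h1 : Ifun z ≤ ∫⁻ t, liminf (fun z' => hullE z' t) (𝓝 z) := by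
    apply lintegral_mono
    intro t
    rw [Filter.le_liminf_iff]
    intro y hy
    exact hullE_lsc t z y hy
  have h2 := lintegral_liminf_le (μ := (volume : Measure ℝ)) (u := 𝓝 z)
    (f := fun z' t => hullE z' t) (fun z' => hullE_meas z')
  exact eventually_lt_of_lt_liminf (hy.trans_le (h1.trans h2))

lemma Fval_usc {n : ℕ} : UpperSemicontinuous (Fval : (Fin n → ℝ) × (Fin n → ℝ) → EReal) := by
  unfold Fval
  apply UpperSemicontinuous.add'
  · apply Continuous.upperSemicontinuous
    apply continuous_coe_real_ereal.comp
    fun_prop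
  · have hc : Continuous (fun a : ℝ≥0∞ => -(a : EReal)) :=
      continuous_neg.comp continuous_coe_ennreal_ereal
    refine hc.comp_lowerSemicontinuous_antitone Ifun_lsc ?_
    intro a b hab
    simpa using hab
  · intro z
    exact EReal.continuousAt_add (Or.inl (EReal.coe_ne_top _)) (Or.inl (EReal.coe_ne_bot _))

/-- Any concave function dominates the hull. -/
lemma Ifun_le {n : ℕ} (z : (Fin n → ℝ) × (Fin n → ℝ)) (ψ : ℝ → EReal)
    (hψ : ∀ x y : ℝ, ∀ a b : ℝ, 0 < a → 0 < b → a + b = 1 →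
      (a : EReal) * ψ x + (b : EReal) * ψ y ≤ ψ (a • x + b • y))
    (hz : ∀ i, ψ (z.1 i) = (z.2 i : ℝ)) : Ifun z ≤ ∫⁻ t, EReal.exp (ψ t) := by
  apply lintegral_mono
  intro t
  refine iSup_le fun i => iSup_le fun j => ?_
  unfold pairE
  split_ifs with h
  swap
  · exact zero_le
  have hne : z.1 j - z.1 i ≠ 0 := by
    intro h0
    have : z.1 j = z.1 i := by linarith
    rw [this] at h
    nlinarith [sq_nonneg (t - z.1 i)]
  rw [← EReal.exp_coe]
  apply EReal.exp_monotone
  set s := (t - z.1 i) / (z.1 j - z.1 i) with hs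
  have hs1 : s * (z.1 j - z.1 i) = t - z.1 i := by rw [hs]; field_simp
  have hss : 0 < s * (1 - s) := by
    have : s * (1 - s) * (z.1 j - z.1 i)^2 = (t - z.1 i) * (z.1 j - t) := by
      have : z.1 j - t = (1 - s) * (z.1 j - z.1 i) := by linarith
      rw [this, ← hs1]; ring
    rw [← this] at h
    exact pos_of_mul_pos_left h (sq_nonneg _)
  have h0 : 0 < s := by nlinarith
  have h1 : 0 < 1 - s := by nlinarith
  have := hψ (z.1 i) (z.1 j) (1 - s) s h1 h0 (by ring)
  rw [hz, hz] at this
  have e : (1 - s) • z.1 i + s • z.1 j = t := by simp only [smul_eq_mul]; linarith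
  rw [e] at this
  refine le_trans (le_of_eq ?_) this
  norm_cast
  ring

/-- least concave majorant -/
noncomputable def concMaj {n : ℕ} (z : (Fin n → ℝ) × (Fin n → ℝ)) (t : ℝ) : EReal :=
  ⨅ p : {p : ℝ × ℝ // ∀ i, z.2 i ≤ p.1 * z.1 i + p.2}, ((p.1.1 * t + p.1.2 : ℝ) : EReal)

lemma concMaj_ge {n : ℕ} (z : (Fin n → ℝ) × (Fin n → ℝ)) (i : Fin n) :
    ((z.2 i : ℝ) : EReal) ≤ concMaj z (z.1 i) := by
  refine le_iInf fun p => ?_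
  exact_mod_cast p.2 i

lemma concMaj_le {n : ℕ} (z : (Fin n → ℝ) × (Fin n → ℝ)) (a b : ℝ)
    (h : ∀ i, z.2 i ≤ a * z.1 i + b) (t : ℝ) : concMaj z t ≤ ((a * t + b : ℝ) : EReal) :=
  iInf_le (fun p : {p : ℝ × ℝ // ∀ i, z.2 i ≤ p.1 * z.1 i + p.2} =>
    ((p.1.1 * t + p.1.2 : ℝ) : EReal)) ⟨(a, b), h⟩

lemma exists_ub {n : ℕ} (f : Fin n → ℝ) : ∃ B, ∀ i, f i ≤ B := by
  obtain ⟨B, hB⟩ := (Set.finite_range f).bddAbove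
  exact ⟨B, fun i => hB ⟨i, rfl⟩⟩

/-- Outside the hull the majorant is `⊥`; `σ` is the orientation. -/
lemma concMaj_bot {n : ℕ} (z : (Fin n → ℝ) × (Fin n → ℝ)) (t σ : ℝ)
    (h : ∀ i, 0 < σ * (t - z.1 i)) : concMaj z t = ⊥ := by
  rw [EReal.eq_bot_iff_forall_lt]
  intro c
  obtain ⟨B, hB⟩ := exists_ub (fun i => (z.2 i - (c - 1)) / (σ * (t - z.1 i)))
  refine lt_of_le_of_lt (concMaj_le z (-(B * σ)) (c - 1 + B * σ * t) ?_ t) ?_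
  · intro i
    have := hB i
    rw [div_le_iff₀ (h i)] at this
    linarith
  · norm_cast
    linarith

lemma concMaj_isPhi {n : ℕ} (z : (Fin n → ℝ) × (Fin n → ℝ)) : IsPhi (concMaj z) := by
  refine ⟨?_, ?_, ?_, ?_⟩
  · apply upperSemicontinuous_iInf
    intro p
    apply Continuous.upperSemicontinuous
    apply continuous_coe_real_ereal.comp
    fun_prop
  · intro t
    obtain ⟨B, hB⟩ := exists_ub z.2
    exact ((concMaj_le z 0 B (by simpa using hB) t).trans_lt (EReal.coe_lt_top _)).ne
  · intro x y a b ha hb hab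
    refine le_iInf fun p => ?_
    have h1 := concMaj_le z p.1.1 p.1.2 p.2 x
    have h2 := concMaj_le z p.1.1 p.1.2 p.2 y
    have h3 := mul_le_mul_of_nonneg_left h1 (EReal.coe_nonneg.2 ha.le)
    have h4 := mul_le_mul_of_nonneg_left h2 (EReal.coe_nonneg.2 hb.le)
    refine (add_le_add h3 h4).trans (le_of_eq ?_)
    norm_cast
    simp only [smul_eq_mul]
    linear_combination p.1.2 * hab
  · obtain ⟨B, hB⟩ := exists_ub (fun i => |z.1 i|)
    apply tendsto_const_nhds.congr'
    have : ∀ᶠ x in Filter.comap (fun x : ℝ => ‖x‖) atTop, B < ‖x‖ :=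
      (eventually_gt_atTop B).comap _
    filter_upwards [this] with t ht
    symm
    rw [Real.norm_eq_abs] at ht
    rcases lt_abs.1 ht with h | h
    · refine concMaj_bot z t 1 fun i => ?_
      have := abs_le.1 (hB i)
      linarith
    · refine concMaj_bot z t (-1) fun i => ?_
      have := abs_le.1 (hB i)
      linarith

lemma concMaj_int {n : ℕ} (z : (Fin n → ℝ) × (Fin n → ℝ)) :
    ∫⁻ t, EReal.exp (concMaj z t) ≤ Ifun z := by
  apply lintegral_mono_ae
  have hfin : (Set.range z.1).Finite := Set.finite_range _
  have : ∀ᵐ t : ℝ, t ∉ Set.range z.1 := hfin.measure_zero volume |> measure_eq_zero_iff_ae_notMem.1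
  filter_upwards [this] with t ht
  have hne : ∀ i, z.1 i ≠ t := fun i h => ht ⟨i, h⟩
  by_cases hR : ∃ j, t < z.1 j
  swap
  · push Not at hR
    rw [concMaj_bot z t 1 (fun i => by have := lt_of_le_of_ne (hR i) (hne i); linarith)]
    simp
  by_cases hL : ∃ i, z.1 i < t
  swap
  · push Not at hL
    rw [concMaj_bot z t (-1) (fun i => by have := lt_of_le_of_ne (hL i) (hne i).symm; linarith)]
    simp
  -- best pair
  let P : Finset (Fin n × Fin n) := Finset.univ.filter fun p => z.1 p.1 < t ∧ t < z.1 p.2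
  let v : Fin n × Fin n → ℝ := fun p =>
    z.2 p.1 + (z.2 p.2 - z.2 p.1) * ((t - z.1 p.1) / (z.1 p.2 - z.1 p.1))
  obtain ⟨i1, hi1⟩ := hL
  obtain ⟨j1, hj1⟩ := hR
  obtain ⟨p, hp, hmax⟩ := P.exists_max_image v ⟨(i1, j1), by simp [P, hi1, hj1]⟩
  have hp' : z.1 p.1 < t ∧ t < z.1 p.2 := by simpa [P] using hp
  let Q : Finset (Fin n) := Finset.univ.filter fun j => t < z.1 j
  obtain ⟨j0, hj0, hjmax⟩ := Q.exists_max_image (fun j => (z.2 j - v p) / (z.1 j - t))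
    ⟨j1, by simp [Q, hj1]⟩
  have hj0' : t < z.1 j0 := by simpa [Q] using hj0
  set a := (z.2 j0 - v p) / (z.1 j0 - t) with ha
  have ha' : a * (z.1 j0 - t) = z.2 j0 - v p := by
    rw [ha]; field_simp [(sub_pos.2 hj0').ne']
  have hmaj : ∀ i, z.2 i ≤ a * z.1 i + (v p - a * t) := by
    intro i
    rcases lt_or_gt_of_ne (hne i) with h | h
    · have h1 := hmax (i, j0) (by simp [P, h, hj0'])
      have h2 : v (i, j0) * (z.1 j0 - z.1 i) =
          z.2 i * (z.1 j0 - t) + z.2 j0 * (t - z.1 i) := by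
        have : z.1 j0 - z.1 i ≠ 0 := by linarith
        simp only [v]
        field_simp
        ring
      have h3 := mul_le_mul_of_nonneg_right h1 (show 0 ≤ z.1 j0 - z.1 i by linarith)
      rw [h2] at h3
      have h4 : z.2 j0 = v p + a * (z.1 j0 - t) := by linarith
      rw [h4] at h3
      have h5 : (z.2 i - v p + a * (t - z.1 i)) * (z.1 j0 - t) ≤ 0 := by nlinarith
      have h6 : z.2 i - v p + a * (t - z.1 i) ≤ 0 :=
        nonpos_of_mul_nonpos_left h5 (by linarith)
      linarith
    · have h1 := hjmax i (by simpa [Q] using h)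
      have h1' : (z.2 i - v p) / (z.1 i - t) ≤ a := h1
      rw [div_le_iff₀ (by linarith)] at h1'
      linarith
  have h1 := concMaj_le z a (v p - a * t) hmaj t
  have h2 : a * t + (v p - a * t) = v p := by ring
  rw [h2] at h1
  refine (EReal.exp_monotone h1).trans ?_
  refine le_trans (le_of_eq ?_) (le_iSup_of_le p.1 (le_iSup_of_le p.2 le_rfl))
  rw [EReal.exp_coe, pairE, if_pos (mul_pos (by linarith [hp'.1]) (by linarith [hp'.2]))]


lemma real_bound (n F0 δ : ℝ) (hn : 1 ≤ n) (hδ : 0 < δ) : ∃ B : ℝ, ∀ M a R : ℝ, 0 ≤ a → δ ≤ R →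
    F0 ≤ M - n⁻¹ * a - R * Real.exp (M - 1) / (4 * (2 + a)) → |M| ≤ B ∧ a ≤ B ∧ R ≤ B := by
  set κ := δ * Real.exp (F0 - 1) with hκ
  have hκ0 : 0 < κ := by positivity
  set U := max 1 (6 * (8 + 4 * n) / κ) with hU
  set E := Real.exp (F0 - 1) with hE
  have hE0 : 0 < E := Real.exp_pos _
  have hU1 : 1 ≤ U := le_max_left _ _
  refine ⟨|F0| + U + n * U + 4 * (2 + n * U) * U / E, ?_⟩
  intro M a R ha hR h
  have hn0 : 0 < n := by linarith
  have hR0 : 0 < R := by linarith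
  set T := R * Real.exp (M - 1) / (4 * (2 + a)) with hT
  have hT0 : 0 < T := by positivity
  have hna : 0 ≤ n⁻¹ * a := by positivity
  set u := M - F0 with hu
  have hu0 : 0 ≤ u := by linarith
  have hau : a ≤ n * u := by
    have : n⁻¹ * a ≤ u := by linarith
    rw [inv_mul_le_iff₀ hn0] at this
    exact this
  have hTu : R * Real.exp (M - 1) ≤ 4 * (2 + n * u) * u := by
    have h1 : T ≤ u := by linarith
    rw [hT, div_le_iff₀ (by positivity)] at h1
    nlinarith [mul_le_mul_of_nonneg_left hau hu0]
  have hexp : Real.exp (M - 1) = E * Real.exp u := by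
    rw [hE, ← Real.exp_add]; congr 1; rw [hu]; ring
  have hcub : u ^ 3 / 6 ≤ Real.exp u := by
    have := Real.pow_div_factorial_le_exp u hu0 3
    simpa [Nat.factorial] using this
  have huU : u ≤ U := by
    by_contra hc
    push Not at hc
    have h1 : 1 < u := lt_of_le_of_lt hU1 hc
    have h2 : 6 * (8 + 4 * n) / κ < u := lt_of_le_of_lt (le_max_right _ _) hc
    rw [div_lt_iff₀ hκ0] at h2
    have h3 : κ * (u ^ 3 / 6) ≤ 4 * (2 + n * u) * u := by
      calc κ * (u ^ 3 / 6) ≤ κ * Real.exp u := by gcongr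
        _ = δ * Real.exp (M - 1) := by rw [hexp, hκ]; ring
        _ ≤ R * Real.exp (M - 1) := by gcongr
        _ ≤ _ := hTu
    have h4 : 4 * (2 + n * u) * u ≤ (8 + 4 * n) * u ^ 2 := by nlinarith
    have h5 : (8 + 4 * n) * u ^ 2 < κ * (u ^ 3 / 6) := by
      have := mul_lt_mul_of_pos_right h2 (show 0 < u ^ 2 / 6 by positivity)
      nlinarith
    linarith
  have hRB : R ≤ 4 * (2 + n * U) * U / E := by
    rw [le_div_iff₀ hE0]
    have h1 : R * E ≤ R * Real.exp (M - 1) := by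
      apply mul_le_mul_of_nonneg_left _ hR0.le
      rw [hE]; apply Real.exp_le_exp.2; linarith
    have h2 : 4 * (2 + n * u) * u ≤ 4 * (2 + n * U) * U := by gcongr
    linarith
  have p1 : 0 ≤ n * U := by positivity
  have p2 : 0 ≤ 4 * (2 + n * U) * U / E := by positivity
  have p3 := abs_nonneg F0
  have hnu : n * u ≤ n * U := by gcongr
  refine ⟨?_, by linarith, by linarith⟩
  have : M = F0 + u := by rw [hu]; ring
  rw [this]
  have := abs_add_le F0 u
  rw [abs_of_nonneg hu0] at this
  linarith

lemma Ifun_ge {n : ℕ} (z : (Fin n → ℝ) × (Fin n → ℝ)) (p q : Fin n) (a : ℝ) (ha : 0 ≤ a)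
    (hq : z.2 p - a ≤ z.2 q) (hd : z.1 q - z.1 p ≠ 0) :
    ENNReal.ofReal (Real.exp (z.2 p - 1) * (|z.1 q - z.1 p| / (2 * (2 + a)))) ≤ Ifun z := by
  set d := z.1 q - z.1 p with hdd
  set A := uIcc (z.1 p + d * (1 / (2 * (2 + a)))) (z.1 p + d * (1 / (2 + a))) with hA
  have hvol : volume A = ENNReal.ofReal (|d| / (2 * (2 + a))) := by
    rw [hA, Real.volume_interval]
    congr 1
    have : z.1 p + d * (1 / (2 + a)) - (z.1 p + d * (1 / (2 * (2 + a)))) =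
        d / (2 * (2 + a)) := by
      field_simp; ring
    rw [this, abs_div, abs_of_pos (show 0 < 2 * (2 + a) by positivity)]
  have hlow : ∀ t ∈ A, ENNReal.ofReal (Real.exp (z.2 p - 1)) ≤ hullE z t := by
    intro t ht
    refine le_trans ?_ (le_iSup_of_le p (le_iSup_of_le q le_rfl))
    set s := (t - z.1 p) / d with hs
    have hts : t - z.1 p = d * s := by rw [hs]; field_simp
    have hs12 : 1 / (2 * (2 + a)) ≤ s ∧ s ≤ 1 / (2 + a) := by
      have ht' : t = z.1 p + d * s := by linarith
      rcases lt_or_gt_of_ne hd with h | h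
      · have hle : z.1 p + d * (1 / (2 + a)) ≤ z.1 p + d * (1 / (2 * (2 + a))) := by
          have : 1 / (2 * (2 + a)) ≤ 1 / (2 + a) := by
            apply one_div_le_one_div_of_le <;> linarith
          nlinarith
        rw [hA, uIcc_of_ge hle, ht'] at ht
        obtain ⟨h1, h2⟩ := ht
        constructor
        · exact (mul_le_mul_left_of_neg h).1 (show d * s ≤ d * (1 / (2 * (2 + a))) by linarith)
        · exact (mul_le_mul_left_of_neg h).1 (show d * (1 / (2 + a)) ≤ d * s by linarith)
      · have hle : z.1 p + d * (1 / (2 * (2 + a))) ≤ z.1 p + d * (1 / (2 + a)) := by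
          have : 1 / (2 * (2 + a)) ≤ 1 / (2 + a) := by
            apply one_div_le_one_div_of_le <;> linarith
          nlinarith
        rw [hA, uIcc_of_le hle, ht'] at ht
        obtain ⟨h1, h2⟩ := ht
        constructor
        · exact le_of_mul_le_mul_left (show d * (1 / (2 * (2 + a))) ≤ d * s by linarith) h
        · exact le_of_mul_le_mul_left (show d * s ≤ d * (1 / (2 + a)) by linarith) h
    have hs0 : 0 < s := lt_of_lt_of_le (by positivity) hs12.1
    have hsa : s * (2 + a) ≤ 1 := by
      have := hs12.2
      rwa [le_div_iff₀ (by positivity)] at this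
    have hs1 : s < 1 := by nlinarith
    have hpos : 0 < (t - z.1 p) * (z.1 q - t) := by
      have : z.1 q - t = d * (1 - s) := by rw [hdd] at hts ⊢; linarith
      rw [this, hts]
      have : 0 < d ^ 2 := by positivity
      have h1 : 0 < s * (1 - s) := mul_pos hs0 (by linarith)
      nlinarith [mul_pos this h1]
    rw [pairE, if_pos hpos]
    apply ENNReal.ofReal_le_ofReal
    apply Real.exp_le_exp.2
    rw [← hdd, ← hs]
    nlinarith
  calc _ = ENNReal.ofReal (Real.exp (z.2 p - 1)) * volume A := by
        rw [hvol, ← ENNReal.ofReal_mul (Real.exp_pos _).le]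
    _ = ∫⁻ t in A, ENNReal.ofReal (Real.exp (z.2 p - 1)) := by simp
    _ ≤ ∫⁻ t in A, hullE z t := setLIntegral_mono (hullE_meas z) hlow
    _ ≤ _ := setLIntegral_le_lintegral _ _

lemma coercive {n : ℕ} (i0 : Fin n) (F0 δ : ℝ) (hδ : 0 < δ) :
    ∃ B : ℝ, ∀ z : (Fin n → ℝ) × (Fin n → ℝ), z.1 i0 = 0 → (∃ i, δ ≤ |z.1 i|) →
      (F0 : EReal) ≤ Fval z → ‖z‖ ≤ B := by
  have hn : (1 : ℝ) ≤ n := by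
    have : 0 < n := i0.pos
    exact_mod_cast this
  obtain ⟨B, hB⟩ := real_bound n F0 δ hn hδ
  refine ⟨2 * B, fun z hz0 ⟨i1, hi1⟩ hF => ?_⟩
  have : Nonempty (Fin n) := ⟨i0⟩
  obtain ⟨p, -, hp⟩ := Finset.univ.exists_max_image z.2 ⟨i0, Finset.mem_univ _⟩
  obtain ⟨k, -, hk⟩ := Finset.univ.exists_min_image z.2 ⟨i0, Finset.mem_univ _⟩
  obtain ⟨q, -, hq⟩ := Finset.univ.exists_max_image (fun i => |z.1 i - z.1 p|)
    ⟨i0, Finset.mem_univ _⟩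
  have hr : ∀ i, |z.1 i| ≤ 2 * |z.1 q - z.1 p| := by
    intro i
    have h1 := hq i (Finset.mem_univ _)
    have h2 := hq i0 (Finset.mem_univ _)
    simp only [hz0] at h1 h2
    have := abs_sub (z.1 i - z.1 p) (0 - z.1 p)
    have e : z.1 i - z.1 p - (0 - z.1 p) = z.1 i := by ring
    rw [e] at this
    linarith
  set D := |z.1 q - z.1 p| with hD
  have hδD : δ ≤ 2 * D := hi1.trans (hr i1)
  have hd : z.1 q - z.1 p ≠ 0 := by
    intro h
    rw [h, abs_zero] at hD
    linarith
  set a := z.2 p - z.2 k with ha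
  have ha0 : 0 ≤ a := sub_nonneg.2 (hp k (Finset.mem_univ _))
  have hI := Ifun_ge z p q a ha0 (by have := hk q (Finset.mem_univ _); linarith) hd
  rw [← hD] at hI
  set L := Real.exp (z.2 p - 1) * (D / (2 * (2 + a))) with hL
  have hL0 : 0 ≤ L := by positivity
  have hmean : (n : ℝ)⁻¹ * ∑ i, z.2 i ≤ z.2 p - (n : ℝ)⁻¹ * a := by
    have h1 : a ≤ ∑ i, (z.2 p - z.2 i) :=
      Finset.single_le_sum (f := fun i => z.2 p - z.2 i)
        (fun i hi => sub_nonneg.2 (hp i hi)) (Finset.mem_univ k)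
    have h2 : ∑ i, (z.2 p - z.2 i) = n * z.2 p - ∑ i, z.2 i := by
      rw [Finset.sum_sub_distrib]; simp
    rw [h2] at h1
    have hn0 : (0 : ℝ) < n := by linarith
    have h3 := mul_le_mul_of_nonneg_left h1 (inv_nonneg.2 hn0.le)
    have h4 : (n : ℝ)⁻¹ * (n * z.2 p - ∑ i, z.2 i) = z.2 p - (n : ℝ)⁻¹ * ∑ i, z.2 i := by
      field_simp
    linarith
  have hFr : F0 ≤ (n : ℝ)⁻¹ * ∑ i, z.2 i - L := by
    have h1 : (L : EReal) ≤ (Ifun z : EReal) := by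
      have : ((ENNReal.ofReal L : ℝ≥0∞) : EReal) ≤ (Ifun z : EReal) :=
        EReal.coe_ennreal_le_coe_ennreal_iff.2 hI
      rwa [EReal.coe_ennreal_ofReal, max_eq_left hL0] at this
    have h2 : Fval z ≤ (((n : ℝ)⁻¹ * ∑ i, z.2 i : ℝ) : EReal) + (-(L : EReal)) := by
      unfold Fval
      gcongr
      exact EReal.neg_le_neg_iff.2 h1
    have h3 := hF.trans h2
    rw [← EReal.coe_neg, ← EReal.coe_add, EReal.coe_le_coe_iff] at h3
    linarith
  have hfin := hB (z.2 p) a (2 * D) ha0 hδD (by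
    have : 2 * D * Real.exp (z.2 p - 1) / (4 * (2 + a)) = L := by
      rw [hL]; field_simp; ring
    rw [this]; linarith)
  obtain ⟨h1, h2, h3⟩ := hfin
  have hB0 : 0 ≤ B := (abs_nonneg _).trans h1
  rw [Prod.norm_def]
  refine max_le ?_ ?_
  · rw [pi_norm_le_iff_of_nonneg (by linarith)]
    intro i
    have := hr i
    rw [Real.norm_eq_abs]
    linarith
  · rw [pi_norm_le_iff_of_nonneg (by linarith)]
    intro i
    have h4 := abs_le.1 h1
    have h5 := hp i (Finset.mem_univ _)
    have h6 := hk i (Finset.mem_univ _)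
    rw [Real.norm_eq_abs, abs_le]
    constructor <;> linarith

lemma Ifun_zero {n : ℕ} (r : Fin n → ℝ) : Ifun (r, (0 : Fin n → ℝ)) ≠ ⊤ := by
  obtain ⟨B, hB⟩ := exists_ub (fun i => |r i|)
  have : Ifun (r, (0 : Fin n → ℝ)) ≤ ∫⁻ t, (Icc (-B) B).indicator (fun _ => (1 : ℝ≥0∞)) t := by
    apply lintegral_mono
    intro t
    refine iSup_le fun i => iSup_le fun j => ?_
    unfold pairE
    split_ifs with h
    · have h1 := abs_le.1 (hB i)
      have h2 := abs_le.1 (hB j)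
      have ht : t ∈ Icc (-B) B := by
        rcases pos_and_pos_or_neg_and_neg_of_mul_pos h with h | h <;>
          constructor <;> simp only at h <;> linarith [h.1, h.2]
      simp [ht]
    · exact zero_le
  refine (this.trans_lt ?_).ne
  rw [lintegral_indicator measurableSet_Icc]
  simp

/-- **Theorem 5 (existence in regression).** If the (nonempty) fitted-value set
`M(x) ⊆ ℝⁿ` is closed and does not contain `Y`, then `Λ̂` has a maximizer over
`Φ(1) × M`. -/
theorem exists_regression_MLE {X : Type*} {n : ℕ} (x : Fin n → X) (Y : Fin n → ℝ)
    (M : Set (X → ℝ)) (hM : M.Nonempty)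
    (hshift : ∀ m ∈ M, ∀ c : ℝ, (fun t => m t + c) ∈ M)
    (hclosed : IsClosed {v : Fin n → ℝ | ∃ m ∈ M, v = fun i => m (x i)})
    (hY : Y ∉ {v : Fin n → ℝ | ∃ m ∈ M, v = fun i => m (x i)}) :
    ∃ (φ : ℝ → EReal) (m : X → ℝ), IsPhi φ ∧ m ∈ M ∧
      ∀ (φ' : ℝ → EReal) (m' : X → ℝ), IsPhi φ' → m' ∈ M →
        Lhat x Y φ' m' ≤ Lhat x Y φ m := by
  obtain ⟨m0, hm0⟩ := hM
  rcases Nat.eq_zero_or_pos n with hn | hn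
  · subst hn
    exact absurd ⟨m0, hm0, Subsingleton.elim _ _⟩ hY
  let i0 : Fin n := ⟨0, hn⟩
  have hninv : (0 : ℝ) < (n : ℝ)⁻¹ := by
    have : (0 : ℝ) < n := by exact_mod_cast hn
    positivity
  set S : Set (Fin n → ℝ) := {v | ∃ m ∈ M, v = fun i => m (x i)} with hS
  let S0 : Set (Fin n → ℝ) := {r | r i0 = 0 ∧ Y - r ∈ S}
  have hS0c : IsClosed S0 := by
    apply IsClosed.inter
    · exact isClosed_eq (by fun_prop) continuous_const
    · exact hclosed.preimage (by fun_prop)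
  have h0 : (0 : Fin n → ℝ) ∉ S0 := by
    rintro ⟨-, h⟩
    rw [sub_zero] at h
    exact hY h
  obtain ⟨δ, hδ, hball⟩ := Metric.isOpen_iff.1 hS0c.isOpen_compl 0 h0
  have hspread : ∀ r ∈ S0, ∃ i, δ ≤ |r i| := by
    intro r hr
    by_contra hc
    push Not at hc
    have : r ∈ Metric.ball (0 : Fin n → ℝ) δ := by
      rw [mem_ball_zero_iff, pi_norm_lt_iff hδ]
      exact hc
    exact hball this hr
  have hnorm : ∀ m ∈ M, (fun i => Y i - m (x i) - (Y i0 - m (x i0))) ∈ S0 := by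
    intro m hm
    refine ⟨by simp, _, hshift m hm (Y i0 - m (x i0)), ?_⟩
    ext i
    simp only [Pi.sub_apply]
    ring
  -- baseline
  set z0 : (Fin n → ℝ) × (Fin n → ℝ) := (fun i => Y i - m0 (x i) - (Y i0 - m0 (x i0)), 0) with hz0
  have hI0 : Ifun z0 ≠ ⊤ := Ifun_zero _
  obtain ⟨F0, hF0⟩ : ∃ F0 : ℝ, (F0 : EReal) = Fval z0 := by
    refine ⟨(n : ℝ)⁻¹ * ∑ i, z0.2 i + -(Ifun z0).toReal, ?_⟩
    rw [Fval, EReal.coe_add, EReal.coe_neg, EReal.coe_ennreal_toReal hI0]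
  obtain ⟨B, hB⟩ := coercive i0 F0 δ hδ
  let K : Set ((Fin n → ℝ) × (Fin n → ℝ)) := {z | z.1 ∈ S0} ∩ Fval ⁻¹' (Ici (F0 : EReal))
  have hKc : IsClosed K :=
    (hS0c.preimage continuous_fst).inter (Fval_usc.isClosed_preimage _)
  have hKb : Bornology.IsBounded K := by
    refine (Metric.isBounded_closedBall (x := 0) (r := B)).subset ?_
    rintro z ⟨hz1, hz2⟩
    rw [mem_closedBall_zero_iff]
    exact hB z hz1.1 (hspread _ hz1) hz2
  have hKcomp : IsCompact K := Metric.isCompact_of_isClosed_isBounded hKc hKb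
  have hz0K : z0 ∈ K := ⟨hnorm m0 hm0, hF0.le⟩
  obtain ⟨zh, hzhK, hmax⟩ := UpperSemicontinuousOn.exists_isMaxOn ⟨z0, hz0K⟩ hKcomp
    (Fval_usc.upperSemicontinuousOn K)
  have hbest : ∀ z : (Fin n → ℝ) × (Fin n → ℝ), z.1 ∈ S0 → Fval z ≤ Fval zh := by
    intro z hz
    by_cases h : (F0 : EReal) ≤ Fval z
    · exact hmax ⟨hz, h⟩
    · exact (not_le.1 h).le.trans hzhK.2
  obtain ⟨⟨-, mh, hmh, hYm⟩, -⟩ := hzhK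
  refine ⟨concMaj zh, mh, concMaj_isPhi zh, hmh, ?_⟩
  have hlow : Fval zh + 1 ≤ Lhat x Y (concMaj zh) mh := by
    unfold Fval Lhat
    rw [sub_eq_add_neg]
    gcongr
    · rw [EReal.coe_mul]
      apply mul_le_mul_of_nonneg_left _ (EReal.coe_nonneg.2 hninv.le)
      have : ((∑ i, zh.2 i : ℝ) : EReal) = ∑ i, ((zh.2 i : ℝ) : EReal) := by
        exact map_sum (⟨⟨Real.toEReal, EReal.coe_zero⟩, EReal.coe_add⟩ : ℝ →+ EReal) _ _
      rw [this]
      apply Finset.sum_le_sum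
      intro i _
      have e : Y i - mh (x i) = zh.1 i := by
        have := congrFun hYm i
        simp only [Pi.sub_apply] at this
        linarith
      rw [e]
      exact concMaj_ge zh i
    · exact EReal.neg_le_neg_iff.2 (EReal.coe_ennreal_le_coe_ennreal_iff.2 (concMaj_int zh))
  intro φ' m' hφ' hm'
  refine le_trans ?_ hlow
  by_cases hbot : ∃ i, φ' (Y i - m' (x i)) = ⊥
  · obtain ⟨i, hi⟩ := hbot
    have hs : ∑ i, φ' (Y i - m' (x i)) = ⊥ := by
      rw [← Finset.add_sum_erase _ _ (Finset.mem_univ i), hi, EReal.bot_add]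
    unfold Lhat
    rw [hs, EReal.coe_mul_bot_of_pos hninv]
    simp
  push Not at hbot
  set c := Y i0 - m' (x i0) with hc
  set z : (Fin n → ℝ) × (Fin n → ℝ) :=
    (fun i => Y i - m' (x i) - c, fun i => (φ' (Y i - m' (x i))).toReal) with hz
  have hw : ∀ i, ((z.2 i : ℝ) : EReal) = φ' (Y i - m' (x i)) := fun i =>
    EReal.coe_toReal (hφ'.2.1 _) (hbot i)
  have hIle : Ifun z ≤ ∫⁻ t, EReal.exp (φ' t) := by
    have h1 := Ifun_le z (fun t => φ' (t + c)) (by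
      intro u v a b ha hb hab
      have := hφ'.2.2.1 (u + c) (v + c) a b ha hb hab
      have e : a • (u + c) + b • (v + c) = a • u + b • v + c := by
        simp only [smul_eq_mul]
        linear_combination c * hab
      rwa [e] at this) (by
      intro i
      rw [hw]
      simp [hz])
    refine h1.trans (le_of_eq ?_)
    exact lintegral_add_right_eq_self (fun t => EReal.exp (φ' t)) c
  refine le_trans ?_ (add_le_add_left (hbest z (hnorm m' hm')) 1)
  unfold Fval Lhat
  rw [sub_eq_add_neg]
  gcongr
  · rw [EReal.coe_mul]
    have : ((∑ i, z.2 i : ℝ) : EReal) = ∑ i, ((z.2 i : ℝ) : EReal) := by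
      exact map_sum (⟨⟨Real.toEReal, EReal.coe_zero⟩, EReal.coe_add⟩ : ℝ →+ EReal) _ _
    rw [this]
    simp only [hw]
    exact le_rfl
  · exact EReal.neg_le_neg_iff.2 (EReal.coe_ennreal_le_coe_ennreal_iff.2 hIle)
end
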